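/- For every positive integer m there exists a real constant C = C(m) with the following property. Let F_q be a finite field with q elements and characteristic p, and let f_1, ..., f_r ∈ F_q[T,X] be pairwise non-associate absolutely irreducible polynomials such that for each i, writing d_i for the total degree of f_i, one has d_i ≥ 2, p does not divide d_i(d_i − 1), the projective plane curve defined by the homogenization of f_i is smooth, and ∑_{i=1}^r d_i ≤ m. Set d = ∏_{i=1}^r d_i and let N be the number of pairs (a_1, a_2) ∈ F_q × F_q such that f_i(T, a_1·T + a_2) is irreducible in F_q[T] for every i = 1, ..., r. Then |N − q²/d| ≤ C · q^{3/2}. -/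

import Mathlib

section
open MvPolynomial

/-- The univariate polynomial `f(T, a₁·T + a₂) ∈ K[T]` obtained from `f ∈ K[T,X]`
(variable `0` is `T`, variable `1` is `X`) by substituting `X := a₁·T + a₂`. -/
noncomputable def lineSub {K : Type*} [CommSemiring K] (f : MvPolynomial (Fin 2) K)
    (a₁ a₂ : K) : Polynomial K :=
  MvPolynomial.aeval ![Polynomial.X, Polynomial.C a₁ * Polynomial.X + Polynomial.C a₂] f

/-- `f ∈ K[T,X]` is absolutely irreducible: it is irreducible over an algebraic
closure of `K`. -/
def AbsolutelyIrreducible {K : Type*} [Field K] (f : MvPolynomial (Fin 2) K) : Prop :=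
  Irreducible (MvPolynomial.map (algebraMap K (AlgebraicClosure K)) f)

/-- `F ∈ K[X₀,X₁,X₂]` is the degree-`d` homogenization of `f ∈ K[T,X]`
(so `F` is homogeneous of degree `d` with `F(1,T,X) = f(T,X)`) and the projective
plane curve `F = 0` is smooth: `F` and its three partial derivatives have no common
zero `≠ (0,0,0)` with coordinates in an algebraic closure of `K`. -/
def IsSmoothHomogenization {K : Type*} [Field K] (F : MvPolynomial (Fin 3) K)
    (f : MvPolynomial (Fin 2) K) (d : ℕ) : Prop :=
  F.IsHomogeneous d ∧
  MvPolynomial.aeval ![1, MvPolynomial.X 0, MvPolynomial.X 1] F = f ∧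
  ∀ x : Fin 3 → AlgebraicClosure K, x ≠ 0 →
    MvPolynomial.eval x (F.map (algebraMap K (AlgebraicClosure K))) = 0 →
    ∃ j : Fin 3, MvPolynomial.eval x ((MvPolynomial.pderiv j F).map
      (algebraMap K (AlgebraicClosure K))) ≠ 0


end

section
open Polynomial
open Polynomial

namespace LineIrr

/-- Existence of points over a given value of the parameter. -/
lemma exists_point {k L : Type*} [Field k] [IsAlgClosed k] [Field L] [Algebra k L] (b : L)
    (hb : Transcendental k b) (s : Set L)
    (hs : ∀ x ∈ s, ∃ P : k[X][X], P.Monic ∧ eval₂ (aeval b : k[X] →ₐ[k] L).toRingHom x P = 0)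
    (β : k) : ∃ ψ : Algebra.adjoin k (insert b s) →ₐ[k] k,
      ψ ⟨b, Algebra.subset_adjoin (Set.mem_insert _ _)⟩ = β := by
  set R := Algebra.adjoin k (insert b s) with hR
  set bR : R := ⟨b, Algebra.subset_adjoin (Set.mem_insert _ _)⟩ with hbR
  let φ : k[X] →ₐ[k] R := aeval bR
  have hval : ∀ p : k[X], (φ p : L) = aeval b p := by
    intro p
    have := Polynomial.aeval_algHom_apply R.val bR p
    exact this.symm
  have hinj : Function.Injective φ := by
    intro p p' h
    have h2 : aeval b p = aeval b p' := by rw [← hval, ← hval, h]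
    exact (transcendental_iff_injective.mp hb) h2
  letI : Algebra k[X] R := φ.toRingHom.toAlgebra
  have halg : ∀ p : k[X], algebraMap k[X] R p = φ p := fun _ => rfl
  letI : Algebra k[X] L := (aeval b : k[X] →ₐ[k] L).toRingHom.toAlgebra
  have halgL : algebraMap k[X] L = (aeval b : k[X] →ₐ[k] L).toRingHom := rfl
  haveI : IsScalarTower k[X] R L := IsScalarTower.of_algebraMap_eq (fun p => by
    rw [halg]; exact (hval p).symm)
  haveI : IsScalarTower k k[X] R := IsScalarTower.of_algebraMap_eq (fun c => by
    rw [halg]; simp [φ])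
  haveI : IsScalarTower k k[X] L := IsScalarTower.of_algebraMap_eq (fun c => by
    rw [halgL]; simp)
  have h_integral : Algebra.IsIntegral k[X] R := by
    constructor
    intro x
    have hle : Algebra.adjoin k (insert b s) ≤ (integralClosure k[X] L).restrictScalars k := by
      rw [Algebra.adjoin_le_iff]
      intro y hy
      rcases Set.mem_insert_iff.mp hy with h | h
      · have h2 : y = algebraMap k[X] L X := by rw [halgL, h]; simp
        rw [h2]
        exact isIntegral_algebraMap
      · obtain ⟨P, hP, h0⟩ := hs y h
        exact ⟨P, hP, h0⟩
    have := hle x.2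
    exact (isIntegral_algebraMap_iff (A := R) (B := L) Subtype.val_injective).mp this
  set I : Ideal k[X] := Ideal.span {X - C β} with hI
  haveI hImax : I.IsMaximal := by
    rw [hI]
    exact PrincipalIdealRing.isMaximal_of_irreducible (irreducible_X_sub_C β)
  obtain ⟨M, hM, hMI⟩ := Ideal.exists_ideal_over_maximal_of_isIntegral (S := R) I (by
    rw [(RingHom.injective_iff_ker_eq_bot _).mp (show Function.Injective (algebraMap k[X] R) from hinj)]
    exact bot_le)
  letI := Ideal.Quotient.field M
  have hXb : Ideal.Quotient.mk M bR = algebraMap k (R ⧸ M) β := by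
    have h1 : (X - C β : k[X]) ∈ M.comap (algebraMap k[X] R) := by
      rw [hMI]; exact Ideal.mem_span_singleton_self _
    rw [Ideal.mem_comap, halg] at h1
    have h2 := Ideal.Quotient.eq_zero_iff_mem.mpr h1
    simp only [φ, map_sub, aeval_X, aeval_C] at h2
    exact sub_eq_zero.mp h2
  have hint2 : Algebra.IsIntegral k (R ⧸ M) := by
    constructor
    intro y
    obtain ⟨x, rfl⟩ := Ideal.Quotient.mk_surjective y
    obtain ⟨P, hP, h0⟩ := h_integral.isIntegral x
    refine ⟨P.map (evalRingHom β), hP.map _, ?_⟩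
    rw [eval₂_map]
    have h3 : (algebraMap k (R ⧸ M)).comp (evalRingHom β)
        = (Ideal.Quotient.mk M).comp (algebraMap k[X] R) := by
      apply Polynomial.ringHom_ext
      · intro c
        simp only [RingHom.comp_apply, coe_evalRingHom, eval_C, halg, φ, aeval_C]
        rfl
      · simp only [RingHom.comp_apply, coe_evalRingHom, eval_X, halg, φ, aeval_X]
        exact hXb.symm
    rw [h3, ← Polynomial.hom_eval₂, h0, map_zero]
  have hbij := IsAlgClosed.algebraMap_bijective_of_isIntegral (k := k) (K := R ⧸ M)
  let e := AlgEquiv.ofBijective (Algebra.ofId k (R ⧸ M)) hbij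
  refine ⟨(e.symm : (R ⧸ M) →ₐ[k] k).comp (Ideal.Quotient.mkₐ k M), ?_⟩
  show e.symm (Ideal.Quotient.mk M bR) = β
  rw [hXb]
  exact e.symm_apply_apply β

end LineIrr

end

section
open Polynomial
open Polynomial

namespace LineIrr

/-- Independence over `Q`-th powers, in power series form. -/
lemma frob_indep {k : Type*} [Field k] [IsAlgClosed k] (p : ℕ) [Fact p.Prime] [CharP k p] (β : ℕ)
    {S : Type*} [Fintype S] (φ ρ : S → PowerSeries k)
    (hlow : ∀ c : S → k, (∀ i < p ^ β, PowerSeries.coeff i (∑ s, c s • φ s) = 0) →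
      ∑ s, c s • φ s = 0)
    (h : ∑ s, φ s * ρ s ^ (p ^ β) = 0) (hli : LinearIndependent k ρ) : ∀ s, φ s = 0 := by
  haveI : CharP (PowerSeries k) p :=
    (charP_of_injective_algebraMap (algebraMap k (PowerSeries k)).injective p)
  have hQ : p ^ β ≠ 0 := pow_ne_zero _ (Fact.out : p.Prime).ne_zero
  have key : ∀ (i : ℕ) (ρ : S → PowerSeries k), ∑ s, φ s * ρ s ^ (p ^ β) = 0 →
      ∑ s, (PowerSeries.coeff i (ρ s)) ^ (p ^ β) • φ s = 0 := by
    intro i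
    induction i with
    | zero =>
      intro ρ h
      apply hlow
      intro i hi
      have h2 : ∑ s, (PowerSeries.coeff 0 (ρ s)) ^ (p ^ β) • φ s
          = - (PowerSeries.X ^ (p ^ β) *
            ∑ s, φ s * (PowerSeries.mk fun j => PowerSeries.coeff (j+1) (ρ s)) ^ (p ^ β)) := by
        rw [eq_neg_iff_add_eq_zero, ← h, Finset.mul_sum, ← Finset.sum_add_distrib]
        refine Finset.sum_congr rfl fun s _ => ?_
        conv_rhs => rw [PowerSeries.eq_X_mul_shift_add_const (ρ s)]
        rw [add_pow_char_pow, mul_pow, ← map_pow PowerSeries.C, PowerSeries.smul_eq_C_mul,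
          PowerSeries.coeff_zero_eq_constantCoeff_apply]
        ring
      rw [h2, map_neg, PowerSeries.coeff_X_pow_mul', if_neg (by omega), neg_zero]
    | succ i ih =>
      intro ρ h
      have h0 : ∑ s, (PowerSeries.coeff 0 (ρ s)) ^ (p ^ β) • φ s = 0 := by
        apply hlow
        intro i hi
        have h2 : ∑ s, (PowerSeries.coeff 0 (ρ s)) ^ (p ^ β) • φ s
            = - (PowerSeries.X ^ (p ^ β) *
              ∑ s, φ s * (PowerSeries.mk fun j => PowerSeries.coeff (j+1) (ρ s)) ^ (p ^ β)) := by
          rw [eq_neg_iff_add_eq_zero, ← h, Finset.mul_sum, ← Finset.sum_add_distrib]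
          refine Finset.sum_congr rfl fun s _ => ?_
          conv_rhs => rw [PowerSeries.eq_X_mul_shift_add_const (ρ s)]
          rw [add_pow_char_pow, mul_pow, ← map_pow PowerSeries.C, PowerSeries.smul_eq_C_mul,
            PowerSeries.coeff_zero_eq_constantCoeff_apply]
          ring
        rw [h2, map_neg, PowerSeries.coeff_X_pow_mul', if_neg (by omega), neg_zero]
      have h3 := ih (fun s => PowerSeries.mk fun j => PowerSeries.coeff (j+1) (ρ s)) (by
        have h2 : PowerSeries.X ^ (p ^ β) *
              ∑ s, φ s * (PowerSeries.mk fun j => PowerSeries.coeff (j+1) (ρ s)) ^ (p ^ β) = 0 := by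
          rw [← h, ← zero_add (PowerSeries.X ^ (p ^ β) * _), ← h0, Finset.mul_sum,
            ← Finset.sum_add_distrib]
          refine Finset.sum_congr rfl fun s _ => ?_
          conv_rhs => rw [PowerSeries.eq_X_mul_shift_add_const (ρ s)]
          rw [add_pow_char_pow, mul_pow, ← map_pow PowerSeries.C, PowerSeries.smul_eq_C_mul,
            PowerSeries.coeff_zero_eq_constantCoeff_apply]
          ring
        exact (mul_eq_zero.mp h2).resolve_left (pow_ne_zero _ PowerSeries.X_ne_zero))
      simpa using h3
  have hroot : ∀ (j : ℕ) (s : S), ∃ z : k, z ^ (p ^ β) = PowerSeries.coeff j (φ s) :=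
    fun j s => IsAlgClosed.exists_pow_nat_eq _ (Nat.pos_of_ne_zero hQ)
  choose z hz using hroot
  intro s
  ext j
  have h4 : ∑ s, z j s • ρ s = 0 := by
    ext i
    have h5 := congrArg (PowerSeries.coeff j) (key i ρ h)
    simp only [map_sum, map_smul, smul_eq_mul, map_zero] at h5 ⊢
    have h6 : (∑ s, z j s * PowerSeries.coeff i (ρ s)) ^ (p ^ β) = 0 := by
      rw [sum_pow_char_pow, ← h5]
      refine Finset.sum_congr rfl fun s _ => ?_
      rw [mul_pow, hz, mul_comm]
    exact pow_eq_zero_iff hQ |>.mp h6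
  have h7 := Fintype.linearIndependent_iff.mp hli (z j) h4 s
  rw [← hz, h7, zero_pow hQ, map_zero]

section vanish
variable {k R : Type*} [Field k] [CommRing R] [Algebra k R] (D : Derivation k R R) (ψ : R →ₐ[k] k)

/-- vanishing to order `M` at the point `ψ` with respect to the derivation `D`. -/
def Vo : ℕ → R → Prop
  | 0, _ => True
  | M+1, r => ψ r = 0 ∧ Vo M (D r)

lemma Vo_mono : ∀ {M : ℕ} {r : R}, Vo D ψ (M+1) r → Vo D ψ M r := by
  intro M
  induction M with
  | zero => intro r _; trivial
  | succ M ih => intro r h; exact ⟨h.1, ih h.2⟩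

lemma Vo_add : ∀ {M : ℕ} {r s : R}, Vo D ψ M r → Vo D ψ M s → Vo D ψ M (r + s) := by
  intro M
  induction M with
  | zero => intros; trivial
  | succ M ih =>
    intro r s h h'
    refine ⟨by rw [map_add, h.1, h'.1, add_zero], ?_⟩
    rw [map_add]; exact ih h.2 h'.2

lemma Vo_mul : ∀ {M : ℕ} {r : R} (s : R), Vo D ψ M r → Vo D ψ M (r * s) := by
  intro M
  induction M with
  | zero => intros; trivial
  | succ M ih =>
    intro r s h
    refine ⟨by rw [map_mul, h.1, zero_mul], ?_⟩
    rw [Derivation.leibniz, smul_eq_mul, smul_eq_mul]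
    refine Vo_add D ψ (ih _ (Vo_mono D ψ h)) ?_
    rw [mul_comm]; exact ih _ h.2

lemma Vo_mul_succ : ∀ {M : ℕ} {r s : R}, Vo D ψ M r → ψ s = 0 → Vo D ψ (M+1) (r * s) := by
  intro M
  induction M with
  | zero => intro r s _ h; exact ⟨by rw [map_mul, h, mul_zero], trivial⟩
  | succ M ih =>
    intro r s h hs
    refine ⟨by rw [map_mul, h.1, zero_mul], ?_⟩
    rw [Derivation.leibniz, smul_eq_mul, smul_eq_mul]
    refine Vo_add D ψ (Vo_mul D ψ _ h) ?_
    rw [mul_comm]; exact ih h.2 hs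

lemma Vo_pow {s : R} (hs : ψ s = 0) : ∀ M : ℕ, Vo D ψ M (s ^ M) := by
  intro M
  induction M with
  | zero => trivial
  | succ M ih => rw [pow_succ]; exact Vo_mul_succ D ψ ih hs

lemma Vo_iter : ∀ {M : ℕ} {r : R}, Vo D ψ M r ↔ ∀ l < M, ψ (D^[l] r) = 0 := by
  intro M
  induction M with
  | zero => intro r; simp [Vo]
  | succ M ih =>
    intro r
    constructor
    · rintro ⟨h1, h2⟩ l hl
      cases l with
      | zero => exact h1
      | succ l => exact ih.mp h2 l (by omega)
    · intro h
      exact ⟨h 0 (by omega), ih.mpr fun l hl => h (l+1) (by omega)⟩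

lemma iter_add (l : ℕ) (r s : R) : D^[l] (r + s) = D^[l] r + D^[l] s := by
  induction l generalizing r s with
  | zero => rfl
  | succ l ih => simp only [Function.iterate_succ_apply, map_add, ih]

lemma iter_zero (l : ℕ) : D^[l] (0 : R) = 0 := by
  induction l with
  | zero => rfl
  | succ l ih => simp only [Function.iterate_succ_apply, map_zero, ih]

lemma iter_sum (l : ℕ) {S : Type*} (t : Finset S) (f : S → R) :
    D^[l] (∑ s ∈ t, f s) = ∑ s ∈ t, D^[l] (f s) := by
  classical
  induction t using Finset.induction_on with
  | empty => simp [iter_zero]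
  | insert a t ha ih => rw [Finset.sum_insert ha, Finset.sum_insert ha, iter_add, ih]

lemma iter_smul (l : ℕ) (c : k) (r : R) : D^[l] (c • r) = c • D^[l] r := by
  induction l generalizing r with
  | zero => rfl
  | succ l ih => rw [Function.iterate_succ_apply, Function.iterate_succ_apply, D.map_smul, ih]

lemma Vo_iter_mul : ∀ {l : ℕ} {u : R} (v : R), Vo D ψ l u →
    ψ (D^[l] (u * v)) = ψ (D^[l] u) * ψ v := by
  intro l
  induction l with
  | zero => intro u v _; simp
  | succ l ih =>
    intro u v h
    rw [Function.iterate_succ_apply, Function.iterate_succ_apply, Derivation.leibniz, smul_eq_mul,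
      smul_eq_mul, iter_add, map_add, mul_comm v, ih v h.2]
    have := (Vo_iter D ψ).mp (Vo_mul D ψ (D v) h) l (by omega)
    rw [this, zero_add]

lemma Vo_iter_mul_succ : ∀ {l : ℕ} {u s : R}, Vo D ψ l u → ψ s = 0 →
    ψ (D^[l+1] (u * s)) = (l + 1) * ψ (D^[l] u) * ψ (D s) := by
  intro l
  induction l with
  | zero => intro u s _ hs; simp [Derivation.leibniz, hs]
  | succ l ih =>
    intro u s h hs
    rw [Function.iterate_succ_apply, Derivation.leibniz, smul_eq_mul,
      smul_eq_mul, iter_add, map_add, mul_comm s, ih h.2 hs, Vo_iter_mul D ψ _ h]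
    simp only [Function.iterate_succ_apply]
    push_cast
    ring

lemma Vo_iter_pow {u s : R} (hs : ψ s = 0) : ∀ l : ℕ, Vo D ψ l (u * s ^ l) ∧
    ψ (D^[l] (u * s ^ l)) = l.factorial * ψ (D s) ^ l * ψ u := by
  intro l
  induction l with
  | zero => exact ⟨trivial, by simp⟩
  | succ l ih =>
    rw [pow_succ, ← mul_assoc]
    refine ⟨Vo_mul_succ D ψ ih.1 hs, ?_⟩
    rw [Vo_iter_mul_succ D ψ ih.1 hs, ih.2, Nat.factorial_succ]
    push_cast
    ring

lemma iter_mul_const (l : ℕ) {h : R} (hh : D h = 0) (r : R) : D^[l] (r * h) = D^[l] r * h := by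
  induction l generalizing r with
  | zero => rfl
  | succ l ih =>
    rw [Function.iterate_succ_apply, Function.iterate_succ_apply, Derivation.leibniz, hh, smul_zero,
      zero_add, smul_eq_mul, mul_comm, ih]

lemma exists_separate {Ω : Type*} [Fintype Ω] [DecidableEq Ω] (pt : Ω → (R →ₐ[k] k))
    (hinj : Function.Injective pt) (w : Ω) :
    ∃ e : R, pt w e ≠ 0 ∧ ∀ w' ≠ w, pt w' e = 0 := by
  have h : ∀ w' : Ω, ∃ r : R, w' ≠ w → (pt w r ≠ 0 ∧ pt w' r = 0) := by
    intro w'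
    by_cases hw : w' = w
    · exact ⟨0, fun h => (h hw).elim⟩
    · have : pt w ≠ pt w' := fun h => hw (hinj h).symm
      obtain ⟨r, hr⟩ := DFunLike.ne_iff.mp this
      refine ⟨r - algebraMap k R (pt w' r), fun _ => ⟨?_, ?_⟩⟩
      · rw [map_sub, AlgHom.commutes]; exact sub_ne_zero.mpr hr
      · rw [map_sub, AlgHom.commutes]; exact sub_self _
  choose r hr using h
  refine ⟨∏ w' ∈ Finset.univ.erase w, r w', ?_, ?_⟩
  · rw [map_prod]
    exact Finset.prod_ne_zero_iff.mpr fun w' h => (hr w' (Finset.ne_of_mem_erase h)).1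
  · intro w' hw'
    rw [map_prod]
    exact Finset.prod_eq_zero (Finset.mem_erase.mpr ⟨hw', Finset.mem_univ _⟩) (hr w' hw').2

end vanish

end LineIrr

end

section
open Polynomial
open Polynomial

namespace LineIrr

/-- the window coefficient -/
noncomputable def win {k R : Type*} [Field k] [CommRing R] [Algebra k R]
    (κ : R →+* LaurentSeries k)
    (hκ : ∀ x, κ (algebraMap k R x) = HahnSeries.C x) (X j : ℕ) : R →ₗ[k] k where
  toFun r := (HahnSeries.ofPowerSeries ℤ k PowerSeries.X ^ X * κ r).coeff (j : ℤ)
  map_add' r s := by rw [map_add, mul_add, HahnSeries.coeff_add]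
  map_smul' c r := by
    rw [Algebra.smul_def, map_mul, hκ, mul_left_comm, HahnSeries.C_mul_eq_smul,
      HahnSeries.coeff_smul]; rfl

/-- Data for the Stepanov argument. -/
structure StepData (k R : Type*) [Field k] [CommRing R] [Algebra k R] (n c : ℕ) where
  V : Submodule k R
  one_mem : (1 : R) ∈ V
  a : R
  a_mem : a ∈ V
  npos : 0 < n
  b : Fin n → R
  b_mem : ∀ i, b i ∈ V ^ n
  li : LinearIndependent k (fun x : Fin n × ℕ => b x.1 * a ^ x.2)
  κ : R →+* LaurentSeries k
  κC : ∀ x, κ (algebraMap k R x) = HahnSeries.C x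
  low : ∀ (X : ℕ) (r : R), r ∈ V ^ X → ∃ ρ : PowerSeries k,
    HahnSeries.ofPowerSeries ℤ k ρ = HahnSeries.ofPowerSeries ℤ k PowerSeries.X ^ X * κ r
  high : ∀ (X : ℕ) (r : R) (ρ : PowerSeries k), r ∈ V ^ X →
    HahnSeries.ofPowerSeries ℤ k ρ = HahnSeries.ofPowerSeries ℤ k PowerSeries.X ^ X * κ r →
    (∀ i ≤ n * X, PowerSeries.coeff i ρ = 0) → r = 0
  D : Derivation k R R
  D_mem : ∀ (X : ℕ) (r : R), r ∈ V ^ X → D r ∈ V ^ (X + c)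
  top : ∀ r : R, ∃ X, r ∈ V ^ X

namespace StepData
variable {k R : Type*} [Field k] [CommRing R] [Algebra k R] {n c : ℕ} (S : StepData k R n c)

lemma pow_mono {X Y : ℕ} (h : X ≤ Y) : S.V ^ X ≤ S.V ^ Y := by
  exact pow_le_pow_right₀ (Submodule.one_le.mpr S.one_mem) h

lemma win_zero {X : ℕ} {r : R} (hr : r ∈ S.V ^ X) (h : ∀ j ≤ n * X, win S.κ S.κC X j r = 0) : r = 0 := by
  obtain ⟨ρ, hρ⟩ := S.low X r hr
  refine S.high X r ρ hr hρ fun i hi => ?_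
  rw [← h i hi]
  show _ = (HahnSeries.ofPowerSeries ℤ k PowerSeries.X ^ X * S.κ r).coeff (i : ℤ)
  rw [← hρ]
  exact (HahnSeries.ofPowerSeries_apply_coeff ρ i).symm

lemma h_mem (x : Fin n × ℕ) : S.b x.1 * S.a ^ x.2 ∈ S.V ^ (n + x.2) := by
  rw [pow_add]
  exact Submodule.mul_mem_mul (S.b_mem _) (Submodule.pow_mem_pow _ S.a_mem _)

lemma iter_mem (l X : ℕ) {r : R} (hr : r ∈ S.V ^ X) : S.D^[l] r ∈ S.V ^ (X + c * l) := by
  induction l generalizing X r with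
  | zero => simpa using hr
  | succ l ih =>
    rw [Function.iterate_succ_apply]
    have := ih (X + c) (S.D_mem _ _ hr)
    rwa [show X + c * (l + 1) = X + c + c * l by ring]

/-- the dimension count producing the auxiliary function -/
lemma exists_aux [IsAlgClosed k] {p : ℕ} [Fact p.Prime] [CharP k p] (μ : ℕ)
    (s : Fin n × ℕ → R) (hs : ∀ x, s x ∈ S.V ^ (n + x.2)) (A' B' M : ℕ)
    (hcount : M * (n * (p ^ μ * (A' + n + c * M) + (B' + n)) + 1) < (n * A') * (n * B')) :
    ∃ f : Fin n × Fin B' → R, (∃ x, f x ≠ 0) ∧ (∀ x, f x ∈ S.V ^ (A' + n)) ∧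
      ∀ l < M, ∑ x, (S.D^[l] (f x)) ^ (p ^ μ) * s (x.1, x.2) = 0 := by
  classical
  haveI : CharP R p := by
    rcases subsingleton_or_nontrivial R with h | h
    · exact absurd (Subsingleton.elim (S.b ⟨0, S.npos⟩ * S.a ^ 0) 0) (S.li.ne_zero ⟨⟨0, S.npos⟩, 0⟩)
    · exact charP_of_injective_algebraMap (algebraMap k R).injective p
  set e := p ^ μ with he
  have he0 : e ≠ 0 := pow_ne_zero _ (Fact.out : p.Prime).ne_zero
  set X := e * (A' + n + c * M) + (B' + n) with hX
  let v : Fin n × Fin A' → R := fun u => S.b u.1 * S.a ^ (u.2 : ℕ)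
  have hv : ∀ u, v u ∈ S.V ^ (A' + n) := fun u =>
    S.pow_mono (by have := u.2.2; simp only; omega) (S.h_mem (u.1, u.2))
  let term : ℕ → (Fin n × Fin A') × (Fin n × Fin B') → R :=
    fun l ux => (S.D^[l] (v ux.1)) ^ e * s (ux.2.1, ux.2.2)
  have hterm : ∀ l < M, ∀ ux, term l ux ∈ S.V ^ X := by
    intro l hl ux
    rw [hX, pow_add]
    refine Submodule.mul_mem_mul ?_ (S.pow_mono (by have := ux.2.2.2; simp only; omega) (hs _))
    rw [mul_comm, pow_mul]
    refine Submodule.pow_mem_pow _ (S.pow_mono ?_ (S.iter_mem l _ (hv _))) _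
    have := Nat.mul_le_mul_left c hl.le
    omega
  let T : ((Fin n × Fin A') × (Fin n × Fin B') → k) →ₗ[k] (Fin M × Fin (n * X + 1) → k) :=
    LinearMap.pi fun lj => (win S.κ S.κC X lj.2).comp (Fintype.linearCombination k (term lj.1))
  have hker : LinearMap.ker T ≠ ⊥ := by
    apply LinearMap.ker_ne_bot_of_finrank_lt
    simp only [Module.finrank_fintype_fun_eq_card, Fintype.card_prod, Fintype.card_fin]
    exact hcount
  obtain ⟨x, hx, hx0⟩ := (Submodule.ne_bot_iff _).mp hker
  have hroot : ∀ ux, ∃ z : k, z ^ e = x ux := fun ux =>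
    IsAlgClosed.exists_pow_nat_eq _ (Nat.pos_of_ne_zero he0)
  choose y hy using hroot
  refine ⟨fun t => ∑ u, y (u, t) • v u, ?_, ?_, ?_⟩
  · by_contra hcon
    push Not at hcon
    apply hx0
    funext ⟨u, t⟩
    have hli : LinearIndependent k v :=
      S.li.comp (fun u : Fin n × Fin A' => (u.1, (u.2 : ℕ))) (by
        rintro ⟨i, j⟩ ⟨i', j'⟩ h
        simp only [Prod.mk.injEq] at h ⊢
        exact ⟨h.1, Fin.ext h.2⟩)
    have := Fintype.linearIndependent_iff.mp hli _ (hcon t) u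
    rw [← hy, this, zero_pow he0]; rfl
  · intro t
    exact Submodule.sum_mem _ fun u _ => Submodule.smul_mem _ _ (hv u)
  · intro l hl
    have h0 : ∑ t : Fin n × Fin B', (S.D^[l] (∑ u, y (u, t) • v u)) ^ e * s (t.1, t.2)
        = Fintype.linearCombination k (term l) x := by
      refine Eq.trans ?_ (Fintype.sum_prod_type_right (α₁ := Fin n × Fin A') (α₂ := Fin n × Fin B') _).symm
      simp only [term]
      apply Finset.sum_congr rfl
      intro t _
      rw [iter_sum, he, sum_pow_char_pow, Finset.sum_mul]
      refine Finset.sum_congr rfl fun u _ => ?_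
      rw [iter_smul, _root_.smul_pow, ← he, hy, smul_mul_assoc]
    simp only
    rw [h0]
    refine S.win_zero (X := X) ?_ ?_
    · rw [Fintype.linearCombination_apply]
      exact Submodule.sum_mem _ fun ux _ => Submodule.smul_mem _ _ (hterm l hl ux)
    · intro j hj
      exact congrFun hx (⟨l, hl⟩, ⟨j, by omega⟩)

lemma aux_ne_zero [IsDomain R] [IsAlgClosed k] {p : ℕ} [Fact p.Prime] [CharP k p] (β A B' : ℕ)
    (hA : n * A < p ^ β) (f : Fin n × Fin B' → R) (hf0 : ∃ x, f x ≠ 0)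
    (hf : ∀ x, f x ∈ S.V ^ A) :
    ∑ x, f x * (S.b x.1 * S.a ^ (x.2 : ℕ)) ^ (p ^ β) ≠ 0 := by
  classical
  intro hsum
  set h : Fin n × Fin B' → R := fun x => S.b x.1 * S.a ^ (x.2 : ℕ) with hh
  have hmem : ∀ x, h x ∈ S.V ^ (B' + n) := fun u =>
    S.pow_mono (by have := u.2.2; simp only; omega) (S.h_mem (u.1, u.2))
  choose φ hφ using fun x => S.low A (f x) (hf x)
  choose ρ hρ using fun x => S.low (B' + n) (h x) (hmem x)
  set Z := HahnSeries.ofPowerSeries ℤ k PowerSeries.X with hZ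
  have hZ0 : Z ≠ 0 := by
    rw [hZ, Ne, map_eq_zero_iff _ HahnSeries.ofPowerSeries_injective]
    exact PowerSeries.X_ne_zero
  have hinj := HahnSeries.ofPowerSeries_injective (Γ := ℤ) (R := k)
  have hsm : ∀ (c : k) (r : PowerSeries k), HahnSeries.ofPowerSeries ℤ k (c • r)
      = HahnSeries.C c * HahnSeries.ofPowerSeries ℤ k r := by
    intro c r
    rw [PowerSeries.smul_eq_C_mul, map_mul, HahnSeries.ofPowerSeries_C]
  have hsmκ : ∀ (c : k) (r : R), S.κ (c • r) = HahnSeries.C c * S.κ r := by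
    intro c r
    rw [Algebra.smul_def, map_mul, S.κC]
  have hκ : Function.Injective S.κ := by
    rw [injective_iff_map_eq_zero]
    intro r hr
    obtain ⟨X, hX⟩ := S.top r
    refine S.high X r 0 hX ?_ (fun _ _ => by simp)
    rw [hr, mul_zero, map_zero]
  have hcomb : ∀ c : Fin n × Fin B' → k, HahnSeries.ofPowerSeries ℤ k (∑ x, c x • φ x)
      = Z ^ A * S.κ (∑ x, c x • f x) := by
    intro c
    simp only [map_sum, hsm, hφ, hsmκ, Finset.mul_sum]
    exact Finset.sum_congr rfl fun x _ => by ring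
  have hcombρ : ∀ c : Fin n × Fin B' → k, HahnSeries.ofPowerSeries ℤ k (∑ x, c x • ρ x)
      = Z ^ (B' + n) * S.κ (∑ x, c x • h x) := by
    intro c
    simp only [map_sum, hsm, hρ, hsmκ, Finset.mul_sum]
    exact Finset.sum_congr rfl fun x _ => by ring
  have hall := frob_indep p β φ ρ ?_ ?_ ?_
  · obtain ⟨x, hx⟩ := hf0
    apply hx
    have := hφ x
    rw [hall x, map_zero] at this
    have h2 := (mul_eq_zero.mp this.symm).resolve_left (pow_ne_zero _ hZ0)
    exact (map_eq_zero_iff _ hκ).mp h2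
  · intro c hc
    have hz : ∑ x, c x • f x = 0 := by
      refine S.high A _ (∑ x, c x • φ x) (Submodule.sum_mem _ fun u _ => Submodule.smul_mem _ _ (hf u))
        (hcomb c) fun i hi => hc i (by omega)
    apply hinj
    rw [hcomb, hz, map_zero, mul_zero, map_zero]
  · apply hinj
    rw [map_zero, map_sum]
    have : ∀ x, HahnSeries.ofPowerSeries ℤ k (φ x * ρ x ^ p ^ β)
        = Z ^ A * (Z ^ (B' + n)) ^ (p ^ β) * S.κ (f x * h x ^ (p ^ β)) := by
      intro x
      rw [map_mul, map_pow, hφ, hρ, map_mul S.κ (f x), map_pow S.κ (h x)]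
      ring
    simp only [this]
    rw [← Finset.mul_sum, ← map_sum, hsum, map_zero, mul_zero]
  · rw [Fintype.linearIndependent_iff]
    intro c hc x
    have h1 := hcombρ c
    rw [hc, map_zero] at h1
    have h2 := (mul_eq_zero.mp h1.symm).resolve_left (pow_ne_zero _ hZ0)
    have h3 := (map_eq_zero_iff _ hκ).mp h2
    have hli : LinearIndependent k h :=
      S.li.comp (fun u : Fin n × Fin B' => (u.1, (u.2 : ℕ))) (by
        rintro ⟨i, j⟩ ⟨i', j'⟩ h
        simp only [Prod.mk.injEq] at h ⊢
        exact ⟨h.1, Fin.ext h.2⟩)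
    exact Fintype.linearIndependent_iff.mp hli c h3 x

end StepData
end LineIrr

end

section
open Polynomial
open Polynomial

namespace LineIrr
namespace StepData
variable {k R : Type*} [Field k] [CommRing R] [Algebra k R] {n c : ℕ} (S : StepData k R n c)

lemma order_count [IsDomain R] {p : ℕ} [Fact p.Prime] [CharP k p]
    {Ω : Type*} [Fintype Ω] (pt : Ω → (R →ₐ[k] k)) (hinj : Function.Injective pt)
    (hΔ : ∀ w, pt w (S.D S.a) ≠ 0) (M X : ℕ) (hM : M ≤ p) (Φ : R) (hΦ : Φ ≠ 0)
    (hΦV : Φ ∈ S.V ^ X) (hvan : ∀ w, Vo S.D (pt w) M Φ) :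
    M * Fintype.card Ω ≤ n * X + n ^ 2 + 1 := by
  classical
  choose ee he1 he0 using fun w => exists_separate pt hinj w
  let u : Ω × Fin M → R := fun wl =>
    ee wl.1 ^ M * (S.a - algebraMap k R (pt wl.1 S.a)) ^ (wl.2 : ℕ)
  choose Yf hYf using fun wl => S.top (u wl)
  set Y := ∑ wl, Yf wl with hY
  have hu : ∀ wl, u wl ∈ S.V ^ (X + (Y + n)) := fun wl =>
    S.pow_mono (by
      have : Yf wl ≤ Y := Finset.single_le_sum (f := Yf) (fun _ _ => Nat.zero_le _) (Finset.mem_univ wl)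
      omega) (hYf wl)
  let v : Fin n × Fin Y → R := fun u => Φ * (S.b u.1 * S.a ^ (u.2 : ℕ))
  have hv : ∀ i, v i ∈ S.V ^ (X + (Y + n)) := fun i => by
    rw [pow_add]
    exact Submodule.mul_mem_mul hΦV (S.pow_mono (by have := i.2.2; simp only; omega) (S.h_mem (i.1, i.2)))
  let T : (((Fin n × Fin Y) ⊕ (Ω × Fin M)) → k) →ₗ[k] (Fin (n * (X + (Y + n)) + 1) → k) :=
    LinearMap.pi fun j => (win S.κ S.κC (X + (Y + n)) j).comp
      (Fintype.linearCombination k (Sum.elim v u))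
  have hT : Function.Injective T := by
    rw [← LinearMap.ker_eq_bot, LinearMap.ker_eq_bot']
    intro x hx
    have h0 : Fintype.linearCombination k (Sum.elim v u) x = 0 := by
      refine S.win_zero (X := X + (Y + n)) ?_ ?_
      · rw [Fintype.linearCombination_apply]
        refine Submodule.sum_mem _ fun i _ => Submodule.smul_mem _ _ ?_
        rcases i with i | i
        · exact hv i
        · exact hu i
      · intro j hj
        exact congrFun hx ⟨j, by omega⟩
    rw [Fintype.linearCombination_apply, Fintype.sum_sum_type] at h0
    simp only [Sum.elim_inl, Sum.elim_inr] at h0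
    have hvan1 : ∀ w, Vo S.D (pt w) M (∑ i, x (Sum.inl i) • v i) := by
      intro w
      have : ∑ i, x (Sum.inl i) • v i = Φ * ∑ i : Fin n × Fin Y,
          x (Sum.inl i) • (S.b i.1 * S.a ^ (i.2 : ℕ)) := by
        rw [Finset.mul_sum]
        exact Finset.sum_congr rfl fun i _ => by simp only [v, mul_smul_comm]
      rw [this]
      exact Vo_mul S.D (pt w) _ (hvan w)
    have hd : ∀ (w : Ω) (l : ℕ) (hl : l < M), x (Sum.inr (w, ⟨l, hl⟩)) = 0 := by
      intro w l
      induction l using Nat.strong_induction_on with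
      | _ l ih =>
        intro hl
        have h1 := congrArg (fun r => pt w (S.D^[l] r)) h0
        simp only [iter_add, map_add, iter_zero, map_zero] at h1
        rw [(Vo_iter S.D (pt w)).mp (hvan1 w) l hl, zero_add, iter_sum, map_sum,
          Finset.sum_eq_single (w, ⟨l, hl⟩)] at h1
        · rw [iter_smul, map_smul, smul_eq_mul] at h1
          refine (mul_eq_zero.mp h1).resolve_right ?_
          have hs : pt w (S.a - algebraMap k R (pt w S.a)) = 0 := by
            rw [map_sub, AlgHom.commutes]; exact sub_self _
          have h2 := (Vo_iter_pow S.D (pt w) (u := ee w ^ M) hs l).2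
          simp only [u]
          rw [h2, map_sub, Derivation.map_algebraMap, sub_zero, map_pow]
          refine mul_ne_zero (mul_ne_zero ?_ (pow_ne_zero _ (hΔ w))) (pow_ne_zero _ (he1 w))
          rw [Ne, CharP.cast_eq_zero_iff k p, (Fact.out : p.Prime).dvd_factorial]
          omega
        · rintro ⟨w', l', hl'⟩ _ hne
          rw [iter_smul, map_smul, smul_eq_mul]
          by_cases hw : w' = w
          · subst hw
            have hll : l' ≠ l := fun h => hne (by subst h; rfl)
            rcases Nat.lt_or_ge l' l with h | h
            · rw [ih l' h hl', zero_mul]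
            · have hs : pt w' (S.a - algebraMap k R (pt w' S.a)) = 0 := by
                rw [map_sub, AlgHom.commutes]; exact sub_self _
              have h2 := (Vo_iter_pow S.D (pt w') (u := ee w' ^ M) hs l').1
              simp only [u]
              rw [(Vo_iter S.D (pt w')).mp h2 l (by omega), mul_zero]
          · have h2 := Vo_mul S.D (pt w) ((S.a - algebraMap k R (pt w' S.a)) ^ l')
              (Vo_pow S.D (pt w) (he0 w' w (Ne.symm hw)) M)
            simp only [u]
            rw [(Vo_iter S.D (pt w)).mp h2 l hl, mul_zero]
        · intro h; exact absurd (Finset.mem_univ _) h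
    have hd' : ∀ wl, x (Sum.inr wl) = 0 := fun ⟨w, l, hl⟩ => hd w l hl
    have h3 : ∑ i : Fin n × Fin Y, x (Sum.inl i) • (S.b i.1 * S.a ^ (i.2 : ℕ)) = 0 := by
      simp only [hd', zero_smul, Finset.sum_const_zero, add_zero] at h0
      have : ∑ i, x (Sum.inl i) • v i = Φ * ∑ i : Fin n × Fin Y,
          x (Sum.inl i) • (S.b i.1 * S.a ^ (i.2 : ℕ)) := by
        rw [Finset.mul_sum]
        exact Finset.sum_congr rfl fun i _ => by simp only [v, mul_smul_comm]
      rw [this] at h0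
      exact (mul_eq_zero.mp h0).resolve_left hΦ
    have hli : LinearIndependent k (fun i : Fin n × Fin Y => S.b i.1 * S.a ^ (i.2 : ℕ)) :=
      S.li.comp (fun u : Fin n × Fin Y => (u.1, (u.2 : ℕ))) (by
        rintro ⟨i, j⟩ ⟨i', j'⟩ h
        simp only [Prod.mk.injEq] at h ⊢
        exact ⟨h.1, Fin.ext h.2⟩)
    funext i
    rcases i with i | i
    · exact Fintype.linearIndependent_iff.mp hli _ h3 i
    · exact hd' i
  have hcard := LinearMap.finrank_le_finrank_of_injective hT
  simp only [Module.finrank_fintype_fun_eq_card, Fintype.card_sum, Fintype.card_prod,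
    Fintype.card_fin] at hcard
  nlinarith

lemma stepanov_core [IsDomain R] [IsAlgClosed k] {p : ℕ} [Fact p.Prime] [CharP k p]
    {Ω : Type*} [Fintype Ω] (pt : Ω → (R →ₐ[k] k)) (hinj : Function.Injective pt)
    (hΔ : ∀ w, pt w (S.D S.a) ≠ 0) (μ β : ℕ) (hβ : β ≠ 0)
    (s : Fin n × ℕ → R) (hs : ∀ x, s x ∈ S.V ^ (n + x.2))
    (hfrob : ∀ w x, (pt w (S.b x.1 * S.a ^ x.2)) ^ (p ^ μ * p ^ β) = pt w (s x))
    (A' B' M : ℕ) (hM : M ≤ p)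
    (hcount : M * (n * (p ^ μ * (A' + n + c * M) + (B' + n)) + 1) < (n * A') * (n * B'))
    (hA : n * (A' + n) < p ^ β) :
    M * Fintype.card Ω ≤ n * (A' + n + p ^ β * (B' + n)) + n ^ 2 + 1 := by
  classical
  obtain ⟨f, hf0, hf, hcond⟩ := S.exists_aux (p := p) μ s hs A' B' M hcount
  have hΦ := S.aux_ne_zero (p := p) β (A' + n) B' hA f hf0 hf
  haveI : CharP R p := charP_of_injective_algebraMap (algebraMap k R).injective p
  have hDh : ∀ h : R, S.D (h ^ p ^ β) = 0 := by
    intro h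
    rw [Derivation.leibniz_pow]
    have : ((p ^ β : ℕ) : R) = 0 := by
      rw [Nat.cast_pow, CharP.cast_eq_zero, zero_pow hβ]
    rw [← Nat.cast_smul_eq_nsmul R, this, zero_smul]
  refine S.order_count (p := p) pt hinj hΔ M _ hM _ hΦ ?_ ?_
  · refine Submodule.sum_mem _ fun x _ => ?_
    rw [pow_add]
    refine Submodule.mul_mem_mul (hf x) ?_
    rw [mul_comm, pow_mul]
    exact Submodule.pow_mem_pow _
      (S.pow_mono (by have := x.2.2; simp only; omega) (S.h_mem (x.1, x.2))) _
  · intro w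
    rw [Vo_iter]
    intro l hl
    have h1 := congrArg (pt w) (hcond l hl)
    have h2 : (pt w (S.D^[l] (∑ x, f x * (S.b x.1 * S.a ^ (x.2 : ℕ)) ^ (p ^ β)))) ^ (p ^ μ) = 0 := by
      rw [← map_zero (pt w), ← h1, iter_sum, ← map_pow, sum_pow_char_pow, map_sum, map_sum]
      refine Finset.sum_congr rfl fun x _ => ?_
      rw [iter_mul_const S.D l (hDh _), mul_pow, map_mul, map_mul, ← hfrob w (x.1, x.2)]
      congr 1
      rw [map_pow, map_pow, ← pow_mul, mul_comm (p ^ μ)]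
    exact (pow_eq_zero_iff (pow_ne_zero _ (Fact.out : p.Prime).ne_zero)).mp h2

end StepData
end LineIrr

end

section
open Polynomial
open Polynomial

namespace LineIrr

set_option maxHeartbeats 2000000 in
lemma stepanov_params (n c : ℕ) (hn : 0 < n) : ∃ C q0 : ℕ, ∀ p α q : ℕ, p.Prime → q = p ^ α → q0 < q →
    ∃ μ β M A' B' : ℕ, μ + β = α ∧ β ≠ 0 ∧ M ≤ p ∧
      M * (n * (p ^ μ * (A' + n + c * M) + (B' + n)) + 1) < (n * A') * (n * B') ∧
      n * (A' + n) < p ^ β ∧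
      ∀ W : ℕ, M * W ≤ n * (A' + n + p ^ β * (B' + n)) + n ^ 2 + 1 →
        (W : ℝ) ≤ q + C * Real.sqrt q := by
  set C1 := 2*n^2+n*c+n+2 with hC1
  set C2 := n*(C1+1+n) with hC2
  set K := 2*n^2+n+2 with hK
  have hC2pos : 0 < C2 := by positivity
  refine ⟨2*C2*K, C2, fun p α q hp hq hq0 => ?_⟩
  have hp2 := hp.two_le
  have hppos := hp.pos
  have hqpos : 0 < q := by omega
  -- choice of μ
  set μ := Nat.findGreatest (fun μ => (p^μ)^2*C2 < q) α with hμ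
  have hμ1 : (p^μ)^2*C2 < q := by
    have := Nat.findGreatest_spec (P := fun μ => (p^μ)^2*C2 < q) (Nat.zero_le α) (by simpa using hq0)
    exact this
  have hμle : μ ≤ α := Nat.findGreatest_le α
  have hμlt : μ < α := by
    rcases hμle.lt_or_eq with h | h
    · exact h
    · exfalso
      rw [h, ← hq] at hμ1
      nlinarith [Nat.mul_le_mul_left (q^2) hC2pos]
  have hμ2 : q ≤ (p^(μ+1))^2*C2 := by
    have := Nat.findGreatest_is_greatest (P := fun μ => (p^μ)^2*C2 < q) (n := α) (k := μ+1)
      (by omega) (by omega)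
    omega
  set e := p^μ with he
  have hepos : 0 < e := by positivity
  set M := Nat.findGreatest (fun M => (M*e)^2*C2 < q) q with hM
  have hq1 : 1 ≤ q := hqpos
  have hM1 : (M*e)^2*C2 < q :=
    Nat.findGreatest_spec (P := fun M => (M*e)^2*C2 < q) hq1 (by simpa using hμ1)
  have hMpos : 1 ≤ M := Nat.le_findGreatest hq1 (by simpa using hμ1)
  have hMlt : M < q := by
    rcases (Nat.findGreatest_le q : M ≤ q).lt_or_eq with h | h
    · exact h
    · exfalso
      have h1 : M ≤ (M*e)^2*C2 := by
        calc M ≤ M*e := Nat.le_mul_of_pos_right _ hepos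
          _ ≤ (M*e)^2 := Nat.le_self_pow (by norm_num) _
          _ ≤ (M*e)^2*C2 := Nat.le_mul_of_pos_right _ hC2pos
      omega
  have hM2 : q ≤ ((M+1)*e)^2*C2 := by
    have := Nat.findGreatest_is_greatest (P := fun M => (M*e)^2*C2 < q) (n := q) (k := M+1)
      (by omega) (by omega)
    omega
  have hMp : M ≤ p := by
    by_contra hcon
    push Not at hcon
    have h1 : (p^(μ+1))^2*C2 ≤ (M*e)^2*C2 := by
      rw [pow_succ p μ, ← he, mul_comm e p]
      gcongr
    omega
  obtain ⟨β, hβ⟩ : ∃ β, μ + β = α := ⟨α - μ, by omega⟩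
  have hβ0 : β ≠ 0 := by omega
  have hqe : q = e * p^β := by rw [hq, ← hβ, pow_add]
  set Q := p^β with hQ
  set P := M*e with hP
  have hPpos : 1 ≤ P := Nat.mul_pos hMpos hepos
  set B' := P/n+1 with hB'
  have hB1 : P + 1 ≤ n*B' := by
    have := Nat.lt_mul_div_succ P hn
    rw [hB']; omega
  have hB2 : n*B' ≤ P + n := by
    have := Nat.mul_div_le P n
    rw [hB', mul_add]; omega
  set A' := C1*M^2*e+1 with hA'
  have hA1 : n*(A'+n) < Q := by
    have h1 : e*(n*(A'+n)) < e*Q := by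
      rw [← hqe]
      refine lt_of_le_of_lt ?_ hM1
      have e1 : e ≤ P^2 := by
        calc e ≤ P := Nat.le_mul_of_pos_left _ hMpos
          _ ≤ P^2 := Nat.le_self_pow (by norm_num) _
      calc e*(n*(A'+n)) = n*(C1*P^2 + e*(1+n)) := by rw [hA', hP]; ring
        _ ≤ n*(C1*P^2 + P^2*(1+n)) := by gcongr
        _ = P^2*C2 := by rw [hC2]; ring
    exact Nat.lt_of_mul_lt_mul_left h1
  refine ⟨μ, β, M, A', B', hβ, hβ0, hMp, ?_, hA1, ?_⟩
  · rw [← he]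
    have e1 : e ≤ P := Nat.le_mul_of_pos_left _ hMpos
    have h1 : M*(n^2*e+n*c*P+(P+n)+n^2+1) < n*A' := by
      calc M*(n^2*e+n*c*P+(P+n)+n^2+1) ≤ M*(n^2*P+n*c*P+(P+n*P)+n^2*P+1*P) := by
            gcongr
            · exact Nat.le_mul_of_pos_right _ hPpos
            · exact Nat.le_mul_of_pos_right _ hPpos
            · omega
        _ = C1*M^2*e := by rw [hC1, hP]; ring
        _ < A' := by omega
        _ ≤ n*A' := Nat.le_mul_of_pos_left _ hn
    calc M * (n * (e * (A' + n + c * M) + (B' + n)) + 1)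
        = n*A'*P + M*(n^2*e+n*c*P+n*B'+n^2+1) := by rw [hP]; ring
      _ ≤ n*A'*P + M*(n^2*e+n*c*P+(P+n)+n^2+1) := by gcongr
      _ < n*A'*P + n*A' := by omega
      _ = (n*A')*(P+1) := by ring
      _ ≤ (n*A')*(n*B') := by gcongr
  · intro W hW
    have h1 : P*W ≤ q*P + q*K := by
      have h2 : e*(M*W) ≤ e*(n*(A'+n)) + q*(n*B'+n^2) + e*(n^2+1) := by
        calc e*(M*W) ≤ e*(n * (A' + n + Q * (B' + n)) + n ^ 2 + 1) := by gcongr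
          _ = e*(n*(A'+n)) + (e*Q)*(n*B'+n^2) + e*(n^2+1) := by ring
          _ = _ := by rw [← hqe]
      have h3 : e*(n*(A'+n)) ≤ q := by rw [hqe]; gcongr
      have h4 : e ≤ q := by
        rw [hqe]; exact Nat.le_mul_of_pos_right _ (by positivity)
      calc P*W = e*(M*W) := by rw [hP]; ring
        _ ≤ _ := h2
        _ ≤ q + q*(P+n+n^2) + q*(n^2+1) := by gcongr
        _ = q*P + q*K := by rw [hK]; ring
    have h5 : q ≤ (2*P)^2*C2 := by
      refine hM2.trans ?_
      have : (M+1)*e ≤ 2*P := by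
        calc (M+1)*e ≤ (2*M)*e := Nat.mul_le_mul_right _ (by omega)
          _ = 2*P := by rw [hP]; ring
      gcongr
    have h6 : Real.sqrt q ≤ 2*P*C2 := by
      rw [Real.sqrt_le_left (by positivity)]
      have h7 : q ≤ (2*P*C2)^2 := by
        refine h5.trans ?_
        rw [mul_pow (2*P) C2]
        gcongr
        exact Nat.le_self_pow (by norm_num) _
      exact_mod_cast h7
    have hP' : (0:ℝ) < P := by exact_mod_cast hPpos
    have h8 : (P:ℝ)*W ≤ q*P + q*K := by exact_mod_cast h1
    have h9 : (q:ℝ) ≤ 2*P*C2*Real.sqrt q := by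
      calc (q:ℝ) = Real.sqrt q * Real.sqrt q := (Real.mul_self_sqrt (by positivity)).symm
        _ ≤ _ := by gcongr
    have h10 : (P:ℝ)*W ≤ P*(q + (2*C2*K : ℕ)*Real.sqrt q) := by
      push_cast
      have h11 : (q:ℝ)*K ≤ 2*P*C2*Real.sqrt q*K := by gcongr
      have h12 : (P:ℝ)*(q + 2*C2*K*Real.sqrt q) = q*P + 2*P*C2*Real.sqrt q*K := by ring
      rw [h12]; linarith
    exact le_of_mul_le_mul_left h10 hP'

/-- The Stepanov upper bound. -/
theorem stepanov (n c : ℕ) : ∃ C q0 : ℕ, ∀ (p α q : ℕ), p.Prime → q = p ^ α → q0 < q →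
    ∀ (k R : Type) [Field k] [IsAlgClosed k] [CharP k p] [CommRing R] [IsDomain R] [Algebra k R]
    (S : StepData k R n c) (Ω : Type) [Fintype Ω] (pt : Ω → (R →ₐ[k] k)),
    Function.Injective pt → (∀ w, pt w (S.D S.a) ≠ 0) →
    ∀ (s : Fin n × ℕ → R), (∀ x, s x ∈ S.V ^ (n + x.2)) →
    (∀ w x, (pt w (S.b x.1 * S.a ^ x.2)) ^ q = pt w (s x)) →
    (Fintype.card Ω : ℝ) ≤ q + C * Real.sqrt q := by
  rcases Nat.eq_zero_or_pos n with h | hn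
  · exact ⟨0, 0, fun p α q hp hq hq0 k R _ _ _ _ _ _ S => absurd S.npos (by omega)⟩
  obtain ⟨C, q0, h⟩ := stepanov_params n c hn
  refine ⟨C, q0, fun p α q hp hq hq0 k R _ _ _ _ _ _ S Ω _ pt hinj hΔ s hs hfrob => ?_⟩
  haveI : Fact p.Prime := ⟨hp⟩
  obtain ⟨μ, β, M, A', B', h1, h2, h3, h4, h5, h6⟩ := h p α q hp hq hq0
  refine h6 _ (S.stepanov_core (p := p) pt hinj hΔ μ β h2 s hs ?_ A' B' M h3 h4 h5)
  intro w x
  rw [← pow_add, h1, ← hq]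
  exact hfrob w x

end LineIrr

end

section
open Polynomial
open Polynomial

namespace LineIrr

open TensorProduct in
lemma exists_deriv {k A L : Type*} [CommRing k] [CommRing A] [CommRing L] [Algebra k A] [Algebra k L]
    [Algebra A L] [IsScalarTower k A L] [Algebra.FormallyEtale A L] (D0 : Derivation k A L) :
    ∃ D : Derivation k L L, ∀ x, D (algebraMap A L x) = D0 x := by
  let φ : Ω[A⁄k] →ₗ[A] L := D0.liftKaehlerDifferential
  let Φ : L ⊗[A] Ω[A⁄k] →ₗ[L] L := TensorProduct.AlgebraTensorModule.lift
    ((LinearMap.toSpanSingleton L _ φ))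
  let Ψ : Ω[L⁄k] →ₗ[L] L :=
    Φ ∘ₗ (KaehlerDifferential.tensorKaehlerEquivOfFormallyEtale k A L).symm.toLinearMap
  refine ⟨Ψ.compDer (KaehlerDifferential.D k L), fun x => ?_⟩
  have h1 : (KaehlerDifferential.tensorKaehlerEquivOfFormallyEtale k A L).symm
    (KaehlerDifferential.D k L (algebraMap A L x)) = _ :=
    KaehlerDifferential.tensorKaehlerEquivOfFormallyEtale_symm_D_algebraMap k A L x
  show Φ ((KaehlerDifferential.tensorKaehlerEquivOfFormallyEtale k A L).symm
    (KaehlerDifferential.D k L (algebraMap A L x))) = _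
  rw [h1]
  simp [Φ, φ]

instance adic_ps (k : Type*) [Field k] :
    IsAdicComplete (Ideal.span {(PowerSeries.X : PowerSeries k)}) (PowerSeries k) where
  haus' := by
    intro x hx
    ext n
    have := hx (n+1)
    rw [SModEq.zero, smul_eq_mul, Ideal.mul_top, Ideal.span_singleton_pow,
      Ideal.mem_span_singleton, PowerSeries.X_pow_dvd_iff] at this
    simpa using this n (by omega)
  prec' := by
    intro f hf
    refine ⟨PowerSeries.mk fun n => PowerSeries.coeff n (f (n+1)), fun n => ?_⟩
    have key : ∀ {m n : ℕ}, m ≤ n → ∀ i < m, PowerSeries.coeff i (f m) = PowerSeries.coeff i (f n) := by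
      intro m n hmn i hi
      have := hf hmn
      rw [SModEq.sub_mem, smul_eq_mul, Ideal.mul_top, Ideal.span_singleton_pow,
      Ideal.mem_span_singleton, PowerSeries.X_pow_dvd_iff] at this
      have := this i hi
      rwa [map_sub, sub_eq_zero] at this
    rw [SModEq.sub_mem, smul_eq_mul, Ideal.mul_top, Ideal.span_singleton_pow,
      Ideal.mem_span_singleton, PowerSeries.X_pow_dvd_iff]
    intro i hi
    rw [map_sub, PowerSeries.coeff_mk, sub_eq_zero]
    exact (key (by omega) i (by omega)).symm

lemma prod_of_distinct_roots {A : Type*} [CommRing A] [IsDomain A] (G : A[X]) (hG : G.Monic) {d : ℕ}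
    (hd : G.natDegree = d) (s : Fin d → A) (hs : Function.Injective s) (hr : ∀ j, G.IsRoot (s j)) :
    G = ∏ j, (X - C (s j)) := by
  have h1 : (∏ j, (X - C (s j))) ∣ G := by
    have : ((Finset.univ.val.map s).map fun a => X - C a).prod ∣ G := by
      rw [Multiset.prod_X_sub_C_dvd_iff_le_roots hG.ne_zero]
      rw [Multiset.le_iff_subset ((Multiset.nodup_map_iff_of_injective hs).2 Finset.univ.nodup)]
      intro x hx
      rw [Multiset.mem_map] at hx
      obtain ⟨j, -, rfl⟩ := hx
      exact (mem_roots hG.ne_zero).2 (hr j)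
    rw [Multiset.map_map] at this
    exact this
  have hm : (∏ j, (X - C (s j))).Monic := monic_prod_of_monic _ _ fun j _ => monic_X_sub_C _
  refine (Polynomial.eq_of_monic_of_dvd_of_natDegree_le hm hG h1 ?_)
  rw [natDegree_prod_of_monic _ _ fun j _ => monic_X_sub_C _]
  simp [hd]

lemma ps_split {k : Type*} [Field k] [IsAlgClosed k] (G : (PowerSeries k)[X]) (hG : G.Monic) {d : ℕ}
    (hd : G.natDegree = d)
    (hsep : (G.map (PowerSeries.constantCoeff (R := k))).Separable) :
    ∃ s : Fin d → PowerSeries k, G = ∏ j, (X - C (s j)) ∧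
      Function.Injective fun j => PowerSeries.constantCoeff (s j) := by
  classical
  set h := G.map (PowerSeries.constantCoeff (R := k)) with hh
  have hmon : h.Monic := hG.map _
  have hcard : Multiset.card h.roots = d := by
    rw [splits_iff_card_roots.1 (IsAlgClosed.splits h), hG.natDegree_map, hd]
  have hnd : h.roots.Nodup := nodup_roots hsep
  have hc2 : h.roots.toFinset.card = d := by rw [Multiset.toFinset_card_of_nodup hnd, hcard]
  let e := (Finset.equivFinOfCardEq hc2).symm
  have hroot : ∀ j, h.IsRoot (e j : k) := fun j =>
    (mem_roots hmon.ne_zero).1 (Multiset.mem_toFinset.1 (e j).2)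
  have hev : ∀ (P : (PowerSeries k)[X]) (x : PowerSeries k),
      PowerSeries.constantCoeff (P.eval x) = (P.map (PowerSeries.constantCoeff (R := k))).eval
        (PowerSeries.constantCoeff x) := by
    intro P x
    rw [eval_map, eval₂_at_apply]
  have hex : ∀ j, ∃ a : PowerSeries k, G.IsRoot a ∧ PowerSeries.constantCoeff a = (e j : k) := by
    intro j
    obtain ⟨a, ha, ha'⟩ := HenselianRing.is_henselian (I := Ideal.span {(PowerSeries.X : PowerSeries k)})
      G hG (PowerSeries.C (e j : k)) (by
        rw [Ideal.mem_span_singleton, PowerSeries.X_dvd_iff, hev]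
        simpa using hroot j) (by
        apply IsUnit.map
        rw [PowerSeries.isUnit_iff_constantCoeff, hev, isUnit_iff_ne_zero, ← derivative_map]
        intro h0
        obtain ⟨u, v, huv⟩ := hsep
        have h1 := congrArg (eval (e j : k)) huv
        have h2 : eval (e j : k) (derivative h) = 0 := by
          rw [PowerSeries.constantCoeff_C] at h0; exact h0
        have h3 : eval (e j : k) h = 0 := hroot j
        simp [h2, h3] at h1)
    refine ⟨a, ha, ?_⟩
    rw [Ideal.mem_span_singleton, PowerSeries.X_dvd_iff, map_sub, sub_eq_zero] at ha'
    simpa using ha'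
  choose s hs hs' using hex
  have hinj : Function.Injective fun j => PowerSeries.constantCoeff (s j) := by
    intro i j hij
    simp only [hs'] at hij
    exact e.injective (Subtype.ext hij)
  refine ⟨s, ?_, hinj⟩
  exact prod_of_distinct_roots G hG hd s (fun i j hij => hinj (by simp only [hij])) hs

end LineIrr

end

section
open Polynomial
open Polynomial

namespace LineIrr

noncomputable def topP {k : Type*} [Field k] (G : k[X][X]) (d : ℕ) : k[X] :=
  ∑ j ∈ Finset.range (d+1), monomial j ((G.coeff j).coeff (d - j))

/-- A family of plane curve equations `g i (T, a)` (outer variable `T`, inner `a`). -/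
structure Fam (k : Type) [Field k] (r : ℕ) (d : Fin r → ℕ) where
  g : Fin r → k[X][X]
  monic : ∀ i, (g i).Monic
  deg : ∀ i, (g i).natDegree = d i
  low : ∀ i j, ((g i).coeff j).natDegree ≤ d i - j
  sep : ∀ i, (topP (g i) (d i)).Separable
  smooth : ∀ i (u a0 : k), (g i).evalEval a0 u = 0 → (derivative (g i)).evalEval a0 u = 0 →
    (derivative ((g i).eval (C u))).eval a0 ≠ 0
  coll : ∀ (a0 : k) (v : (Σ i, Fin (d i)) → k),
    (∀ i, (g i).map (evalRingHom a0) = ∏ j, (X - C (v ⟨i, j⟩))) →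
    ∀ i j j' i' l l', j ≠ j' → l ≠ l' → v ⟨i, j⟩ = v ⟨i, j'⟩ → v ⟨i', l⟩ = v ⟨i', l'⟩ →
      i = i' ∧ ((⟨i, j⟩ : Σ i, Fin (d i)) = ⟨i', l⟩ ∨ (⟨i, j⟩ : Σ i, Fin (d i)) = ⟨i', l'⟩)

section inf
variable (k : Type*) [Field k]

noncomputable abbrev zz : LaurentSeries k := HahnSeries.ofPowerSeries ℤ k PowerSeries.X

lemma zz_ne : zz k ≠ 0 := by
  rw [zz, Ne, map_eq_zero_iff _ HahnSeries.ofPowerSeries_injective]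
  exact PowerSeries.X_ne_zero

noncomputable def evi : k[X] →+* LaurentSeries k := eval₂RingHom (HahnSeries.C) (zz k)⁻¹

lemma evi_C (c : k) : evi k (C c) = HahnSeries.C c := by simp [evi]
lemma evi_X : evi k X = (zz k)⁻¹ := by simp [evi]

variable {k}

lemma evi_reflect (N : ℕ) (P : k[X]) (hP : P.natDegree ≤ N) :
    zz k ^ N * evi k P = HahnSeries.ofPowerSeries ℤ k (reflect N P : k[X]) := by
  letI : Invertible ((zz k)⁻¹) := ⟨zz k, mul_inv_cancel₀ (zz_ne k), inv_mul_cancel₀ (zz_ne k)⟩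
  have h := eval₂_reflect_mul_pow (HahnSeries.C : k →+* LaurentSeries k) (zz k)⁻¹ N P hP
  have h2 : ∀ Q : k[X], eval₂ (HahnSeries.C : k →+* LaurentSeries k) (zz k) Q =
      HahnSeries.ofPowerSeries ℤ k (Q : k[X]) := by
    intro Q
    have : eval₂RingHom (HahnSeries.C : k →+* LaurentSeries k) (zz k) =
      (HahnSeries.ofPowerSeries ℤ k).comp (Polynomial.coeToPowerSeries.ringHom) := by
      apply Polynomial.ringHom_ext
      · intro a; simp
      · simp
    exact congrArg (fun f : k[X] →+* LaurentSeries k => f Q) this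
  have h3 : ⅟((zz k)⁻¹) = zz k := rfl
  rw [h3, h2] at h
  show _ * eval₂ _ _ _ = _
  rw [← h, inv_pow]
  have := pow_ne_zero N (zz_ne k)
  field_simp

/-- a polynomial in `1/z` is not divisible by `z`. -/
lemma evi_order (P : k[X]) (hP : P ≠ 0) (N : ℕ) (ρ : PowerSeries k)
    (h : zz k ^ N * evi k P = HahnSeries.ofPowerSeries ℤ k ρ) : ∃ i ≤ N, PowerSeries.coeff i ρ ≠ 0 := by
  by_contra hcon
  push Not at hcon
  obtain ⟨ρ', hρ'⟩ : (PowerSeries.X : PowerSeries k)^(N+1) ∣ ρ := by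
    rw [PowerSeries.X_pow_dvd_iff]; intro m hm; exact hcon m (by omega)
  rw [hρ', map_mul, map_pow, pow_succ, mul_assoc] at h
  have h1 := mul_left_cancel₀ (pow_ne_zero N (zz_ne k)) h
  have h2 := evi_reflect P.natDegree P le_rfl
  rw [h1] at h2
  have h3 : (PowerSeries.X : PowerSeries k) ^ P.natDegree * (PowerSeries.X * ρ') =
      ((reflect P.natDegree P : k[X]) : PowerSeries k) := by
    apply HahnSeries.ofPowerSeries_injective (Γ := ℤ)
    rw [← h2]; simp
  have h4 := congrArg (PowerSeries.constantCoeff) h3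
  have h5 : (reflect P.natDegree P).coeff 0 = 0 := by simpa using h4.symm
  rw [coeff_reflect, revAt_le (Nat.zero_le _)] at h5
  exact hP (leadingCoeff_eq_zero.1 (by simpa using h5))

lemma evi_injective : Function.Injective (evi k) := by
  rw [injective_iff_map_eq_zero]
  intro P hP
  by_contra h
  obtain ⟨i, -, hi⟩ := evi_order P h 0 0 (by simp [hP])
  simp at hi

lemma evi_const (P : k[X]) (ρ : PowerSeries k) (h : evi k P = HahnSeries.ofPowerSeries ℤ k ρ) :
    P.natDegree = 0 := by
  by_contra hne
  have h2 := evi_reflect P.natDegree P le_rfl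
  rw [h] at h2
  have h3 : (PowerSeries.X : PowerSeries k) ^ P.natDegree * ρ =
      ((reflect P.natDegree P : k[X]) : PowerSeries k) := by
    apply HahnSeries.ofPowerSeries_injective (Γ := ℤ)
    rw [← h2]; simp
  have h4 := congrArg (PowerSeries.constantCoeff) h3
  have h5 : (reflect P.natDegree P).coeff 0 = 0 := by simpa [hne] using h4.symm
  rw [coeff_reflect, revAt_le (Nat.zero_le _)] at h5
  have : P = 0 := (leadingCoeff_eq_zero.1 (by simpa using h5))
  simp [this] at hne

lemma inf_split [IsAlgClosed k] (G : k[X][X]) (d : ℕ) (hm : G.Monic) (hd : G.natDegree = d)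
    (hlow : ∀ j, (G.coeff j).natDegree ≤ d - j) (hsep : (topP G d).Separable) :
    ∃ s : Fin d → PowerSeries k, (Function.Injective fun j => PowerSeries.constantCoeff (s j)) ∧
     ∀ j, (G.map (evi k)).IsRoot ((zz k)⁻¹ * HahnSeries.ofPowerSeries ℤ k (s j)) := by
  classical
  set H : (PowerSeries k)[X] :=
    ∑ j ∈ Finset.range (d+1), monomial j ((reflect (d-j) (G.coeff j) : k[X]) : PowerSeries k) with hH
  have hcd : H.coeff d = 1 := by
    rw [hH, finsetSum_coeff, Finset.sum_eq_single d]
    · have : G.coeff d = 1 := by rw [← hd]; exact hm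
      rw [coeff_monomial, if_pos rfl, this]
      simp [reflect_one]
    · intro j _ hj; rw [coeff_monomial, if_neg hj]
    · intro h; exact absurd (Finset.mem_range.2 (Nat.lt_succ_self d)) h
  have hdeg : H.natDegree ≤ d := by
    rw [hH]
    refine natDegree_sum_le_of_forall_le _ _ fun j hj => ?_
    exact (natDegree_monomial_le _).trans (by simpa [Nat.lt_succ_iff] using hj)
  have hHm : H.Monic := monic_of_natDegree_le_of_coeff_eq_one d hdeg hcd
  have hHd : H.natDegree = d := le_antisymm hdeg (le_natDegree_of_ne_zero (by rw [hcd]; exact one_ne_zero))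
  have hHt : H.map (PowerSeries.constantCoeff (R := k)) = topP G d := by
    rw [hH, topP, Polynomial.map_sum]
    refine Finset.sum_congr rfl fun j hj => ?_
    rw [map_monomial]
    congr 1
    have : PowerSeries.constantCoeff ((reflect (d-j) (G.coeff j) : k[X]) : PowerSeries k) =
      (reflect (d-j) (G.coeff j)).coeff 0 := by simp
    rw [this, coeff_reflect, revAt_le (Nat.zero_le _), Nat.sub_zero]
  obtain ⟨s, hs, hinj⟩ := ps_split H hHm hHd (by rw [hHt]; exact hsep)
  refine ⟨s, hinj, fun j => ?_⟩
  have hroot : H.eval (s j) = 0 := by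
    rw [hs, eval_prod]; exact Finset.prod_eq_zero (Finset.mem_univ j) (by simp)
  have h1 : zz k ^ d * (G.map (evi k)).eval ((zz k)⁻¹ * HahnSeries.ofPowerSeries ℤ k (s j)) =
      HahnSeries.ofPowerSeries ℤ k (H.eval (s j)) := by
    rw [eval_eq_sum_range' (n := d+1), hH, eval_finsetSum, map_sum, Finset.mul_sum]
    · refine Finset.sum_congr rfl fun i hi => ?_
      have hi' : i ≤ d := by simpa [Nat.lt_succ_iff] using hi
      rw [eval_monomial, map_mul, map_pow, ← evi_reflect _ _ (hlow i), coeff_map, mul_pow, inv_pow]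
      have h0 := zz_ne k
      have : zz k ^ d = zz k ^ (d-i) * zz k ^ i := by rw [← pow_add]; congr 1; omega
      rw [this]
      field_simp
    · rw [hm.natDegree_map, hd]; omega
  rw [hroot, map_zero] at h1
  exact (mul_eq_zero.1 h1).resolve_left (pow_ne_zero _ (zz_ne k))

end inf

lemma splitting_lift {F M : Type*} [Field F] [Field M] (f : F[X]) (φ : F →+* M)
    (h : (f.map φ).Splits) : ∃ κ : f.SplittingField →+* M, ∀ x, κ (algebraMap F _ x) = φ x := by
  letI := φ.toAlgebra
  exact ⟨(SplittingField.lift f h : f.SplittingField →ₐ[F] M), fun x =>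
    (SplittingField.lift f h : f.SplittingField →ₐ[F] M).commutes x⟩

lemma splits_fin {L : Type*} [Field L] (P : L[X]) (hP : P.Monic) (hs : P.Splits) {d : ℕ}
    (hd : P.natDegree = d) : ∃ t : Fin d → L, P = ∏ j, (X - C (t j)) := by
  have h1 := hs.eq_prod_roots_of_monic hP
  have h2 : P.roots.toList.length = d := by
    rw [Multiset.length_toList, splits_iff_card_roots.1 hs, hd]
  refine ⟨fun j => P.roots.toList.get (j.cast h2.symm), ?_⟩
  subst h2
  conv_lhs => rw [h1]
  conv_lhs => rw [← Multiset.coe_toList P.roots]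
  rw [Multiset.map_coe, Multiset.prod_coe, ← List.prod_ofFn]
  congr 1
  apply List.ext_get <;> simp

end LineIrr

end

section
open Polynomial
open Polynomial

namespace LineIrr
namespace Fam
variable {k : Type} [Field k] {r : ℕ} {d : Fin r → ℕ} (F : Fam k r d)

noncomputable def poly : (RatFunc k)[X] := ∏ i, (F.g i).map (algebraMap k[X] (RatFunc k))

def L : Type := F.poly.SplittingField
noncomputable instance : Field F.L := inferInstanceAs (Field F.poly.SplittingField)
noncomputable instance : Algebra (RatFunc k) F.L :=
  inferInstanceAs (Algebra (RatFunc k) F.poly.SplittingField)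
instance : IsSplittingField (RatFunc k) F.L F.poly :=
  inferInstanceAs (IsSplittingField (RatFunc k) F.poly.SplittingField F.poly)
noncomputable instance : Algebra k[X] F.L :=
  ((algebraMap (RatFunc k) F.L).comp (algebraMap k[X] (RatFunc k))).toAlgebra
noncomputable instance : Algebra k F.L :=
  ((algebraMap k[X] F.L).comp C).toAlgebra
instance : IsScalarTower k[X] (RatFunc k) F.L := IsScalarTower.of_algebraMap_eq fun _ => rfl
instance : IsScalarTower k k[X] F.L := IsScalarTower.of_algebraMap_eq fun _ => rfl
instance : IsScalarTower k (RatFunc k) F.L := IsScalarTower.of_algebraMap_eq fun x => by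
  rw [IsScalarTower.algebraMap_apply k k[X] F.L, IsScalarTower.algebraMap_apply k k[X] (RatFunc k),
    IsScalarTower.algebraMap_apply k[X] (RatFunc k) F.L]
instance : FiniteDimensional (RatFunc k) F.L := IsSplittingField.finiteDimensional F.L F.poly
instance : Normal (RatFunc k) F.L := Normal.of_isSplittingField F.poly

lemma algMap_injective : Function.Injective (algebraMap k[X] F.L) := by
  rw [IsScalarTower.algebraMap_eq k[X] (RatFunc k) F.L]
  exact (algebraMap (RatFunc k) F.L).injective.comp (IsFractionRing.injective k[X] (RatFunc k))

lemma algMap_C (x : k) : algebraMap k[X] F.L (C x) = algebraMap k F.L x := rfl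

variable [IsAlgClosed k]

lemma exists_κ : ∃ κ : F.L →+* LaurentSeries k, ∀ P, κ (algebraMap k[X] F.L P) = evi k P := by
  let φ : RatFunc k →+* LaurentSeries k := IsFractionRing.lift (evi_injective (k := k))
  have hφ : ∀ P, φ (algebraMap k[X] (RatFunc k) P) = evi k P := fun P => IsFractionRing.lift_algebraMap _ _
  obtain ⟨κ, hκ⟩ := splitting_lift F.poly φ (by
    rw [poly, Polynomial.map_prod]
    refine Splits.prod fun i _ => ?_
    have h0 : φ.comp (algebraMap k[X] (RatFunc k)) = evi k := RingHom.ext hφ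
    rw [Polynomial.map_map, h0]
    obtain ⟨s, hs, hs'⟩ := inf_split (F.g i) (d i) (F.monic i) (F.deg i) (F.low i) (F.sep i)
    rw [prod_of_distinct_roots ((F.g i).map (evi k)) ((F.monic i).map _)
      (by rw [(F.monic i).natDegree_map, F.deg i]) _ ?_ hs']
    · exact Splits.prod fun j _ => Splits.X_sub_C _
    · intro j j' hjj
      have h1 := mul_left_cancel₀ (inv_ne_zero (zz_ne k)) hjj
      exact hs (by simp only [HahnSeries.ofPowerSeries_injective h1]))
  exact ⟨κ, fun P => (hκ _).trans (hφ P)⟩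

noncomputable def κ : F.L →+* LaurentSeries k := F.exists_κ.choose
lemma κ_alg (P : k[X]) : F.κ (algebraMap k[X] F.L P) = evi k P := F.exists_κ.choose_spec P
lemma κ_C (c : k) : F.κ (algebraMap k F.L c) = HahnSeries.C c := by
  rw [← algMap_C, κ_alg, evi_C]

lemma exists_roots : ∃ (t : (Σ i, Fin (d i)) → F.L) (s : (Σ i, Fin (d i)) → PowerSeries k),
    (∀ i, (F.g i).map (algebraMap k[X] F.L) = ∏ j, (X - C (t ⟨i,j⟩))) ∧
    (∀ x, zz k * F.κ (t x) = HahnSeries.ofPowerSeries ℤ k (s x)) ∧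
    (∀ i, Function.Injective fun j => PowerSeries.constantCoeff (s ⟨i, j⟩)) := by
  have hsp : ∀ i, ((F.g i).map (algebraMap k[X] F.L)).Splits := by
    intro i
    have h1 := IsSplittingField.splits F.L F.poly
    refine h1.of_dvd ?_ ?_
    · rw [poly, Polynomial.map_prod, Finset.prod_ne_zero_iff]
      intro i _
      exact (((F.monic i).map _).map _).ne_zero
    · rw [IsScalarTower.algebraMap_eq k[X] (RatFunc k) F.L, ← Polynomial.map_map, poly,
        Polynomial.map_prod]
      exact Finset.dvd_prod_of_mem _ (Finset.mem_univ i)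
  have key : ∀ i, ∃ (t : Fin (d i) → F.L) (s : Fin (d i) → PowerSeries k),
    (F.g i).map (algebraMap k[X] F.L) = ∏ j, (X - C (t j)) ∧
    (∀ x, zz k * F.κ (t x) = HahnSeries.ofPowerSeries ℤ k (s x)) ∧
    (Function.Injective fun j => PowerSeries.constantCoeff (s j)) := by
    intro i
    obtain ⟨s, hs, hs'⟩ := inf_split (F.g i) (d i) (F.monic i) (F.deg i) (F.low i) (F.sep i)
    have hdeg : ((F.g i).map (algebraMap k[X] F.L)).natDegree = d i := by
      rw [(F.monic i).natDegree_map, F.deg i]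
    obtain ⟨t, ht⟩ := splits_fin _ ((F.monic i).map (algebraMap k[X] F.L)) (hsp i) hdeg
    have hmap : ((F.g i).map (algebraMap k[X] F.L)).map F.κ = (F.g i).map (evi k) := by
      rw [Polynomial.map_map]; congr 1; exact RingHom.ext F.κ_alg
    have hex : ∀ j, ∃ x, F.κ (t x) = (zz k)⁻¹ * HahnSeries.ofPowerSeries ℤ k (s j) := by
      intro j
      have h1 := hs' j
      rw [← hmap, ht, Polynomial.map_prod, IsRoot.def, eval_prod, Finset.prod_eq_zero_iff] at h1
      obtain ⟨x, -, hx⟩ := h1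
      refine ⟨x, ?_⟩
      simp only [Polynomial.map_sub, map_X, map_C, eval_sub, eval_X, eval_C] at hx
      exact (sub_eq_zero.1 hx).symm
    choose e he using hex
    refine ⟨fun j => t (e j), s, ?_, ?_, hs⟩
    · apply prod_of_distinct_roots _ ((F.monic i).map _) hdeg
      · intro j j' hjj
        have h1 := congrArg F.κ hjj
        simp only [he] at h1
        have h1 := mul_left_cancel₀ (inv_ne_zero (zz_ne k)) h1
        exact hs (by simp only [HahnSeries.ofPowerSeries_injective h1])
      · intro j
        rw [ht, IsRoot.def, eval_prod]
        exact Finset.prod_eq_zero (Finset.mem_univ (e j)) (by simp)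
    · intro j
      rw [he, mul_inv_cancel_left₀ (zz_ne k)]
  choose t s h1 h2 h3 using key
  exact ⟨fun x => t x.1 x.2, fun x => s x.1 x.2, h1, fun x => h2 _ _, h3⟩

noncomputable def t : (Σ i, Fin (d i)) → F.L := F.exists_roots.choose
noncomputable def s : (Σ i, Fin (d i)) → PowerSeries k := F.exists_roots.choose_spec.choose
lemma g_eq (i) : (F.g i).map (algebraMap k[X] F.L) = ∏ j, (X - C (F.t ⟨i,j⟩)) :=
  F.exists_roots.choose_spec.choose_spec.1 i
lemma κ_t (x) : zz k * F.κ (F.t x) = HahnSeries.ofPowerSeries ℤ k (F.s x) :=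
  F.exists_roots.choose_spec.choose_spec.2.1 x
lemma s_inj (i) : Function.Injective fun j => PowerSeries.constantCoeff (F.s ⟨i, j⟩) :=
  F.exists_roots.choose_spec.choose_spec.2.2 i

lemma t_inj {i} {j j' : Fin (d i)} (h : F.t ⟨i, j⟩ = F.t ⟨i, j'⟩) : j = j' := by
  have h1 := F.κ_t ⟨i, j⟩
  rw [h, F.κ_t] at h1
  exact F.s_inj i (by simp only [HahnSeries.ofPowerSeries_injective h1])

lemma t_root (x) : eval₂ (algebraMap k[X] F.L) (F.t x) (F.g x.1) = 0 := by
  rw [← eval_map, F.g_eq, eval_prod]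
  exact Finset.prod_eq_zero (Finset.mem_univ x.2) (by simp)

lemma root_iff (i) (y : F.L) : eval₂ (algebraMap k[X] F.L) y (F.g i) = 0 ↔ ∃ j, y = F.t ⟨i, j⟩ := by
  rw [← eval_map, F.g_eq, eval_prod, Finset.prod_eq_zero_iff]
  simp [sub_eq_zero]

lemma t_int (x) : IsIntegral k[X] (F.t x) := ⟨F.g x.1, F.monic _, F.t_root x⟩

lemma adjoin_t : Algebra.adjoin (RatFunc k) (Set.range F.t) = ⊤ := by
  rw [eq_top_iff, ← IsSplittingField.adjoin_rootSet F.L F.poly]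
  apply Algebra.adjoin_mono
  intro y hy
  rw [mem_rootSet', poly] at hy
  have := hy.2
  rw [map_prod, Finset.prod_eq_zero_iff] at this
  obtain ⟨i, -, hi⟩ := this
  rw [aeval_def, eval₂_map, ← IsScalarTower.algebraMap_eq, F.root_iff] at hi
  obtain ⟨j, rfl⟩ := hi
  exact ⟨_, rfl⟩

lemma g_sep (i) : ((F.g i).map (algebraMap k[X] (RatFunc k))).Separable := by
  have : (((F.g i).map (algebraMap k[X] (RatFunc k))).map (algebraMap (RatFunc k) F.L)).Separable := by
    rw [Polynomial.map_map, ← IsScalarTower.algebraMap_eq, F.g_eq]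
    exact separable_prod_X_sub_C_iff.2 fun _ _ h => F.t_inj h
  exact (separable_map _).1 this

instance : Algebra.IsSeparable (RatFunc k) F.L := by
  rw [← IntermediateField.isSeparable_top (F := RatFunc k)]
  have h : IntermediateField.adjoin (RatFunc k) (Set.range F.t) = ⊤ := by
    rw [eq_top_iff]
    intro x _
    exact IntermediateField.algebra_adjoin_le_adjoin _ _ (by rw [F.adjoin_t]; trivial)
  rw [← h, IntermediateField.isSeparable_adjoin_iff_isSeparable]
  rintro _ ⟨x, rfl⟩
  refine (F.g_sep x.1).of_dvd (minpoly.dvd _ _ ?_)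
  rw [aeval_def, eval₂_map, ← IsScalarTower.algebraMap_eq, F.t_root]

instance : IsGalois (RatFunc k) F.L := ⟨⟩

abbrev G := F.L ≃ₐ[RatFunc k] F.L

lemma exists_perm (τ : F.G) (i) : ∃ σ : Equiv.Perm (Fin (d i)), ∀ j, τ (F.t ⟨i,j⟩) = F.t ⟨i, σ j⟩ := by
  have h : ∀ j, ∃ l, τ (F.t ⟨i,j⟩) = F.t ⟨i, l⟩ := by
    intro j
    rw [← F.root_iff]
    have h1 := congrArg τ (F.t_root ⟨i, j⟩)
    rw [map_zero, IsScalarTower.algebraMap_eq k[X] (RatFunc k) F.L, ← eval₂_map] at h1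
    rw [IsScalarTower.algebraMap_eq k[X] (RatFunc k) F.L, ← eval₂_map, ← aeval_def]
    rw [← aeval_def] at h1
    rw [← h1]
    exact Polynomial.aeval_algHom_apply τ _ _
  choose σ hσ using h
  have hinj : Function.Injective σ := by
    intro j j' hjj
    have h1 := hσ j
    rw [hjj, ← hσ j'] at h1
    exact F.t_inj (τ.injective h1)
  exact ⟨Equiv.ofBijective σ (Finite.injective_iff_bijective.1 hinj), hσ⟩

noncomputable def perm : F.G →* (∀ i, Equiv.Perm (Fin (d i))) where
  toFun τ i := (F.exists_perm τ i).choose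
  map_one' := by
    funext i; ext1 j
    apply F.t_inj
    rw [← (F.exists_perm 1 i).choose_spec]; rfl
  map_mul' τ τ' := by
    funext i; ext1 j
    apply F.t_inj
    rw [← (F.exists_perm (τ * τ') i).choose_spec]
    show τ (τ' _) = _
    rw [(F.exists_perm τ' i).choose_spec, (F.exists_perm τ i).choose_spec]
    rfl

lemma perm_t (τ : F.G) (i j) : τ (F.t ⟨i,j⟩) = F.t ⟨i, F.perm τ i j⟩ := (F.exists_perm τ i).choose_spec j

lemma perm_inj : Function.Injective F.perm := by
  intro τ τ' h
  have : (τ : F.L →ₐ[RatFunc k] F.L) = τ' := by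
    apply AlgHom.ext_of_adjoin_eq_top F.adjoin_t
    rintro _ ⟨x, rfl⟩
    show τ (F.t ⟨x.1, x.2⟩) = τ' (F.t ⟨x.1, x.2⟩)
    rw [F.perm_t, F.perm_t, h]
  exact AlgEquiv.coe_toAlgHom_injective this

lemma fixed_mem (y : F.L) (hy : IsIntegral k[X] y) (h : ∀ τ : F.G, τ y = y) :
    ∃ P : k[X], algebraMap k[X] F.L P = y := by
  have h1 : y ∈ (⊥ : IntermediateField (RatFunc k) F.L) := (IsGalois.mem_bot_iff_fixed y).2 h
  obtain ⟨z, rfl⟩ := IntermediateField.mem_bot.1 h1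
  have h2 : IsIntegral k[X] z :=
    (isIntegral_algebraMap_iff (algebraMap (RatFunc k) F.L).injective).1 hy
  obtain ⟨P, rfl⟩ := IsIntegrallyClosed.isIntegral_iff.1 h2
  exact ⟨P, IsScalarTower.algebraMap_apply _ _ _ _⟩

noncomputable def aL : F.L := algebraMap k[X] F.L X

lemma aeval_aL (P : k[X]) : aeval F.aL P = algebraMap k[X] F.L P := by
  rw [aL, aeval_algebraMap_apply, aeval_X_left_apply]

lemma aL_tr : Transcendental k F.aL := by
  rw [transcendental_iff]
  intro P hP
  rw [aeval_aL] at hP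
  exact F.algMap_injective (by rw [hP, map_zero])

lemma τ_alg (τ : F.G) (P : k[X]) : τ (algebraMap k[X] F.L P) = algebraMap k[X] F.L P := by
  rw [IsScalarTower.algebraMap_apply k[X] (RatFunc k) F.L]; exact τ.commutes _

noncomputable def R : Subalgebra k F.L := Algebra.adjoin k (insert F.aL (Set.range F.t))

lemma aL_mem : F.aL ∈ F.R := Algebra.subset_adjoin (Set.mem_insert _ _)
lemma t_mem (x) : F.t x ∈ F.R := Algebra.subset_adjoin (Set.mem_insert_of_mem _ ⟨x, rfl⟩)
lemma alg_mem (P : k[X]) : algebraMap k[X] F.L P ∈ F.R := by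
  rw [← aeval_aL]; exact Algebra.adjoin_mono (Set.singleton_subset_iff.2 (Set.mem_insert _ _)) (Polynomial.aeval_mem_adjoin_singleton (R := k) (p := P) F.aL)
 
lemma R_int (y : F.L) (hy : y ∈ F.R) : IsIntegral k[X] y := by
  have : F.R ≤ (integralClosure k[X] F.L).restrictScalars k := by
    refine Algebra.adjoin_le ?_
    rintro x (rfl | ⟨x, rfl⟩)
    · exact isIntegral_algebraMap
    · exact F.t_int x
  exact this hy

lemma τ_mem (τ : F.G) {y : F.L} (hy : y ∈ F.R) : τ y ∈ F.R := by
  have : F.R ≤ F.R.comap (τ.toAlgHom.restrictScalars k) := by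
    refine Algebra.adjoin_le ?_
    rintro x (rfl | ⟨x, rfl⟩)
    · show τ F.aL ∈ F.R
      rw [aL, τ_alg]; exact F.aL_mem
    · show τ (F.t ⟨x.1, x.2⟩) ∈ F.R
      rw [perm_t]; exact F.t_mem _
  exact this hy

/-- The action on `R`. -/
noncomputable def act (τ : F.G) : F.R →ₐ[k] F.R :=
  ((τ.toAlgHom.restrictScalars k).comp F.R.val).codRestrict F.R fun x => F.τ_mem τ x.2

lemma act_coe (τ : F.G) (x : F.R) : (F.act τ x : F.L) = τ x := rfl

noncomputable def aR : F.R := ⟨F.aL, F.aL_mem⟩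
noncomputable def tR (x : Σ i, Fin (d i)) : F.R := ⟨F.t x, F.t_mem x⟩

lemma act_mul (τ τ' : F.G) (x : F.R) : F.act (τ * τ') x = F.act τ (F.act τ' x) := rfl
lemma act_one (x : F.R) : F.act 1 x = x := rfl
lemma act_a (τ : F.G) : F.act τ F.aR = F.aR := Subtype.ext (F.τ_alg τ X)
lemma act_t (τ : F.G) (i j) : F.act τ (F.tR ⟨i, j⟩) = F.tR ⟨i, F.perm τ i j⟩ := Subtype.ext (F.perm_t τ i j)

lemma exists_pt (β : k) : ∃ ψ : F.R →ₐ[k] k, ψ F.aR = β := by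
  refine exists_point F.aL F.aL_tr (Set.range F.t) ?_ β
  rintro _ ⟨x, rfl⟩
  refine ⟨F.g x.1, F.monic _, ?_⟩
  have : (aeval F.aL : k[X] →ₐ[k] F.L).toRingHom = algebraMap k[X] F.L := RingHom.ext F.aeval_aL
  rw [this]
  exact F.t_root x

/-- the map `k[a] → R`. -/
noncomputable def aMap : k[X] →ₐ[k] F.R := aeval F.aR
lemma aMap_coe (P : k[X]) : (F.aMap P : F.L) = algebraMap k[X] F.L P := by
  rw [← F.aeval_aL]
  exact (Polynomial.aeval_algHom_apply F.R.val F.aR P).symm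
lemma ψ_aMap (ψ : F.R →ₐ[k] k) (P : k[X]) : ψ (F.aMap P) = P.eval (ψ F.aR) := by
  rw [aMap, ← Polynomial.aeval_algHom_apply, coe_aeval_eq_eval]

lemma ψ_split (ψ : F.R →ₐ[k] k) (i) :
    (F.g i).map (evalRingHom (ψ F.aR)) = ∏ j, (X - C (ψ (F.tR ⟨i, j⟩))) := by
  have h1 : (F.g i).map (F.aMap : k[X] →+* F.R) = ∏ j, (X - C (F.tR ⟨i, j⟩)) := by
    apply Polynomial.map_injective (F.R.val : F.R →+* F.L) Subtype.val_injective
    rw [Polynomial.map_map, Polynomial.map_prod]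
    have : ((F.R.val : F.R →+* F.L).comp (F.aMap : k[X] →+* F.R)) = algebraMap k[X] F.L :=
      RingHom.ext F.aMap_coe
    rw [this, F.g_eq]
    simp [tR]
  have h2 := congrArg (Polynomial.map (ψ : F.R →+* k)) h1
  rw [Polynomial.map_map, Polynomial.map_prod] at h2
  have : ((ψ : F.R →+* k).comp (F.aMap : k[X] →+* F.R)) = evalRingHom (ψ F.aR) :=
    RingHom.ext (F.ψ_aMap ψ)
  rw [this] at h2
  rw [h2]
  simp

end Fam
end LineIrr

end

section
open Polynomial
open Polynomial

namespace LineIrr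
namespace Fam
variable {k : Type} [Field k] {r : ℕ} {d : Fin r → ℕ} (F : Fam k r d) [IsAlgClosed k]

lemma inertia (ψ : F.R →ₐ[k] k) (i) (j j' : Fin (d i)) (hjj : j ≠ j')
    (h : ψ (F.tR ⟨i, j⟩) = ψ (F.tR ⟨i, j'⟩)) (τ : F.G) (hτ : τ ≠ 1)
    (hψ : ∀ x, ψ (F.act τ x) = ψ x) : F.perm τ = Pi.mulSingle i (Equiv.swap j j') := by
  have hc := F.coll (ψ F.aR) (fun x => ψ (F.tR x)) (F.ψ_split ψ)
  have hmov : ∀ i' l, F.perm τ i' l ≠ l → ∃ e : i' = i, 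
      (l = e ▸ j ∧ F.perm τ i' l = e ▸ j') ∨ (l = e ▸ j' ∧ F.perm τ i' l = e ▸ j) := by
    intro i' l hl
    have e1 : ψ (F.tR ⟨i', l⟩) = ψ (F.tR ⟨i', F.perm τ i' l⟩) := by
      rw [← F.act_t, hψ]
    obtain ⟨h1, h2⟩ := hc i j j' i' l _ hjj hl.symm h e1
    obtain ⟨-, h3⟩ := hc i j' j i' l _ hjj.symm hl.symm h.symm e1
    subst h1
    refine ⟨rfl, ?_⟩
    simp only [Sigma.mk.injEq, heq_eq_eq, true_and] at h2 h3
    rcases h2 with h2 | h2 <;> rcases h3 with h3 | h3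
    · exact absurd (h2.trans h3.symm) hjj
    · exact Or.inl ⟨h2.symm, h3.symm⟩
    · exact Or.inr ⟨h3.symm, h2.symm⟩
    · exact absurd (h2.trans h3.symm) hjj
  have hne : F.perm τ ≠ 1 := fun h0 => hτ (F.perm_inj (by rw [h0, map_one]))
  obtain ⟨i0, l0, hl0⟩ : ∃ i' l, F.perm τ i' l ≠ l := by
    by_contra hcon
    push Not at hcon
    exact hne (by funext i'; ext1 l; exact hcon i' l)
  obtain ⟨rfl, h1⟩ := hmov i0 l0 hl0
  have hboth : F.perm τ i0 j = j' ∧ F.perm τ i0 j' = j := by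
    rcases h1 with ⟨rfl, h2⟩ | ⟨rfl, h2⟩
    · simp only at h2
      refine ⟨h2, ?_⟩
      have : F.perm τ i0 j' ≠ j' := by
        intro h3
        exact hjj ((F.perm τ i0).injective (h2.trans h3.symm))
      obtain ⟨_, h4 | h4⟩ := hmov i0 j' this
      · exact absurd h4.1.symm hjj
      · exact h4.2
    · simp only at h2
      refine ⟨?_, h2⟩
      have : F.perm τ i0 j ≠ j := by
        intro h3
        exact hjj ((F.perm τ i0).injective (h3.trans h2.symm))
      obtain ⟨_, h4 | h4⟩ := hmov i0 j this
      · exact h4.2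
      · exact absurd h4.1 hjj
  funext i'
  ext1 l
  by_cases hi : i' = i0
  · subst hi
    rw [Pi.mulSingle_eq_same]
    by_cases hl : F.perm τ i' l = l
    · have h5 : l ≠ j := by rintro rfl; exact hjj (hl.symm.trans hboth.1)
      have h6 : l ≠ j' := by rintro rfl; exact hjj (hboth.2.symm.trans hl)
      rw [Equiv.swap_apply_of_ne_of_ne h5 h6, hl]
    · obtain ⟨_, h4 | h4⟩ := hmov i' l hl
      · rw [h4.2, h4.1]; simp
      · rw [h4.2, h4.1]; simp
  · rw [Pi.mulSingle_eq_of_ne hi]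
    by_contra hl
    exact hi (hmov i' l hl).1

instance : IsNoetherianRing F.R := by
  haveI : Algebra.FiniteType k F.R := by
    have : (F.R).FG := by
      rw [R, Subalgebra.fg_def]
      exact ⟨_, (Set.finite_range _).insert _, rfl⟩
    exact (Subalgebra.fg_iff_finiteType _).1 this
  exact Algebra.FiniteType.isNoetherianRing k F.R

/-- derivative vanishes at a collision -/
lemma deriv_zero (ψ : F.R →ₐ[k] k) (i) (j j' : Fin (d i)) (hjj : j ≠ j')
    (h : ψ (F.tR ⟨i, j⟩) = ψ (F.tR ⟨i, j'⟩)) :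
    (F.g i).evalEval (ψ F.aR) (ψ (F.tR ⟨i, j⟩)) = 0 ∧
    (derivative (F.g i)).evalEval (ψ F.aR) (ψ (F.tR ⟨i, j⟩)) = 0 := by
  have h1 := F.ψ_split ψ i
  rw [← Finset.mul_prod_erase _ _ (Finset.mem_univ j),
    ← Finset.mul_prod_erase _ _ (Finset.mem_erase.2 ⟨hjj.symm, Finset.mem_univ j'⟩), ← h] at h1
  rw [← map_evalRingHom_eval, ← map_evalRingHom_eval, ← derivative_map, h1]
  constructor <;> simp

lemma a_sub_mem (ψ : F.R →ₐ[k] k) (i) (j j' : Fin (d i)) (hjj : j ≠ j')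
    (h : ψ (F.tR ⟨i, j⟩) = ψ (F.tR ⟨i, j'⟩)) :
    F.aR - algebraMap k F.R (ψ F.aR) ∈ (RingHom.ker ψ) ^ 2 := by
  set 𝔪 := RingHom.ker ψ with hm
  set a0 := ψ F.aR with ha0
  obtain ⟨h1, h2⟩ := F.deriv_zero ψ i j j' hjj h
  set x := F.tR ⟨i, j⟩ with hx
  set u := ψ x with hu
  have h3 := F.smooth i u a0 h1 h2
  have key : ∀ y : F.R, y - algebraMap k F.R (ψ y) ∈ 𝔪 := by
    intro y; rw [hm, RingHom.mem_ker, map_sub, AlgHom.commutes]; simp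
  set α := F.aR - algebraMap k F.R a0 with hα
  set ξ := x - algebraMap k F.R u with hξ
  have hα1 : α ∈ 𝔪 := key _
  have hξ1 : ξ ∈ 𝔪 := key _
  set Gm := (F.g i).map (F.aMap : k[X] →+* F.R) with hGm
  have hroot : Gm.eval x = 0 := by
    apply Subtype.val_injective
    have := F.t_root ⟨i, j⟩
    have e : algebraMap k[X] F.L = (F.R.val : F.R →+* F.L).comp (F.aMap : k[X] →+* F.R) :=
      (RingHom.ext F.aMap_coe).symm
    rw [e, ← eval₂_map] at this
    rw [← hGm] at this
    have h5 := eval₂_at_apply (p := Gm) (F.R.val : F.R →+* F.L) x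
    exact h5.symm.trans this
  have hev : ∀ P : k[X][X], (P.map (F.aMap : k[X] →+* F.R)).eval (algebraMap k F.R u) =
      F.aMap (P.eval (C u)) := by
    intro P
    have : algebraMap k F.R u = (F.aMap : k[X] →+* F.R) (C u) := by simp [aMap]
    rw [this, eval_map, eval₂_at_apply]; rfl
  obtain ⟨K1, hK1⟩ := Polynomial.binomExpansion Gm (algebraMap k F.R u) ξ
  have hxe : algebraMap k F.R u + ξ = x := by rw [hξ]; ring
  rw [hxe, hroot, hev, hGm, derivative_map, hev] at hK1
  set p := (F.g i).eval (C u) with hp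
  obtain ⟨K2, hK2⟩ := Polynomial.binomExpansion (p.map (algebraMap k F.R)) (algebraMap k F.R a0) α
  have hae : algebraMap k F.R a0 + α = F.aR := by rw [hα]; ring
  rw [hae] at hK2
  have e1 : (p.map (algebraMap k F.R)).eval F.aR = F.aMap p := by
    rw [aMap, aeval_def, eval_map]
  have e2 : (p.map (algebraMap k F.R)).eval (algebraMap k F.R a0) = 0 := by
    rw [eval_map, eval₂_at_apply]
    have : eval a0 p = 0 := h1
    rw [this, map_zero]
  have e3 : ((derivative p).map (algebraMap k F.R)).eval (algebraMap k F.R a0) =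
      algebraMap k F.R (eval a0 (derivative p)) := by
    rw [eval_map, eval₂_at_apply]
  rw [derivative_map] at hK2
  rw [e1, e2, e3, zero_add] at hK2
  have h4 : F.aMap (eval (C u) (derivative (F.g i))) ∈ 𝔪 := by
    rw [hm, RingHom.mem_ker]
    have := F.ψ_aMap ψ (eval (C u) (derivative (F.g i)))
    rw [this]; exact h2
  have h5 : algebraMap k F.R (eval a0 (derivative p)) * α ∈ 𝔪 ^ 2 := by
    have : algebraMap k F.R (eval a0 (derivative p)) * α =
       - (K2 * α^2 + F.aMap (eval (C u) (derivative (F.g i))) * ξ + K1 * ξ^2) := by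
      rw [hK2] at hK1
      linear_combination -hK1
    rw [this]
    refine neg_mem (add_mem (add_mem ?_ ?_) ?_)
    · exact Ideal.mul_mem_left _ _ (Ideal.pow_mem_pow hα1 2)
    · rw [pow_two]; exact Ideal.mul_mem_mul h4 hξ1
    · exact Ideal.mul_mem_left _ _ (Ideal.pow_mem_pow hξ1 2)
  have h6 := Ideal.mul_mem_left _ (algebraMap k F.R (eval a0 (derivative p))⁻¹) h5
  rwa [← mul_assoc, ← map_mul, inv_mul_cancel₀ h3, map_one, one_mul] at h6

lemma swap_mem (ψ : F.R →ₐ[k] k) (i) (j j' : Fin (d i)) (hjj : j ≠ j')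
    (h : ψ (F.tR ⟨i, j⟩) = ψ (F.tR ⟨i, j'⟩)) :
    Pi.mulSingle i (Equiv.swap j j') ∈ F.perm.range := by
  classical
  by_contra hcon
  have hne : ∀ τ : F.G, τ ≠ 1 → ∃ x, ψ (F.act τ x) ≠ ψ x := by
    intro τ hτ
    by_contra hc
    push Not at hc
    exact hcon ⟨τ, F.inertia ψ i j j' hjj h τ hτ hc⟩
  have hex : ∀ τ : F.G, ∃ e : F.R, ψ e = 1 ∧ (τ ≠ 1 → ψ (F.act τ e) = 0) := by
    intro τ
    by_cases hτ : τ = 1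
    · exact ⟨1, by simp, fun h => absurd hτ h⟩
    obtain ⟨x, hx⟩ := hne τ hτ
    refine ⟨algebraMap k F.R (ψ x - ψ (F.act τ x))⁻¹ * (x - algebraMap k F.R (ψ (F.act τ x))), ?_, ?_⟩
    · rw [map_mul, map_sub, AlgHom.commutes, AlgHom.commutes]
      exact inv_mul_cancel₀ (sub_ne_zero.2 hx.symm)
    · intro _
      rw [map_mul, map_mul, map_sub, map_sub, AlgHom.commutes (F.act τ) (ψ (F.act τ x)),
        AlgHom.commutes ψ (ψ (F.act τ x))]
      simp
  choose e he1 he2 using hex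
  set r0 : F.R := ∏ τ, e τ with hr0
  have hr1 : ψ r0 = 1 := by rw [hr0, map_prod]; exact Finset.prod_eq_one fun τ _ => he1 τ
  have hr2 : ∀ τ : F.G, τ ≠ 1 → ψ (F.act τ r0) = 0 := by
    intro τ hτ
    rw [hr0, map_prod, map_prod]
    exact Finset.prod_eq_zero (Finset.mem_univ τ) (he2 τ hτ)
  set 𝔪 := RingHom.ker ψ with hm
  have hle : 𝔪 ≤ 𝔪 ^ 2 := by
    intro y hy
    set rr := r0^2 * (2 - r0^2) with hrr
    set Tr : F.R := ∑ τ : F.G, F.act τ (rr * y) with hTr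
    have hother : ∀ τ : F.G, τ ≠ 1 → F.act τ (rr * y) ∈ 𝔪 ^ 2 := by
      intro τ hτ
      rw [hrr, map_mul, map_mul, map_pow, mul_assoc]
      exact Ideal.mul_mem_right _ _ (Ideal.pow_mem_pow (RingHom.mem_ker.2 (hr2 τ hτ)) 2)
    have hTy : y - Tr ∈ 𝔪 ^ 2 := by
      rw [hTr, ← Finset.add_sum_erase _ _ (Finset.mem_univ 1), act_one]
      have : y - (rr * y + ∑ τ ∈ Finset.univ.erase 1, F.act τ (rr * y)) =
        y * (1 - r0^2)^2 - ∑ τ ∈ Finset.univ.erase 1, F.act τ (rr * y) := by rw [hrr]; ring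
      rw [this]
      refine sub_mem ?_ (Ideal.sum_mem _ fun τ hτ => hother τ (Finset.ne_of_mem_erase hτ))
      exact Ideal.mul_mem_left _ _ (Ideal.pow_mem_pow (RingHom.mem_ker.2 (by simp [hr1])) 2)
    obtain ⟨P, hP⟩ := F.fixed_mem (Tr : F.L) (F.R_int _ Tr.2) (by
      intro τ
      rw [← F.act_coe, hTr, map_sum]
      congr 1
      exact Fintype.sum_equiv (Equiv.mulLeft τ) _ _ fun τ' => rfl)
    have hP2 : F.aMap P = Tr := Subtype.ext (by rw [F.aMap_coe, hP])
    have hψT : ψ Tr = 0 := by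
      have h1 : ψ (y - Tr) = 0 := RingHom.mem_ker.1 (Ideal.pow_le_self two_ne_zero hTy)
      rw [map_sub, show ψ y = 0 from hy, zero_sub, neg_eq_zero] at h1
      exact h1
    rw [← hP2, F.ψ_aMap] at hψT
    obtain ⟨Q, hQ⟩ := dvd_iff_isRoot.2 hψT
    have hTm : Tr ∈ 𝔪 ^ 2 := by
      rw [← hP2, hQ, map_mul]
      apply Ideal.mul_mem_right
      have := F.a_sub_mem ψ i j j' hjj h
      simpa [aMap] using this
    have := add_mem hTy hTm
    simpa using this
  have hid : IsIdempotentElem 𝔪 := by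
    rw [IsIdempotentElem, ← pow_two]
    exact le_antisymm (Ideal.pow_le_self two_ne_zero) hle
  rcases (Ideal.isIdempotentElem_iff_eq_bot_or_top 𝔪 (IsNoetherian.noetherian 𝔪)).1 hid with h0 | h0
  · have h1 : F.aMap (X - C (ψ F.aR)) ∈ 𝔪 := by
      rw [hm, RingHom.mem_ker]
      have := F.ψ_aMap ψ (X - C (ψ F.aR))
      rw [this]; simp
    rw [h0, Ideal.mem_bot] at h1
    have h2 := congrArg (Subtype.val) h1
    rw [F.aMap_coe] at h2
    have h3 := F.algMap_injective (h2.trans (map_zero _).symm)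
    exact X_sub_C_ne_zero _ h3
  · have : (1 : F.R) ∈ 𝔪 := by rw [h0]; trivial
    rw [hm, RingHom.mem_ker, map_one] at this
    exact one_ne_zero this

end Fam
end LineIrr

end

section
open Polynomial
open Polynomial

namespace LineIrr
namespace Fam
variable {k : Type} [Field k] {r : ℕ} {d : Fin r → ℕ} (F : Fam k r d) [IsAlgClosed k]

lemma conj_swap (τ : F.G) (i) (j j' : Fin (d i)) :
    Pi.mulSingle i (Equiv.swap (F.perm τ i j) (F.perm τ i j')) =
      F.perm τ * Pi.mulSingle i (Equiv.swap j j') * (F.perm τ)⁻¹ := by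
  funext i'
  by_cases h : i' = i
  · subst h
    simp [Equiv.swap_apply_apply]
  · simp [Pi.mulSingle_eq_of_ne h]

lemma all_swaps (i) (j j' : Fin (d i)) (hjj : j ≠ j') :
    Pi.mulSingle i (Equiv.swap j j') ∈ F.perm.range := by
  classical
  by_contra hcon
  set S : Finset (Σ i, Fin (d i) × Fin (d i)) := Finset.univ.filter
    (fun x => x.2.1 ≠ x.2.2 ∧ Pi.mulSingle x.1 (Equiv.swap x.2.1 x.2.2) ∉ F.perm.range) with hS
  set E : F.R := ∏ x ∈ S, (F.tR ⟨x.1, x.2.1⟩ - F.tR ⟨x.1, x.2.2⟩) with hE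
  have hmem : (⟨i, (j, j')⟩ : Σ i, Fin (d i) × Fin (d i)) ∈ S := by
    rw [hS, Finset.mem_filter]; exact ⟨Finset.mem_univ _, hjj, hcon⟩
  have hfix : ∀ τ, F.act τ E = E := by
    intro τ
    rw [hE, map_prod]
    let e : (Σ i, Fin (d i) × Fin (d i)) ≃ (Σ i, Fin (d i) × Fin (d i)) :=
      Equiv.sigmaCongrRight fun i => Equiv.prodCongr (F.perm τ i) (F.perm τ i)
    refine Finset.prod_equiv e ?_ ?_
    · rintro ⟨i, j, j'⟩
      rw [hS, Finset.mem_filter, Finset.mem_filter]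
      have : e ⟨i, j, j'⟩ = ⟨i, F.perm τ i j, F.perm τ i j'⟩ := rfl
      rw [this]
      simp only [Finset.mem_univ, true_and, (F.perm τ i).injective.ne_iff, conj_swap]
      have h1 : F.perm τ ∈ F.perm.range := ⟨τ, rfl⟩
      rw [Subgroup.mul_mem_cancel_right _ (inv_mem h1), Subgroup.mul_mem_cancel_left _ h1]
    · rintro ⟨i, j, j'⟩ _
      have : e ⟨i, j, j'⟩ = ⟨i, F.perm τ i j, F.perm τ i j'⟩ := rfl
      rw [this, map_sub, act_t, act_t]
  obtain ⟨P, hP⟩ := F.fixed_mem (E : F.L) (F.R_int _ E.2) (fun τ => by rw [← F.act_coe, hfix])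
  have hP2 : F.aMap P = E := Subtype.ext (by rw [F.aMap_coe, hP])
  have hP3 : evi k P = F.κ E := by rw [← hP, F.κ_alg]
  set ρ : PowerSeries k := ∏ x ∈ S, (F.s ⟨x.1, x.2.1⟩ - F.s ⟨x.1, x.2.2⟩) with hρ
  have h1 : zz k ^ S.card * evi k P = HahnSeries.ofPowerSeries ℤ k ρ := by
    rw [hP3, hE, ← Finset.prod_const, hρ, map_prod]
    have : ((∏ x ∈ S, (F.tR ⟨x.1, x.2.1⟩ - F.tR ⟨x.1, x.2.2⟩) : F.R) : F.L) =
      ∏ x ∈ S, (F.t ⟨x.1, x.2.1⟩ - F.t ⟨x.1, x.2.2⟩) :=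
        map_prod F.R.val _ _
    rw [this, map_prod, ← Finset.prod_mul_distrib]
    refine Finset.prod_congr rfl fun x _ => ?_
    rw [map_sub, mul_sub, F.κ_t, F.κ_t, map_sub]
  have h2 : PowerSeries.constantCoeff ρ ≠ 0 := by
    rw [hρ, map_prod, Finset.prod_ne_zero_iff]
    intro x hx
    rw [hS, Finset.mem_filter] at hx
    rw [map_sub, sub_ne_zero]
    exact fun h => hx.2.1 (F.s_inj x.1 h)
  have hdeg : P.natDegree ≠ 0 := by
    intro h0
    obtain ⟨c, rfl⟩ := natDegree_eq_zero.1 h0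
    rw [evi_C] at h1
    have h3 : ρ = PowerSeries.X ^ S.card * PowerSeries.C c := by
      apply HahnSeries.ofPowerSeries_injective (Γ := ℤ)
      rw [← h1]; simp
    apply h2
    rw [h3, map_mul, map_pow]
    have : S.card ≠ 0 := (Finset.card_pos.2 ⟨_, hmem⟩).ne'
    simp [this]
  obtain ⟨a0, ha0⟩ := IsAlgClosed.exists_root P (by
    intro h0; exact hdeg (natDegree_eq_of_degree_eq_some (h0 : P.degree = ((0:ℕ) : WithBot ℕ))))
  obtain ⟨ψ, hψ⟩ := F.exists_pt a0
  have h3 : ψ E = 0 := by rw [← hP2, F.ψ_aMap, hψ]; exact ha0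
  rw [hE, map_prod, Finset.prod_eq_zero_iff] at h3
  obtain ⟨x, hx, hx2⟩ := h3
  rw [hS, Finset.mem_filter] at hx
  rw [map_sub, sub_eq_zero] at hx2
  exact hx.2.2 (F.swap_mem ψ x.1 x.2.1 x.2.2 hx.2.1 hx2)

theorem perm_surj : Function.Surjective F.perm := by
  classical
  rw [← MonoidHom.range_eq_top, eq_top_iff]
  intro σ _
  refine Subgroup.pi_mem_of_mulSingle_mem σ fun i => ?_
  have h : (⊤ : Subgroup (Equiv.Perm (Fin (d i)))) ≤
      F.perm.range.comap (MonoidHom.mulSingle (fun i => Equiv.Perm (Fin (d i))) i) := by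
    rw [← Equiv.Perm.closure_isSwap, Subgroup.closure_le]
    rintro _ ⟨x, y, hxy, rfl⟩
    exact F.all_swaps i x y hxy
  exact h (Subgroup.mem_top (σ i))

noncomputable def permEquiv : F.G ≃* (∀ i, Equiv.Perm (Fin (d i))) :=
  MulEquiv.ofBijective F.perm ⟨F.perm_inj, F.perm_surj⟩

lemma card_G : Nat.card F.G = ∏ i, (d i).factorial := by
  rw [Nat.card_congr F.permEquiv.toEquiv, Nat.card_eq_fintype_card, Fintype.card_pi]
  simp [Fintype.card_perm]

end Fam
end LineIrr

end

section
open Polynomial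
open Polynomial

namespace LineIrr
namespace Fam
variable {k : Type} [Field k] {r : ℕ} {d : Fin r → ℕ} (F : Fam k r d) [IsAlgClosed k]

noncomputable def V : Submodule k F.R := Submodule.span k (insert 1 (insert F.aR (Set.range F.tR)))
lemma V_one : (1 : F.R) ∈ F.V := Submodule.subset_span (Set.mem_insert _ _)
lemma V_a : F.aR ∈ F.V := Submodule.subset_span (Set.mem_insert_of_mem _ (Set.mem_insert _ _))
lemma V_t (x) : F.tR x ∈ F.V :=
  Submodule.subset_span (Set.mem_insert_of_mem _ (Set.mem_insert_of_mem _ ⟨x, rfl⟩))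
lemma V_mono {X Y : ℕ} (h : X ≤ Y) : F.V ^ X ≤ F.V ^ Y :=
  pow_le_pow_right₀ (Submodule.one_le.mpr F.V_one) h

lemma act_V (τ : F.G) : F.V.map (F.act τ).toLinearMap ≤ F.V := by
  rw [V, Submodule.map_span_le]
  rintro x (rfl | rfl | ⟨x, rfl⟩)
  · simpa [V] using F.V_one
  · simpa [act_a, V] using F.V_a
  · have := F.V_t ⟨x.1, F.perm τ x.1 x.2⟩
    simpa [← act_t, V] using this

lemma act_Vpow (τ : F.G) {X : ℕ} {y : F.R} (hy : y ∈ F.V ^ X) : F.act τ y ∈ F.V ^ X := by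
  have h : (F.V ^ X).map (F.act τ).toLinearMap ≤ F.V ^ X := by
    rw [Submodule.map_pow]
    exact pow_le_pow_left' (F.act_V τ) X
  exact h ⟨y, hy, rfl⟩

lemma low_V (y : F.R) (hy : y ∈ F.V) : ∃ ρ : PowerSeries k,
    HahnSeries.ofPowerSeries ℤ k ρ = zz k * F.κ y := by
  rw [V] at hy
  induction hy using Submodule.span_induction with
  | mem x h =>
    rcases h with (rfl | rfl | ⟨x, rfl⟩)
    · exact ⟨PowerSeries.X, by simp [zz]⟩
    · refine ⟨1, ?_⟩
      show _ = zz k * F.κ (algebraMap k[X] F.L X)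
      rw [F.κ_alg, evi_X, mul_inv_cancel₀ (zz_ne k), map_one]
    · exact ⟨_, (F.κ_t x).symm⟩
  | zero => exact ⟨0, by simp⟩
  | add x y _ _ h1 h2 =>
    obtain ⟨ρ, h1⟩ := h1
    obtain ⟨ρ', h2⟩ := h2
    exact ⟨ρ + ρ', by rw [map_add, h1, h2]; simp [mul_add]⟩
  | smul c x _ h =>
    obtain ⟨ρ, h⟩ := h
    refine ⟨PowerSeries.C c * ρ, ?_⟩
    rw [map_mul, h, HahnSeries.ofPowerSeries_C, Algebra.smul_def]
    have : F.κ ((algebraMap k F.R c : F.R) : F.L) = HahnSeries.C c := F.κ_C c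
    rw [Subalgebra.coe_mul, map_mul, this]; ring

lemma low_X (X : ℕ) (y : F.R) (hy : y ∈ F.V ^ X) : ∃ ρ : PowerSeries k,
    HahnSeries.ofPowerSeries ℤ k ρ = zz k ^ X * F.κ y := by
  induction X generalizing y with
  | zero =>
    rw [pow_zero, Submodule.mem_one] at hy
    obtain ⟨c, rfl⟩ := hy
    refine ⟨PowerSeries.C c, ?_⟩
    have : F.κ ((algebraMap k F.R c : F.R) : F.L) = HahnSeries.C c := F.κ_C c
    rw [this, pow_zero, one_mul, HahnSeries.ofPowerSeries_C]
  | succ X ih =>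
    rw [pow_succ] at hy
    induction hy using Submodule.mul_induction_on' with
    | mem_mul_mem m hm n hn =>
      obtain ⟨ρ, h1⟩ := ih m hm
      obtain ⟨ρ', h2⟩ := F.low_V n hn
      exact ⟨ρ * ρ', by rw [map_mul, h1, h2, Subalgebra.coe_mul, map_mul]; ring⟩
    | add x _ y _ h1 h2 =>
      obtain ⟨ρ, h1⟩ := h1
      obtain ⟨ρ', h2⟩ := h2
      exact ⟨ρ + ρ', by rw [map_add, h1, h2, Subalgebra.coe_add, map_add, mul_add]⟩

lemma high_X (X : ℕ) (y : F.R) (ρ : PowerSeries k) (hy : y ∈ F.V ^ X)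
    (hρ : HahnSeries.ofPowerSeries ℤ k ρ = zz k ^ X * F.κ y)
    (hc : ∀ i ≤ Nat.card F.G * X, PowerSeries.coeff i ρ = 0) : y = 0 := by
  classical
  by_contra h0
  have hy0 : (y : F.L) ≠ 0 := fun h => h0 (Subtype.ext h)
  choose ρ' hρ' using fun τ : F.G => F.low_X X _ (F.act_Vpow τ hy)
  have e1 : ρ' 1 = ρ := by
    apply HahnSeries.ofPowerSeries_injective (Γ := ℤ)
    rw [hρ, hρ', act_one]
  obtain ⟨P, hP⟩ := F.fixed_mem (∏ τ : F.G, (F.act τ y : F.L))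
    (IsIntegral.prod _ fun τ _ => F.R_int _ (F.act τ y).2) (by
      intro τ
      rw [map_prod]
      refine Fintype.prod_equiv (Equiv.mulLeft τ) _ _ fun σ => ?_
      rfl)
  have hP0 : P ≠ 0 := by
    rintro rfl
    rw [map_zero] at hP
    refine absurd hP.symm (Finset.prod_ne_zero_iff.2 fun τ _ => ?_)
    rw [act_coe]; simpa using hy0
  have h1 := F.κ_alg P
  rw [hP, map_prod] at h1
  obtain ⟨i, hi, hi'⟩ := evi_order P hP0 (Nat.card F.G * X) (∏ τ : F.G, ρ' τ) (by
    rw [← h1, map_prod, mul_comm, pow_mul, Nat.card_eq_fintype_card, ← Finset.card_univ]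
    simp only [hρ']
    rw [Finset.prod_mul_distrib, Finset.prod_const, ← pow_mul, ← pow_mul]
    ring)
  apply hi'
  rw [← Finset.mul_prod_erase _ _ (Finset.mem_univ (1 : F.G)), e1]
  have h2 : PowerSeries.X ^ (Nat.card F.G * X + 1) ∣ ρ :=
    PowerSeries.X_pow_dvd_iff.2 fun m hm => hc m (by omega)
  exact PowerSeries.X_pow_dvd_iff.1 (h2.mul_right _) i (by omega)

lemma V_top (y : F.R) : ∃ X, y ∈ F.V ^ X := by
  obtain ⟨y, hy⟩ := y
  refine Algebra.adjoin_induction (p := fun y hy => ∃ X, (⟨y, hy⟩ : F.R) ∈ F.V ^ X) ?_ ?_ ?_ ?_ hy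
  · rintro x (rfl | ⟨x, rfl⟩)
    · exact ⟨1, by rw [pow_one]; exact F.V_a⟩
    · exact ⟨1, by rw [pow_one]; exact F.V_t x⟩
  · intro c
    exact ⟨0, by rw [pow_zero, Submodule.mem_one]; exact ⟨c, rfl⟩⟩
  · rintro x y hx hy ⟨X, h1⟩ ⟨Y, h2⟩
    exact ⟨max X Y, Submodule.add_mem _ (F.V_mono (le_max_left _ _) h1) (F.V_mono (le_max_right _ _) h2)⟩
  · rintro x y hx hy ⟨X, h1⟩ ⟨Y, h2⟩
    exact ⟨X + Y, by rw [pow_add]; exact Submodule.mul_mem_mul h1 h2⟩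

end Fam
end LineIrr

end

section
open Polynomial
open Polynomial

namespace LineIrr
namespace Fam
variable {k : Type} [Field k] {r : ℕ} {d : Fin r → ℕ} (F : Fam k r d) [IsAlgClosed k]

noncomputable def W : Submodule (RatFunc k) F.L := Submodule.span _ (insert 1 (Set.range F.t))

lemma W_one : (1 : F.L) ∈ F.W := Submodule.subset_span (Set.mem_insert _ _)
lemma W_t (x) : F.t x ∈ F.W := Submodule.subset_span (Set.mem_insert_of_mem _ ⟨x, rfl⟩)

lemma W_stab (j : ℕ) (h : F.W ^ (j+1) ≤ F.W ^ j) : F.W ^ j = ⊤ := by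
  rw [eq_top_iff]
  intro y _
  have hy : y ∈ Algebra.adjoin (RatFunc k) (Set.range F.t) := by rw [F.adjoin_t]; trivial
  have key : ∀ w ∈ F.W ^ j, y * w ∈ F.W ^ j := by
    induction hy using Algebra.adjoin_induction with
    | mem x hx =>
      obtain ⟨x, rfl⟩ := hx
      intro w hw
      apply h
      rw [pow_succ']
      exact Submodule.mul_mem_mul (F.W_t x) hw
    | algebraMap c => intro w hw; rw [← Algebra.smul_def]; exact Submodule.smul_mem _ _ hw
    | add x y _ _ h1 h2 =>
      intro w hw; rw [add_mul]; exact Submodule.add_mem _ (h1 trivial w hw) (h2 trivial w hw)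
    | mul x y _ _ h1 h2 => intro w hw; rw [mul_assoc]; exact h1 trivial _ (h2 trivial w hw)
  have h1 : (1 : F.L) ∈ F.W ^ j := by simpa using Submodule.pow_mem_pow _ F.W_one j
  simpa using key 1 h1

lemma W_dim (j : ℕ) : F.W ^ j = ⊤ ∨ j + 1 ≤ Module.finrank (RatFunc k) ↥(F.W ^ j) := by
  induction j with
  | zero =>
    right
    by_contra h
    have : Module.finrank (RatFunc k) ↥(F.W ^ 0) = 0 := by omega
    rw [Submodule.finrank_eq_zero, pow_zero] at this
    have h1 : (1 : F.L) ∈ (1 : Submodule (RatFunc k) F.L) := Submodule.one_le.1 le_rfl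
    rw [this] at h1
    exact one_ne_zero ((Submodule.mem_bot _).1 h1)
  | succ j ih =>
    have hle : F.W ^ j ≤ F.W ^ (j+1) := pow_le_pow_right₀ (Submodule.one_le.mpr F.W_one) (by omega)
    by_cases hs : F.W ^ (j+1) ≤ F.W ^ j
    · left
      rw [eq_top_iff, ← F.W_stab j hs]; exact hle
    · rcases ih with ih | ih
      · left; rw [eq_top_iff, ← ih]; exact hle
      · right
        have := Submodule.finrank_lt_finrank_of_lt (lt_of_le_not_ge hle hs)
        omega

lemma W_top : F.W ^ (Nat.card F.G) = ⊤ := by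
  rcases F.W_dim (Nat.card F.G) with h | h
  · exact h
  · have h1 := Submodule.finrank_le (F.W ^ (Nat.card F.G))
    rw [IsGalois.card_aut_eq_finrank] at h h1
    omega

open scoped Pointwise in
lemma lift_mon (m : ℕ) (y : F.L) (hy : y ∈ (insert 1 (Set.range F.t) : Set F.L) ^ m) :
    ∃ b : F.R, (b : F.L) = y ∧ b ∈ F.V ^ m ∧ b ∈ Submonoid.closure (Set.range F.tR) := by
  induction m generalizing y with
  | zero =>
    rw [pow_zero, Set.mem_one] at hy
    exact ⟨1, hy.symm ▸ rfl, by rw [pow_zero]; exact Submodule.one_le.1 le_rfl, one_mem _⟩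
  | succ m ih =>
    rw [pow_succ, Set.mem_mul] at hy
    obtain ⟨u, hu, v, hv, rfl⟩ := hy
    obtain ⟨b, rfl, h1, h2⟩ := ih u hu
    rcases hv with rfl | ⟨x, rfl⟩
    · exact ⟨b, (mul_one _).symm, F.V_mono (by omega) h1, h2⟩
    · exact ⟨b * F.tR x, rfl, by rw [pow_succ]; exact Submodule.mul_mem_mul h1 (F.V_t x),
        mul_mem h2 (Submonoid.subset_closure ⟨x, rfl⟩)⟩

open scoped Pointwise in
lemma exists_b : ∃ b : Fin (Nat.card F.G) → F.R, (∀ i, b i ∈ F.V ^ (Nat.card F.G)) ∧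
    (∀ i, b i ∈ Submonoid.closure (Set.range F.tR)) ∧
    LinearIndependent k (fun x : Fin (Nat.card F.G) × ℕ => b x.1 * F.aR ^ x.2) := by
  generalize hn : Nat.card F.G = n
  have hsp : Submodule.span (RatFunc k) ((insert 1 (Set.range F.t) : Set F.L) ^ n) = ⊤ := by
    rw [← Submodule.span_pow, ← hn]; exact F.W_top
  have h1 := Submodule.exists_fun_fin_finrank_span_eq (RatFunc k)
    ((insert 1 (Set.range F.t) : Set F.L) ^ n)
  have hfr : Module.finrank (RatFunc k)
      ↥(Submodule.span (RatFunc k) ((insert 1 (Set.range F.t) : Set F.L) ^ n)) = n := by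
    rw [hsp, finrank_top, ← hn, IsGalois.card_aut_eq_finrank]
  rw [hfr] at h1
  obtain ⟨f, hf, -, hli⟩ := h1
  choose b hb hb1 hb2 using fun i => F.lift_mon n (f i) (hf i)
  refine ⟨b, hb1, hb2, ?_⟩
  have hX : LinearIndependent k (fun x : ℕ => (algebraMap k[X] (RatFunc k) X) ^ x) := by
    have h2 : LinearIndependent k (fun x : ℕ => (X : k[X]) ^ x) := by
      have := (Polynomial.basisMonomials k).linearIndependent
      simpa [Function.comp_def, X_pow_eq_monomial] using this
    have h3 := h2.map' (IsScalarTower.toAlgHom k k[X] (RatFunc k)).toLinearMap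
      (LinearMap.ker_eq_bot.2 (IsFractionRing.injective k[X] (RatFunc k)))
    simpa [Function.comp_def] using h3
  have h4 := linearIndependent_smul hX hli
  have h5 := h4.comp Prod.swap Prod.swap_injective
  apply LinearIndependent.of_comp F.R.val.toLinearMap
  have e : F.R.val.toLinearMap ∘ (fun x : Fin n × ℕ => b x.1 * F.aR ^ x.2) =
      (fun p : ℕ × Fin n => (algebraMap k[X] (RatFunc k)) X ^ p.1 • f p.2) ∘ Prod.swap := by
    funext x
    simp only [Function.comp, AlgHom.toLinearMap_apply, Subalgebra.val_apply, Prod.swap]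
    rw [Subalgebra.coe_mul, Subalgebra.coe_pow, hb, Algebra.smul_def, map_pow, mul_comm]
    rfl
  rw [e]
  exact h5

end Fam
end LineIrr

end

section
open Polynomial
open Polynomial

namespace LineIrr

lemma deriv_eval₂ {k L : Type*} [Field k] [Field L] [Algebra k L] (φ : k[X] →+* L)
    (Dl : Derivation k L L) (hD : ∀ P, Dl (φ P) = φ (derivative P)) (y : L) (P : k[X][X]) :
    Dl (eval₂ φ y P) = ∑ j ∈ Finset.range (P.natDegree + 1), φ (derivative (P.coeff j)) * y ^ j
      + eval₂ φ y (derivative P) * Dl y := by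
  have h1 : derivative P = ∑ j ∈ Finset.range (P.natDegree + 1), C (P.coeff j * (j : k[X])) * X ^ (j - 1) := by
    conv_lhs => rw [P.as_sum_range_C_mul_X_pow, derivative_sum]
    refine Finset.sum_congr rfl fun j _ => derivative_C_mul_X_pow _ _
  rw [eval₂_eq_sum_range, map_sum, h1, eval₂_finset_sum, Finset.sum_mul, ← Finset.sum_add_distrib]
  refine Finset.sum_congr rfl fun j _ => ?_
  rw [Derivation.leibniz, Derivation.leibniz_pow, hD, eval₂_mul, eval₂_C, eval₂_pow, eval₂_X, map_mul,
    map_natCast]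
  simp only [smul_eq_mul, nsmul_eq_mul]
  ring

lemma deriv_prod {A ι : Type*} [CommRing A] [Fintype ι] [DecidableEq ι] (s : ι → A) (x : ι) :
    (derivative (∏ j, (X - C (s j)))).eval (s x) = ∏ j ∈ Finset.univ.erase x, (s x - s j) := by
  rw [← Finset.mul_prod_erase _ _ (Finset.mem_univ x), derivative_mul]
  simp [eval_prod]

namespace Fam
variable {k : Type} [Field k] {r : ℕ} {d : Fin r → ℕ} (F : Fam k r d) [IsAlgClosed k]

noncomputable def VL : Submodule k F.L := F.V.map F.R.val.toLinearMap
lemma VL_one : (1 : F.L) ∈ F.VL := ⟨1, F.V_one, rfl⟩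
lemma VL_a : F.aL ∈ F.VL := ⟨F.aR, F.V_a, rfl⟩
lemma VL_t (x) : F.t x ∈ F.VL := ⟨F.tR x, F.V_t x, rfl⟩
lemma VL_mono {X Y : ℕ} (h : X ≤ Y) : F.VL ^ X ≤ F.VL ^ Y :=
  pow_le_pow_right₀ (Submodule.one_le.mpr F.VL_one) h
lemma VL_pow (X : ℕ) : F.VL ^ X = (F.V ^ X).map F.R.val.toLinearMap := by
  rw [Submodule.map_pow]; rfl

lemma VL_alg (N : ℕ) (P : k[X]) (h : P.natDegree ≤ N) : algebraMap k[X] F.L P ∈ F.VL ^ N := by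
  rw [← aeval_aL, aeval_eq_sum_range]
  refine Submodule.sum_mem _ fun i hi => Submodule.smul_mem _ _ ?_
  exact F.VL_mono (by have := Finset.mem_range.1 hi; omega) (Submodule.pow_mem_pow _ F.VL_a i)

lemma prod_VL {ι : Type*} (s : Finset ι) (f : ι → F.L) (N : ι → ℕ)
    (h : ∀ i ∈ s, f i ∈ F.VL ^ N i) : ∏ i ∈ s, f i ∈ F.VL ^ (∑ i ∈ s, N i) := by
  classical
  induction s using Finset.induction_on with
  | empty => simp only [Finset.prod_empty, Finset.sum_empty, pow_zero]; exact Submodule.one_le.1 le_rfl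
  | insert a s ha ih =>
    rw [Finset.prod_insert ha, Finset.sum_insert ha, pow_add]
    exact Submodule.mul_mem_mul (h _ (Finset.mem_insert_self _ _))
      (ih fun i hi => h i (Finset.mem_insert_of_mem hi))

noncomputable def γ (x : Σ i, Fin (d i)) : F.R :=
  ∏ j ∈ Finset.univ.erase x.2, (F.tR x - F.tR ⟨x.1, j⟩)

lemma γ_coe (x) : (F.γ x : F.L) = eval₂ (algebraMap k[X] F.L) (F.t x) (derivative (F.g x.1)) := by
  rw [← eval_map, ← derivative_map, F.g_eq, deriv_prod (fun j => F.t ⟨x.1, j⟩) x.2]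
  rw [γ]
  exact map_prod F.R.val _ _

lemma γ_mem (x) : (F.γ x : F.L) ∈ F.VL ^ d x.1 := by
  have h := F.prod_VL (Finset.univ.erase x.2) (fun j => F.t x - F.t ⟨x.1, j⟩) (fun _ => 1)
    (fun i _ => by rw [pow_one]; exact Submodule.sub_mem _ (F.VL_t _) (F.VL_t _))
  have e : (F.γ x : F.L) = ∏ j ∈ Finset.univ.erase x.2, (F.t x - F.t ⟨x.1, j⟩) :=
    map_prod F.R.val _ _
  rw [e]
  refine F.VL_mono ?_ h
  simp

instance : Algebra.FormallyEtale k[X] F.L := by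
  haveI : Algebra.FormallyEtale k[X] (RatFunc k) :=
    Algebra.FormallyEtale.of_isLocalization (nonZeroDivisors k[X])
  haveI : Algebra.FormallyEtale (RatFunc k) F.L := Algebra.FormallyEtale.of_isSeparable _ _
  exact Algebra.FormallyEtale.comp k[X] (RatFunc k) F.L

lemma exists_Dl : ∃ D : Derivation k F.L F.L, ∀ P,
    D (algebraMap k[X] F.L P) = algebraMap k[X] F.L (derivative P) :=
  exists_deriv ((Algebra.linearMap k[X] F.L).compDer derivative')

noncomputable def Dl : Derivation k F.L F.L := F.exists_Dl.choose
lemma Dl_alg (P) : F.Dl (algebraMap k[X] F.L P) = algebraMap k[X] F.L (derivative P) :=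
  F.exists_Dl.choose_spec P

lemma γ_Dl (x) : F.γ x * F.Dl (F.t x) ∈ F.VL ^ d x.1 := by
  have h := deriv_eval₂ (algebraMap k[X] F.L) F.Dl F.Dl_alg (F.t x) (F.g x.1)
  rw [F.t_root, map_zero, ← γ_coe, F.deg] at h
  rw [← neg_eq_of_add_eq_zero_right h.symm]
  refine Submodule.neg_mem _ (Submodule.sum_mem _ fun j hj => ?_)
  have hj := Finset.mem_range.1 hj
  refine F.VL_mono (X := (d x.1 - j) + j) (by omega) ?_
  rw [pow_add]
  refine Submodule.mul_mem_mul (F.VL_alg _ _ ?_) (Submodule.pow_mem_pow _ (F.VL_t x) _)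
  exact (natDegree_derivative_le _).trans ((Nat.sub_le _ _).trans (F.low _ _))

noncomputable def Δ : F.R := ∏ x, F.γ x
noncomputable def cc (d : Fin r → ℕ) : ℕ := ∑ x : (Σ i, Fin (d i)), d x.1

lemma Δ_coe : (F.Δ : F.L) = ∏ x, (F.γ x : F.L) := map_prod F.R.val _ _

lemma ΔD_V (y : F.L) (hy : y ∈ F.VL) : F.Δ * F.Dl y ∈ F.VL ^ (cc d) := by
  classical
  obtain ⟨y, hy, rfl⟩ := hy
  rw [SetLike.mem_coe, V] at hy
  induction hy using Submodule.span_induction with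
  | mem y h =>
    rcases h with (rfl | rfl | ⟨x, rfl⟩)
    · simp
    · show _ * F.Dl (algebraMap k[X] F.L X) ∈ _
      rw [F.Dl_alg, derivative_X, map_one, mul_one, Δ_coe]
      exact F.prod_VL _ _ _ fun x _ => F.γ_mem x
    · show _ * F.Dl (F.t x) ∈ _
      rw [Δ_coe, ← Finset.mul_prod_erase _ _ (Finset.mem_univ x), mul_right_comm, cc,
        ← Finset.add_sum_erase _ _ (Finset.mem_univ x), pow_add]
      exact Submodule.mul_mem_mul (F.γ_Dl x) (F.prod_VL _ _ _ fun x _ => F.γ_mem x)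
  | zero => simp
  | add x y _ _ h1 h2 => simp only [map_add, mul_add]; exact Submodule.add_mem _ h1 h2
  | smul c x _ h => simp only [map_smul, Derivation.map_smul, mul_smul_comm]; exact Submodule.smul_mem _ _ h

lemma ΔD_mem (X : ℕ) (y : F.L) (hy : y ∈ F.VL ^ X) : F.Δ * F.Dl y ∈ F.VL ^ (X + cc d) := by
  induction X generalizing y with
  | zero =>
    rw [pow_zero, Submodule.mem_one] at hy
    obtain ⟨c, rfl⟩ := hy
    simp
  | succ X ih =>
    rw [pow_succ] at hy
    induction hy using Submodule.mul_induction_on' with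
    | mem_mul_mem m hm n hn =>
      rw [Derivation.leibniz, smul_eq_mul, smul_eq_mul, mul_add]
      refine Submodule.add_mem _ ?_ ?_
      · rw [mul_left_comm]
        refine F.VL_mono (X := X + cc d) (by omega) ?_
        rw [pow_add]
        exact Submodule.mul_mem_mul hm (F.ΔD_V n hn)
      · rw [mul_left_comm, add_right_comm, add_comm, pow_add, pow_one]
        exact Submodule.mul_mem_mul hn (ih m hm)
    | add x _ y _ h1 h2 => rw [map_add, mul_add]; exact Submodule.add_mem _ h1 h2

lemma ΔD_R (y : F.R) : F.Δ * F.Dl y ∈ F.R := by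
  obtain ⟨X, hX⟩ := F.V_top y
  have := F.ΔD_mem X y (by rw [VL_pow]; exact ⟨y, hX, rfl⟩)
  rw [VL_pow] at this
  obtain ⟨z, -, hz⟩ := this
  rw [← hz]; exact z.2

noncomputable def DR : Derivation k F.R F.R :=
  Derivation.mk' ((((F.Δ : F.L) • F.Dl).toLinearMap ∘ₗ F.R.val.toLinearMap).codRestrict
    F.R.toSubmodule (fun y => F.ΔD_R y)) (by
    intro x y
    apply Subtype.ext
    show F.Δ * F.Dl (x * y) = x * (F.Δ * F.Dl y) + y * (F.Δ * F.Dl x)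
    rw [Derivation.leibniz, smul_eq_mul, smul_eq_mul]; ring)

lemma DR_coe (y : F.R) : (F.DR y : F.L) = F.Δ * F.Dl y := rfl
lemma DR_a : F.DR F.aR = F.Δ := by
  apply Subtype.ext
  rw [DR_coe]
  show _ * F.Dl (algebraMap k[X] F.L X) = _
  rw [F.Dl_alg, derivative_X, map_one, mul_one]

noncomputable def step : StepData k F.R (Nat.card F.G) (cc d) where
  V := F.V
  one_mem := F.V_one
  a := F.aR
  a_mem := F.V_a
  npos := Nat.card_pos
  b := F.exists_b.choose
  b_mem := F.exists_b.choose_spec.1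
  li := F.exists_b.choose_spec.2.2
  κ := F.κ.comp F.R.val
  κC := F.κ_C
  low := F.low_X
  high := F.high_X
  D := F.DR
  D_mem X y hy := by
    have := F.ΔD_mem X y (by rw [VL_pow]; exact ⟨y, hy, rfl⟩)
    rw [VL_pow] at this
    obtain ⟨z, hz, hz'⟩ := this
    have e : F.DR y = z := Subtype.ext hz'.symm
    rwa [e]
  top := F.V_top

lemma step_b (i) : F.step.b i ∈ Submonoid.closure (Set.range F.tR) := F.exists_b.choose_spec.2.1 i

end Fam
end LineIrr

end

section
open Polynomial
open Polynomial

namespace LineIrr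

lemma cycleType_iff {e : ℕ} (he : 2 ≤ e) (σ : Equiv.Perm (Fin e)) :
    σ.cycleType = {e} ↔ ∀ x y, σ.SameCycle x y := by
  constructor
  · intro h x y
    have hc : σ.IsCycle := by rw [← Equiv.Perm.card_cycleType_eq_one, h]; simp
    have hs : σ.support = Finset.univ := by
      apply Finset.eq_univ_of_card
      have := σ.sum_cycleType
      rw [h] at this
      simpa using this.symm
    exact hc.sameCycle (Equiv.Perm.mem_support.1 (by rw [hs]; simp)) (Equiv.Perm.mem_support.1 (by rw [hs]; simp))
  · intro h
    have hne : ∀ x, σ x ≠ x := by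
      intro x hx
      haveI : Nontrivial (Fin e) := Fin.nontrivial_iff_two_le.2 he
      obtain ⟨y, hy⟩ := exists_ne x
      obtain ⟨i, hi⟩ := h x y
      rw [Equiv.Perm.zpow_apply_eq_self_of_apply_eq_self hx] at hi
      exact hy hi.symm
    have hc : σ.IsCycle := (Equiv.Perm.isCycle_iff_sameCycle (hne ⟨0, by omega⟩)).2
      fun {y} => ⟨fun _ => hne y, fun _ => h _ _⟩
    have hs : σ.support = Finset.univ := by ext x; simp [hne]
    rw [hc.cycleType, hs]; simp

lemma card_full {e : ℕ} (he : 2 ≤ e) :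
    (Finset.univ.filter fun σ : Equiv.Perm (Fin e) => σ.cycleType = {e}).card * e = e.factorial := by
  have := Equiv.Perm.card_of_cycleType_singleton (α := Fin e) he (by simp)
  rw [this]
  simp only [Fintype.card_fin, Nat.choose_self, mul_one]
  rw [mul_comm, Nat.mul_factorial_pred (by omega)]

section
variable {K k : Type} [Field K] [Fintype K] [Field k] [Algebra K k]

lemma frob_fixed (y : k) (hy : y ^ Fintype.card K = y) : ∃ x : K, algebraMap K k x = y := by
  have h1 : (X ^ Fintype.card K - X : K[X]) = ∏ x : K, (X - C x) := by
    have h := FiniteField.roots_X_pow_card_sub_X K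
    have hm : (X ^ Fintype.card K - X : K[X]).Monic := by
      apply monic_X_pow_sub
      rw [degree_X]; exact_mod_cast Fintype.one_lt_card
    have h2 := prod_multiset_X_sub_C_of_monic_of_roots_card_eq hm (by
      rw [h, FiniteField.X_pow_card_sub_X_natDegree_eq _ Fintype.one_lt_card]; rfl)
    rw [← h2, h]; rfl
  have h2 := congrArg (aeval y) h1
  rw [map_sub, map_pow, aeval_X, hy, sub_self, map_prod] at h2
  obtain ⟨x, -, hx⟩ := Finset.prod_eq_zero_iff.1 h2.symm
  exact ⟨x, by rw [map_sub, aeval_X, aeval_C, sub_eq_zero] at hx; exact hx.symm⟩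

lemma exists_frob (K k : Type) [Field K] [Fintype K] [Field k] [Algebra K k] :
    ∃ φ : k →ₐ[K] k, ∀ x, φ x = x ^ Fintype.card K := by
  exact ⟨FiniteField.frobeniusAlgHom K k, fun x => rfl⟩

lemma irreducible_iff_cycle {e : ℕ} (he : 2 ≤ e) (h : K[X]) (hm : h.Monic)
    (v : Fin e → k) (hv : Function.Injective v) (hh : h.map (algebraMap K k) = ∏ j, (X - C (v j)))
    (σ : Equiv.Perm (Fin e)) (hσ : ∀ j, v j ^ Fintype.card K = v (σ j)) :
    Irreducible h ↔ σ.cycleType = {e} := by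
  classical
  rw [cycleType_iff he]
  obtain ⟨φ, hφ⟩ := exists_frob K k
  have hdeg : h.natDegree = e := by
    rw [← natDegree_map (algebraMap K k), hh, natDegree_prod_of_monic _ _ fun j _ => monic_X_sub_C _]
    simp
  have hroot : ∀ j, aeval (v j) h = 0 := by
    intro j
    rw [aeval_def, ← eval_map, hh, eval_prod]
    exact Finset.prod_eq_zero (Finset.mem_univ j) (by simp)
  have hroot' : ∀ y, aeval y h = 0 → ∃ j, v j = y := by
    intro y hy
    rw [aeval_def, ← eval_map, hh, eval_prod] at hy
    obtain ⟨j, -, hj⟩ := Finset.prod_eq_zero_iff.1 hy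
    exact ⟨j, by simpa [sub_eq_zero, eq_comm] using hj⟩
  constructor
  · intro hirr x
    set O := Finset.univ.filter fun y => σ.SameCycle x y with hO
    set u : k[X] := ∏ j ∈ O, (X - C (v j)) with hu
    have hum : u.Monic := monic_prod_of_monic _ _ fun j _ => monic_X_sub_C _
    have hfix : u.map (φ : k →+* k) = u := by
      rw [hu, Polynomial.map_prod]
      refine Finset.prod_equiv σ ?_ ?_
      · intro j; simp [hO]
      · intro j _
        simp [hφ, hσ]
    have hlift : u ∈ lifts (algebraMap K k) := by
      rw [lifts_iff_coeff_lifts]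
      intro n
      have := congrArg (fun P => P.coeff n) hfix
      simp only [coeff_map] at this
      exact frob_fixed (K := K) _ (by rw [← hφ]; exact this)
    obtain ⟨w, hw⟩ := (mem_lifts _).1 hlift
    have hdvd : w ∣ h := by
      rw [← map_dvd_map' (algebraMap K k), hw, hh, hu]
      exact Finset.prod_dvd_prod_of_subset _ _ _ (Finset.subset_univ _)
    have hwd : w.natDegree = O.card := by
      rw [← natDegree_map (algebraMap K k), hw, hu, natDegree_prod_of_monic _ _ fun j _ => monic_X_sub_C _]
      simp
    have hxO : x ∈ O := by simp [hO, Equiv.Perm.SameCycle.refl]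
    rcases hirr.dvd_iff.1 hdvd with h1 | h1
    · have := natDegree_eq_zero_of_isUnit h1
      have := Finset.card_pos.2 ⟨x, hxO⟩
      omega
    · have h2 := natDegree_eq_of_degree_eq (degree_eq_degree_of_associated h1)
      have h3 : O = Finset.univ := Finset.eq_univ_of_card _ (by rw [Fintype.card_fin]; omega)
      intro y
      have : y ∈ O := by rw [h3]; simp
      simpa [hO] using this
  · intro hc
    rw [hm.irreducible_iff_natDegree']
    refine ⟨fun h1 => by rw [h1, natDegree_one] at hdeg; omega, ?_⟩
    intro u w hu hw huw hcon
    rw [Finset.mem_Ioc] at hcon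
    have key : ∀ P : K[X], P.Monic → (∀ j, aeval (v j) P = 0) → e ≤ P.natDegree := by
      intro P hP h0
      rw [← natDegree_map (algebraMap K k)]
      have h1 : (Finset.univ.image v).val ⊆ (P.map (algebraMap K k)).roots := by
        intro y hy
        obtain ⟨j, -, rfl⟩ := Finset.mem_image.1 (Finset.mem_def.2 hy)
        rw [mem_roots (hP.map _).ne_zero, IsRoot.def, eval_map_algebraMap]
        exact h0 j
      have h2 := card_le_degree_of_subset_roots h1
      rwa [Finset.card_image_of_injective _ hv, Finset.card_univ, Fintype.card_fin] at h2
    have hdd : u.natDegree + w.natDegree = e := by rw [← hu.natDegree_mul hw, huw, hdeg]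
    have hcl : ∀ j, aeval (v j) w = 0 → aeval (v (σ j)) w = 0 := by
      intro j hj
      rw [← hσ, ← hφ, aeval_algHom_apply, hj, map_zero]
    have hcl' : ∀ (n : ℕ) j, aeval (v j) w = 0 → aeval (v ((σ ^ n) j)) w = 0 := by
      intro n
      induction n with
      | zero => intro j hj; simpa using hj
      | succ n ih => intro j hj; rw [pow_succ']; exact hcl _ (ih j hj)
    by_cases hex : ∃ j, aeval (v j) w = 0
    · obtain ⟨j, hj⟩ := hex
      have := key w hw fun l => by
        obtain ⟨n, rfl⟩ := (hc j l).exists_nat_pow_eq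
        exact hcl' n j hj
      omega
    · push Not at hex
      have := key u hu fun l => by
        have := hroot l
        rw [← huw, map_mul] at this
        exact (mul_eq_zero.1 this).resolve_right (hex l)
      omega
end

end LineIrr

end

section
open Polynomial
open Polynomial

namespace LineIrr

lemma evi_deg {k : Type*} [Field k] (P : k[X]) (N : ℕ) (ρ : PowerSeries k)
    (h : zz k ^ N * evi k P = HahnSeries.ofPowerSeries ℤ k ρ) : P.natDegree ≤ N := by
  by_contra hne
  have h2 := evi_reflect P.natDegree P le_rfl
  obtain ⟨e, he⟩ : ∃ e, P.natDegree = N + (e + 1) := ⟨P.natDegree - N - 1, by omega⟩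
  have h3 : (PowerSeries.X : PowerSeries k) ^ (e+1) * ρ =
      ((reflect P.natDegree P : k[X]) : PowerSeries k) := by
    apply HahnSeries.ofPowerSeries_injective (Γ := ℤ)
    rw [← h2, map_mul, map_pow, ← h, he, pow_add (zz k)]; ring
  have h4 := congrArg (PowerSeries.constantCoeff) h3
  rw [pow_succ, map_mul, map_mul, PowerSeries.constantCoeff_X, mul_zero, zero_mul] at h4
  have h5 : P.coeff P.natDegree = 0 := by
    have : (reflect P.natDegree P).coeff 0 = 0 := by
      rw [← Polynomial.constantCoeff_coe] at *
      exact h4.symm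
    rwa [coeff_reflect, revAt_le (Nat.zero_le _), Nat.sub_zero] at this
  have : P = 0 := leadingCoeff_eq_zero.1 h5
  rw [this, natDegree_zero] at hne
  omega

namespace Fam
variable {k : Type} [Field k] {r : ℕ} {d : Fin r → ℕ} (F : Fam k r d) [IsAlgClosed k]

lemma Δ_ne : F.Δ ≠ 0 := by
  rw [Δ, Finset.prod_ne_zero_iff]
  intro x _
  rw [γ, Finset.prod_ne_zero_iff]
  intro j hj h
  rw [sub_eq_zero] at h
  exact (Finset.ne_of_mem_erase hj) (F.t_inj (congrArg Subtype.val h)).symm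

lemma Δ_mem : F.Δ ∈ F.V ^ (cc d) := by
  have h1 : (F.Δ : F.L) ∈ F.VL ^ (cc d) := by
    rw [Δ_coe]; exact F.prod_VL _ _ _ fun x _ => F.γ_mem x
  rw [VL_pow] at h1
  obtain ⟨z, hz, e⟩ := h1
  have : z = F.Δ := Subtype.ext e
  rwa [← this]

lemma exists_bad : ∃ P : k[X], P ≠ 0 ∧ P.natDegree ≤ Nat.card F.G * cc d ∧
    ∀ ψ : F.R →ₐ[k] k, ψ F.Δ = 0 → P.eval (ψ F.aR) = 0 := by
  choose ρ' hρ' using fun τ : F.G => F.low_X (cc d) _ (F.act_Vpow τ F.Δ_mem)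
  obtain ⟨P, hP⟩ := F.fixed_mem (∏ τ : F.G, (F.act τ F.Δ : F.L))
    (IsIntegral.prod _ fun τ _ => F.R_int _ (F.act τ F.Δ).2) (by
      intro τ
      rw [map_prod]
      refine Fintype.prod_equiv (Equiv.mulLeft τ) _ _ fun σ => ?_
      rfl)
  refine ⟨P, ?_, ?_, ?_⟩
  · rintro rfl
    rw [map_zero] at hP
    refine absurd hP.symm (Finset.prod_ne_zero_iff.2 fun τ _ => ?_)
    rw [act_coe]
    have hy0 : (F.Δ : F.L) ≠ 0 := fun h => F.Δ_ne (Subtype.ext h)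
    simpa using hy0
  · have h1 := F.κ_alg P
    rw [hP, map_prod] at h1
    refine evi_deg P _ (∏ τ : F.G, ρ' τ) ?_
    rw [← h1, map_prod, mul_comm, pow_mul, Nat.card_eq_fintype_card, ← Finset.card_univ]
    simp only [hρ']
    rw [Finset.prod_mul_distrib, Finset.prod_const, ← pow_mul, ← pow_mul]
    ring
  · intro ψ hψ
    rw [← ψ_aMap]
    have e : F.aMap P = ∏ τ : F.G, F.act τ F.Δ := by
      apply Subtype.ext
      rw [aMap_coe, hP]
      exact (map_prod F.R.val (fun τ : F.G => F.act τ F.Δ) Finset.univ).symm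
    rw [e, map_prod]
    exact Finset.prod_eq_zero (Finset.mem_univ 1) (by rw [act_one, hψ])

lemma ψ_inj (ψ : F.R →ₐ[k] k) (hψ : ψ F.Δ ≠ 0) (i) : Function.Injective fun j => ψ (F.tR ⟨i, j⟩) := by
  intro j j' h
  by_contra hne
  apply hψ
  rw [Δ, map_prod]
  refine Finset.prod_eq_zero (Finset.mem_univ ⟨i, j⟩) ?_
  rw [γ, map_prod]
  refine Finset.prod_eq_zero (Finset.mem_erase.2 ⟨Ne.symm hne, Finset.mem_univ _⟩) ?_
  rw [map_sub]; exact sub_eq_zero.2 h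

variable {K : Type} [Field K] [Fintype K] [Algebra K k] 

lemma g_map_eval (g : Fin r → K[X][X]) (hg : ∀ i, F.g i = (g i).map (mapRingHom (algebraMap K k))) (i) (a0 : K) :
    (F.g i).map (evalRingHom (algebraMap K k a0)) = ((g i).map (evalRingHom a0)).map (algebraMap K k) := by
  rw [hg, Polynomial.map_map, Polynomial.map_map]
  congr 1
  ext <;> simp

lemma exists_τ (g : Fin r → K[X][X]) (hg : ∀ i, F.g i = (g i).map (mapRingHom (algebraMap K k)))
    (ψ : F.R →ₐ[k] k) (a0 : K) (ha : ψ F.aR = algebraMap K k a0) (hψ : ψ F.Δ ≠ 0) :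
    ∃ τ : F.G, ∀ x, ψ (F.tR x) ^ Fintype.card K = ψ (F.act τ (F.tR x)) := by
  obtain ⟨φ, hφ⟩ := exists_frob K k
  have hsp : ∀ i, ((g i).map (evalRingHom a0)).map (algebraMap K k) = ∏ j, (X - C (ψ (F.tR ⟨i, j⟩))) := by
    intro i
    rw [← g_map_eval F g hg, ← ha, F.ψ_split ψ i]
  have h : ∀ i j, ∃ l, ψ (F.tR ⟨i, j⟩) ^ Fintype.card K = ψ (F.tR ⟨i, l⟩) := by
    intro i j
    have h1 : aeval (ψ (F.tR ⟨i, j⟩)) ((g i).map (evalRingHom a0)) = 0 := by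
      rw [aeval_def, ← eval_map, hsp, eval_prod]
      exact Finset.prod_eq_zero (Finset.mem_univ j) (by simp)
    have h2 := congrArg φ h1
    rw [map_zero, ← aeval_algHom_apply, aeval_def, ← eval_map, hsp, eval_prod] at h2
    obtain ⟨l, -, hl⟩ := Finset.prod_eq_zero_iff.1 h2
    exact ⟨l, by rw [← hφ]; simpa [sub_eq_zero] using hl⟩
  choose σ hσ using h
  have hinj : ∀ i, Function.Injective (σ i) := by
    intro i j j' hjj
    apply F.ψ_inj ψ hψ i
    apply φ.toRingHom.injective
    show φ _ = φ _
    rw [hφ, hφ, hσ, hσ, hjj]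
  obtain ⟨τ, hτ⟩ := F.perm_surj fun i => Equiv.ofBijective (σ i) (Finite.injective_iff_bijective.1 (hinj i))
  refine ⟨τ, fun x => ?_⟩
  obtain ⟨i, j⟩ := x
  rw [act_t, hτ, hσ]; rfl

/-- The abstract Stepanov bound applied to a Frobenius class. -/
lemma bound_of_step (C q0 : ℕ) (hC : ∀ p α q : ℕ, p.Prime → q = p^α → q0 < q →
      ∀ (k R : Type) [Field k] [IsAlgClosed k] [CharP k p] [CommRing R] [IsDomain R] [Algebra k R]
      (S : StepData k R (Nat.card F.G) (cc d)) (Ω : Type) [Fintype Ω] (pt : Ω → (R →ₐ[k] k)),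
      Function.Injective pt → (∀ w, pt w (S.D S.a) ≠ 0) → ∀ s : Fin (Nat.card F.G) × ℕ → R,
      (∀ x, s x ∈ S.V^(Nat.card F.G + x.2)) → (∀ w x, (pt w (S.b x.1 * S.a^x.2))^q = pt w (s x)) →
      (Fintype.card Ω:ℝ) ≤ q + C*√q) (hq : q0 < Fintype.card K)
    (σ : F.G) (Ω : Type) [Fintype Ω] (pt : Ω → (F.R →ₐ[k] k)) (hpt : Function.Injective pt)
    (h1 : ∀ w, pt w F.Δ ≠ 0) (h2 : ∀ w, ∃ a0 : K, pt w F.aR = algebraMap K k a0)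
    (h3 : ∀ w x, pt w (F.tR x) ^ Fintype.card K = pt w (F.act σ (F.tR x))) :
    (Fintype.card Ω : ℝ) ≤ Fintype.card K + C * √(Fintype.card K : ℝ) := by
  obtain ⟨p, hp⟩ := CharP.exists K
  obtain ⟨n, hpr, hn⟩ := FiniteField.card K p
  haveI : CharP k p := charP_of_injective_algebraMap (algebraMap K k).injective p
  refine hC p n _ hpr hn hq k F.R F.step Ω pt hpt ?_
    (fun x => F.act σ (F.step.b x.1 * F.step.a ^ x.2)) ?_ ?_
  · intro w
    show pt w (F.DR F.aR) ≠ 0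
    rw [DR_a]; exact h1 w
  · intro x
    exact F.act_Vpow σ (F.step.h_mem x)
  · intro w x
    rw [map_mul, mul_pow, map_mul, map_mul]
    congr 1
    · have : ∀ b ∈ Submonoid.closure (Set.range F.tR), pt w b ^ Fintype.card K = pt w (F.act σ b) := by
        intro b hb
        induction hb using Submonoid.closure_induction with
        | mem x hx => obtain ⟨x, rfl⟩ := hx; exact h3 w x
        | one => simp
        | mul x y _ _ h1 h2 => rw [map_mul, mul_pow, h1, h2, map_mul, map_mul]
      exact this _ (F.step_b _)
    · obtain ⟨a0, ha⟩ := h2 w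
      show pt w (F.aR ^ x.2) ^ _ = pt w (F.act σ (F.aR ^ x.2))
      rw [map_pow (F.act σ), act_a, map_pow, ha, ← map_pow, ← map_pow, FiniteField.pow_card]

end Fam
end LineIrr

end

section
open Polynomial
open Polynomial

namespace LineIrr
namespace Fam
variable {k : Type} [Field k] {r : ℕ} {d : Fin r → ℕ} (F : Fam k r d) [IsAlgClosed k]
variable {K : Type} [Field K] [Fintype K] [Algebra K k] 

lemma conj_aux {G : Type*} [Group G] {x t σ : G} (h : x⁻¹ * t * x = σ) : t * x = x * σ := by
  rw [← h]; group

lemma num_aux {N N' N'' n s s' D q u bad c C : ℕ} {sq : ℝ} (hn : 0 < n) (hD : 0 < D) (hs1 : 1 ≤ sq)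
    (c1 : (N' : ℝ) * n ≤ s * (q + C * sq)) (c2 : (N'' : ℝ) * n ≤ s' * (q + C * sq))
    (c3 : s * D = n) (c4 : s + s' = n) (c5 : N' + N'' = u) (c6 : bad + u = q) (hbad : bad ≤ n * c)
    (c7 : N' ≤ N) (c8 : N ≤ N' + bad) : |(N : ℝ) - q / D| ≤ (C + n * c) * sq := by
  have hs : 0 < s := by
    rcases Nat.eq_zero_or_pos s with h | h
    · subst h; omega
    · exact h
  have hD' : (1 : ℝ) ≤ D := by exact_mod_cast hD
  have hs' : (0 : ℝ) < s := by exact_mod_cast hs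
  have hn' : (0 : ℝ) < n := by exact_mod_cast hn
  have C0 : (0 : ℝ) ≤ C := by positivity
  have q0 : (0 : ℝ) ≤ q := by positivity
  have e3 : (n : ℝ) = s * D := by exact_mod_cast c3.symm
  have e4 : (s : ℝ) + s' = n := by exact_mod_cast c4
  have e5 : (N' : ℝ) + N'' = u := by exact_mod_cast c5
  have e6 : (bad : ℝ) + u = q := by exact_mod_cast c6
  have e7 : (N' : ℝ) ≤ N := by exact_mod_cast c7
  have e8 : (N : ℝ) ≤ N' + bad := by exact_mod_cast c8
  have eb : (bad : ℝ) ≤ n * c := by exact_mod_cast hbad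
  have eb' : (bad : ℝ) ≤ n * c * sq := eb.trans (le_mul_of_one_le_right (by positivity) hs1)
  have hX : q / D ≤ (q + C * sq) / D := by gcongr; linarith [mul_nonneg C0 (zero_le_one.trans hs1)]
  have hX2 : (q + C * sq) / D ≤ q / D + C * sq := by
    rw [add_div]; gcongr; exact div_le_self (mul_nonneg C0 (zero_le_one.trans hs1)) hD'
  have h1 : (N' : ℝ) ≤ (q + C * sq) / D := by
    rw [le_div_iff₀ (by linarith)]
    rw [e3] at c1
    refine le_of_mul_le_mul_left ?_ hs'
    linarith
  have h2 : (N'' : ℝ) ≤ (q + C * sq) - (q + C * sq) / D := by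
    have : (s' : ℝ) = s * (D - 1) := by linarith
    rw [this, e3] at c2
    have h : (N'' : ℝ) * D ≤ (D - 1) * (q + C * sq) := by
      refine le_of_mul_le_mul_left ?_ hs'
      linarith
    have h' : (q + C * sq) - (q + C * sq) / D = (D - 1) * (q + C * sq) / D := by
      field_simp
    rw [h', le_div_iff₀ (by linarith)]; exact h
  rw [abs_le]
  constructor <;> linarith

def good (σ : F.G) : Prop := ∀ i, (F.perm σ i).cycleType = {d i}

open Classical in
lemma card_good (hd : ∀ i, 2 ≤ d i) :
    (Finset.univ.filter F.good).card * ∏ i, d i = Nat.card F.G := by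
  have h1 : (Finset.univ.filter F.good).card =
      (Fintype.piFinset fun i => Finset.univ.filter fun σ : Equiv.Perm (Fin (d i)) => σ.cycleType = {d i}).card := by
    refine Finset.card_bij (fun σ _ => F.perm σ) ?_ ?_ ?_
    · intro σ hσ
      simpa [good] using hσ
    · intro a _ b _ h; exact F.perm_inj h
    · intro b hb
      obtain ⟨τ, rfl⟩ := F.perm_surj b
      exact ⟨τ, by simpa [good] using hb, rfl⟩
  rw [h1, Fintype.card_piFinset, ← Finset.prod_mul_distrib, card_G]
  exact Finset.prod_congr rfl fun i _ => card_full (hd i)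

lemma good_conj (σ τ : F.G) : F.good (σ⁻¹ * τ * σ) ↔ F.good τ := by
  refine forall_congr' fun i => ?_
  rw [map_mul, map_mul, map_inv]
  have := Equiv.Perm.cycleType_conj (σ := F.perm τ i) (τ := (F.perm σ i)⁻¹)
  rw [inv_inv] at this
  rw [← this]; rfl

open Classical in
theorem count (hd : ∀ i, 2 ≤ d i) (C q0 : ℕ) (hC : ∀ p α q : ℕ, p.Prime → q = p^α → q0 < q →
      ∀ (k R : Type) [Field k] [IsAlgClosed k] [CharP k p] [CommRing R] [IsDomain R] [Algebra k R]
      (S : StepData k R (Nat.card F.G) (cc d)) (Ω : Type) [Fintype Ω] (pt : Ω → (R →ₐ[k] k)),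
      Function.Injective pt → (∀ w, pt w (S.D S.a) ≠ 0) → ∀ s : Fin (Nat.card F.G) × ℕ → R,
      (∀ x, s x ∈ S.V^(Nat.card F.G + x.2)) → (∀ w x, (pt w (S.b x.1 * S.a^x.2))^q = pt w (s x)) →
      (Fintype.card Ω:ℝ) ≤ q + C*√q) (hq : q0 < Fintype.card K)
    (g : Fin r → K[X][X]) (hg : ∀ i, F.g i = (g i).map (mapRingHom (algebraMap K k))) :
    |((Finset.univ.filter fun a0 : K => ∀ i, Irreducible ((g i).map (evalRingHom a0))).card : ℝ) -
      (Fintype.card K : ℝ) / (∏ i, d i : ℕ)| ≤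
      (C + Nat.card F.G * cc d) * √(Fintype.card K : ℝ) := by
  choose ψ hψ using fun a0 : K => F.exists_pt (algebraMap K k a0)
  set U : Finset K := Finset.univ.filter fun a0 => ψ a0 F.Δ ≠ 0 with hU
  have hτ : ∀ a0 : K, ∃ τ : F.G, a0 ∈ U → ∀ x, ψ a0 (F.tR x) ^ Fintype.card K = ψ a0 (F.act τ (F.tR x)) := by
    intro a0
    by_cases h : a0 ∈ U
    · obtain ⟨τ, hτ⟩ := F.exists_τ g hg (ψ a0) a0 (hψ a0) (by simpa [hU] using h)
      exact ⟨τ, fun _ => hτ⟩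
    · exact ⟨1, fun h' => absurd h' h⟩
  choose τ hτ using hτ
  have hbad : (Finset.univ \ U).card ≤ Nat.card F.G * cc d := by
    obtain ⟨P, hP0, hPd, hP⟩ := F.exists_bad
    refine le_trans ?_ hPd
    rw [← Finset.card_image_of_injective _ (algebraMap K k).injective]
    apply card_le_degree_of_subset_roots
    intro y hy
    obtain ⟨a0, ha, rfl⟩ := Finset.mem_image.1 (Finset.mem_def.2 hy)
    rw [mem_roots hP0, IsRoot.def, ← hψ]
    apply hP
    simpa [hU] using ha
  have hΩ : ∀ σ : F.G, (((U ×ˢ Finset.univ).filter fun x : K × F.G => x.2⁻¹ * τ x.1 * x.2 = σ).card : ℝ)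
      ≤ Fintype.card K + C * √(Fintype.card K : ℝ) := by
    intro σ
    rw [← Fintype.card_coe]
    have hmem : ∀ w : ((U ×ˢ Finset.univ).filter fun x : K × F.G => x.2⁻¹ * τ x.1 * x.2 = σ),
        w.1.1 ∈ U ∧ w.1.2⁻¹ * τ w.1.1 * w.1.2 = σ := by
      intro w; have := Finset.mem_filter.1 w.2; exact ⟨(Finset.mem_product.1 this.1).1, this.2⟩
    have hane : ∀ w : ((U ×ˢ Finset.univ).filter fun x : K × F.G => x.2⁻¹ * τ x.1 * x.2 = σ),
        ((ψ w.1.1).comp (F.act w.1.2)) F.aR = algebraMap K k w.1.1 := by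
      intro w; rw [AlgHom.comp_apply, act_a, hψ]
    refine F.bound_of_step C q0 hC hq σ _ (fun w => (ψ w.1.1).comp (F.act w.1.2)) ?_ ?_ ?_ ?_
    · intro w w' h
      have e1 : w.1.1 = w'.1.1 := by
        apply (algebraMap K k).injective
        rw [← hane, ← hane]
        exact DFunLike.congr_fun h F.aR
      have hu : ψ w'.1.1 F.Δ ≠ 0 := by simpa [hU] using (hmem w').1
      have e2 : w.1.2 = w'.1.2 := by
        apply F.perm_inj
        funext i; ext1 j
        apply F.ψ_inj (ψ w'.1.1) hu i
        have := DFunLike.congr_fun h (F.tR ⟨i, j⟩)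
        simp only [AlgHom.comp_apply, act_t, e1] at this
        exact this
      exact Subtype.ext (Prod.ext e1 e2)
    · intro w
      have hu : ψ w.1.1 F.Δ ≠ 0 := by simpa [hU] using (hmem w).1
      rw [AlgHom.comp_apply, Δ, map_prod, map_prod, Finset.prod_ne_zero_iff]
      intro x _
      rw [γ, map_prod, map_prod, Finset.prod_ne_zero_iff]
      intro j hj
      obtain ⟨i, l⟩ := x
      rw [map_sub, map_sub, act_t, act_t]
      intro h
      have := F.ψ_inj _ hu i (sub_eq_zero.1 h)
      exact (Finset.ne_of_mem_erase hj) ((F.perm w.1.2 i).injective this).symm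
    · intro w; exact ⟨_, hane w⟩
    · rintro w ⟨i, j⟩
      simp only [AlgHom.comp_apply]
      have e : τ w.1.1 * w.1.2 = w.1.2 * σ := conj_aux (hmem w).2
      rw [act_t, hτ _ (hmem w).1, ← act_t, ← act_mul, ← act_mul, e]
  have hirr : ∀ a0 ∈ U, (∀ i, Irreducible ((g i).map (evalRingHom a0))) ↔ F.good (τ a0) := by
    intro a0 ha
    have hu : ψ a0 F.Δ ≠ 0 := by simpa [hU] using ha
    refine forall_congr' fun i => ?_
    apply irreducible_iff_cycle (k := k) (hd i) _ _ _ (F.ψ_inj _ hu i)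
    · rw [← g_map_eval F g hg, ← hψ a0]; exact F.ψ_split _ i
    · intro j
      rw [hτ a0 ha, act_t]
    · have h1 : (((g i).map (evalRingHom a0)).map (algebraMap K k)).Monic := by
        rw [← g_map_eval F g hg]; exact (F.monic i).map _
      exact monic_of_injective (algebraMap K k).injective h1
  -- counting
  have hcnt : ∀ (T : F.G → Prop), (∀ σ τ, T (σ⁻¹ * τ * σ) ↔ T τ) →
      ((U.filter fun a0 => T (τ a0)).card : ℝ) * Nat.card F.G ≤
        (Finset.univ.filter T).card * (Fintype.card K + C * √(Fintype.card K : ℝ)) := by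
    intro T hT
    have h1 : (U.filter fun a0 => T (τ a0)).card * Nat.card F.G =
        ((U ×ˢ Finset.univ).filter fun x : K × F.G => T (x.2⁻¹ * τ x.1 * x.2)).card := by
      rw [Nat.card_eq_fintype_card, ← Finset.card_univ, ← Finset.card_product]
      congr 1
      ext x
      simp [hT]
    have h2 := Finset.card_eq_sum_card_fiberwise (f := fun x : K × F.G => x.2⁻¹ * τ x.1 * x.2)
      (s := (U ×ˢ Finset.univ).filter fun x : K × F.G => T (x.2⁻¹ * τ x.1 * x.2))
      (t := Finset.univ.filter T) (by
        intro x hx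
        have := (Finset.mem_filter.1 hx).2
        simpa using this)
    have h3 : ((U.filter fun a0 => T (τ a0)).card : ℝ) * Nat.card F.G = ∑ σ ∈ Finset.univ.filter T,
        ((((U ×ˢ Finset.univ).filter fun x : K × F.G => T (x.2⁻¹ * τ x.1 * x.2)).filter
          fun x : K × F.G => x.2⁻¹ * τ x.1 * x.2 = σ).card : ℝ) := by
      exact_mod_cast h1.trans h2
    rw [h3, ← nsmul_eq_mul]
    refine Finset.sum_le_card_nsmul _ _ _ fun σ _ => le_trans ?_ (hΩ σ)
    exact_mod_cast Finset.card_le_card (fun x hx => by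
      simp only [Finset.mem_filter] at hx ⊢
      exact ⟨hx.1.1, hx.2⟩)
  have c1 := hcnt F.good F.good_conj
  have c2 : ((U.filter fun a0 => ¬ F.good (τ a0)).card : ℝ) * Nat.card F.G ≤
        (Finset.univ.filter fun σ => ¬ F.good σ).card * (Fintype.card K + C * √(Fintype.card K : ℝ)) := by
    have := hcnt (fun σ => ¬ F.good σ) (fun σ τ => not_congr (F.good_conj σ τ))
    convert this
  have c3 := F.card_good hd
  have c4 : (Finset.univ.filter F.good).card + (Finset.univ.filter fun σ => ¬ F.good σ).card = Nat.card F.G := by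
    rw [Finset.card_filter_add_card_filter_not, Nat.card_eq_fintype_card, Finset.card_univ]
  have c5 : (U.filter fun a0 => F.good (τ a0)).card + (U.filter fun a0 => ¬ F.good (τ a0)).card = U.card :=
    Finset.card_filter_add_card_filter_not _
  have c6 : (Finset.univ \ U).card + U.card = Fintype.card K := by
    rw [Finset.card_sdiff_add_card_eq_card (Finset.subset_univ _), Finset.card_univ]
  set N := (Finset.univ.filter fun a0 : K => ∀ i, Irreducible ((g i).map (evalRingHom a0))).card with hN
  set N' := (U.filter fun a0 => F.good (τ a0)).card with hN'
  have c7 : N' ≤ N := Finset.card_le_card fun a0 ha => by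
    rw [Finset.mem_filter] at ha
    simp only [Finset.mem_filter, Finset.mem_univ, true_and]
    exact (hirr a0 ha.1).2 ha.2
  have c8 : N ≤ N' + (Finset.univ \ U).card := by
    rw [hN, hN']
    refine le_trans (Finset.card_le_card fun a0 ha => ?_) (Finset.card_union_le _ _)
    by_cases h : a0 ∈ U
    · refine Finset.mem_union_left _ (Finset.mem_filter.2 ⟨h, (hirr a0 h).1 ?_⟩)
      simpa using ha
    · exact Finset.mem_union_right _ (by simp [h])
  have hn : 0 < Nat.card F.G := Nat.card_pos
  have hD : 0 < ∏ i, d i := Finset.prod_pos fun i _ => by have := hd i; omega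
  have hs1 : 1 ≤ √(Fintype.card K : ℝ) := by
    rw [Real.one_le_sqrt]; exact_mod_cast Fintype.card_pos
  exact num_aux hn hD hs1 c1 c2 c3 c4 c5 c6 hbad c7 c8

end Fam
end LineIrr

end

section
open Polynomial
open Polynomial

namespace LineIrr

open Fam
open Classical in
theorem fam_count (m : ℕ) : ∃ C : ℝ, 0 ≤ C ∧ ∀ (K k : Type) [Field K] [Fintype K] [Field k]
    [IsAlgClosed k] [Algebra K k] (r : ℕ) (d : Fin r → ℕ) (F : Fam k r d)
    (g : Fin r → K[X][X]) (_hg : ∀ i, F.g i = (g i).map (mapRingHom (algebraMap K k)))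
    (_hd : ∀ i, 2 ≤ d i) (_hm : ∑ i, d i ≤ m),
    |((Finset.univ.filter fun a0 : K => ∀ i, Irreducible ((g i).map (evalRingHom a0))).card : ℝ) -
      (Fintype.card K : ℝ) / (∏ i, d i : ℕ)| ≤ C * √(Fintype.card K : ℝ) := by
  choose C q0 h using stepanov
  set I := Finset.range (m.factorial + 1) ×ˢ Finset.range (m^2 + 1) with hI
  refine ⟨(∑ x ∈ I, (C x.1 x.2 + q0 x.1 x.2 + x.1 * x.2 : ℕ) : ℕ), by positivity, ?_⟩
  intro K k _ _ _ _ _ r d F g hg hd hm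
  have hn : Nat.card F.G ≤ m.factorial := by
    rw [Fam.card_G]
    refine le_trans (Nat.le_of_dvd (Nat.factorial_pos _) (Nat.prod_factorial_dvd_factorial_sum _ _)) (Nat.factorial_le hm)
  have hc : cc d ≤ m^2 := by
    unfold cc
    rw [Fintype.sum_sigma]
    simp only [Finset.sum_const, Finset.card_univ, Fintype.card_fin, smul_eq_mul]
    calc ∑ i, d i * d i ≤ ∑ i, d i * m := Finset.sum_le_sum fun i _ =>
          Nat.mul_le_mul_left _ (le_trans (Finset.single_le_sum (f := d) (fun _ _ => Nat.zero_le _) (Finset.mem_univ i)) hm)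
      _ = (∑ i, d i) * m := by rw [Finset.sum_mul]
      _ ≤ m * m := Nat.mul_le_mul_right _ hm
      _ = m^2 := by ring
  have hmem : (Nat.card F.G, cc d) ∈ I := by
    simp only [hI, Finset.mem_product, Finset.mem_range]; omega
  have hle := Finset.single_le_sum (f := fun x : ℕ × ℕ => (C x.1 x.2 + q0 x.1 x.2 + x.1 * x.2 : ℕ))
    (fun _ _ => Nat.zero_le _) hmem
  have hle' : (C (Nat.card F.G) (cc d) : ℝ) + q0 (Nat.card F.G) (cc d) + Nat.card F.G * cc d ≤
      (∑ x ∈ I, (C x.1 x.2 + q0 x.1 x.2 + x.1 * x.2 : ℕ) : ℕ) := by exact_mod_cast hle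
  have hs1 : 1 ≤ √(Fintype.card K : ℝ) := by
    rw [Real.one_le_sqrt]; exact_mod_cast Fintype.card_pos
  by_cases hq : q0 (Nat.card F.G) (cc d) < Fintype.card K
  · refine (F.count hd _ _ (h _ _) hq g hg).trans ?_
    gcongr
    have : (0 : ℝ) ≤ q0 (Nat.card F.G) (cc d) := by positivity
    linarith
  · have hD : (1 : ℝ) ≤ (∏ i, d i : ℕ) := by
      exact_mod_cast Nat.succ_le_of_lt (Finset.prod_pos (s := Finset.univ) (f := d) fun i _ => by have := hd i; omega)
    have h1 : (Fintype.card K : ℝ) / (∏ i, d i : ℕ) ≤ Fintype.card K := div_le_self (by positivity) hD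
    have h0 : 0 ≤ (Fintype.card K : ℝ) / (∏ i, d i : ℕ) := by positivity
    have h2 : ((Finset.univ.filter fun a0 : K => ∀ i, Irreducible ((g i).map (evalRingHom a0))).card : ℝ)
        ≤ Fintype.card K := by exact_mod_cast Finset.card_le_univ _
    have h3 : (Fintype.card K : ℝ) ≤ q0 (Nat.card F.G) (cc d) := by exact_mod_cast not_lt.1 hq
    have h4 : (0 : ℝ) ≤ C (Nat.card F.G) (cc d) + Nat.card F.G * cc d := by positivity
    have h5 : (0:ℝ) ≤ ((Finset.univ.filter fun a0 : K => ∀ i, Irreducible ((g i).map (evalRingHom a0))).card : ℝ) := by positivity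
    calc _ ≤ (Fintype.card K : ℝ) := by rw [abs_le]; constructor <;> linarith
      _ ≤ (∑ x ∈ I, (C x.1 x.2 + q0 x.1 x.2 + x.1 * x.2 : ℕ) : ℕ) := by linarith
      _ ≤ _ := le_mul_of_one_le_right (by positivity) hs1

end LineIrr

end

section
open Polynomial
open Polynomial

namespace LineIrr

lemma deriv_aeval {k : Type*} [CommRing k] {B M : Type*} [CommRing B] [Algebra k B] [AddCommGroup M]
    [Module k M] [Module B M] [IsScalarTower k B M] {n : ℕ} (D : Derivation k B M) (v : Fin n → B)
    (p : MvPolynomial (Fin n) k) :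
    D (MvPolynomial.aeval v p) = ∑ i, MvPolynomial.aeval v (MvPolynomial.pderiv i p) • D (v i) := by
  induction p using MvPolynomial.induction_on with
  | C a => simp [MvPolynomial.algebraMap_eq]
  | add p q hp hq => simp only [map_add, hp, hq, add_smul, Finset.sum_add_distrib]
  | mul_X p j hp =>
    simp only [map_mul, Derivation.leibniz, hp, MvPolynomial.aeval_X, MvPolynomial.pderiv_X, map_add, smul_eq_mul]
    simp only [add_smul, Finset.sum_add_distrib, Finset.smul_sum, mul_smul]
    congr 1
    rw [Finset.sum_eq_single j]
    · simp
    · intro i _ hi; simp [Pi.single_apply, hi]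
    · simp

/-- weak Nullstellensatz: common zeros in some extension give zeros over `k`. -/
lemma nullst {k : Type} [Field k] [IsAlgClosed k] {n : ℕ} {E : Type*} [CommRing E] [Nontrivial E] [Algebra k E]
    (φ : MvPolynomial (Fin n) k →ₐ[k] E) : ∃ P : Fin n → k, ∀ h, φ h = 0 → MvPolynomial.aeval P h = 0 := by
  have h1 : RingHom.ker φ ≠ ⊤ := RingHom.ker_ne_top _
  obtain ⟨M, hM, hle⟩ := Ideal.exists_le_maximal _ h1
  obtain ⟨P, hP⟩ := (MvPolynomial.isMaximal_iff_eq_vanishingIdeal_singleton (K := k)).1 hM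
  refine ⟨P, fun h hh => ?_⟩
  have : h ∈ M := hle hh
  rw [hP] at this
  exact (MvPolynomial.mem_vanishingIdeal_singleton_iff _ _).1 this

/-- a prime strictly above a principal prime is a point -/
lemma point_of_two {k : Type} [Field k] [IsAlgClosed k] {E : Type*} [CommRing E] [IsDomain E] [Algebra k E]
    (f b : MvPolynomial (Fin 2) k) (hf : Irreducible f) (φ : MvPolynomial (Fin 2) k →ₐ[k] E) (h0 : φ f = 0)
    (hb : φ b = 0) (hfb : ¬ f ∣ b) : ∃ P : Fin 2 → k, ∀ h, φ h = algebraMap k E (MvPolynomial.aeval P h) := by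
  have hfp : Prime f := hf.prime
  have hP1 : (Ideal.span {f}).IsPrime := (Ideal.span_singleton_prime hf.ne_zero).2 hfp
  have hP2 : (RingHom.ker φ).IsPrime := RingHom.ker_isPrime _
  have hmax : (RingHom.ker φ).IsMaximal := by
    by_contra hmax
    obtain ⟨M, hM, hle⟩ := Ideal.exists_le_maximal _ hP2.ne_top
    let p0 : PrimeSpectrum (MvPolynomial (Fin 2) k) := ⟨⊥, Ideal.isPrime_bot⟩
    let p1 : PrimeSpectrum (MvPolynomial (Fin 2) k) := ⟨_, hP1⟩
    let p2 : PrimeSpectrum (MvPolynomial (Fin 2) k) := ⟨_, hP2⟩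
    let p3 : PrimeSpectrum (MvPolynomial (Fin 2) k) := ⟨M, hM.isPrime⟩
    have l01 : p0 < p1 := by
      rw [← PrimeSpectrum.asIdeal_lt_asIdeal]
      exact bot_lt_iff_ne_bot.2 (by simpa [p1] using hf.ne_zero)
    have l12 : p1 < p2 := by
      rw [← PrimeSpectrum.asIdeal_lt_asIdeal]
      refine lt_of_le_of_ne ?_ ?_
      · simp only [p1, p2, Ideal.span_singleton_le_iff_mem]; exact h0
      · intro h
        apply hfb
        rw [← Ideal.mem_span_singleton]
        have : b ∈ p2.asIdeal := hb
        rwa [← h] at this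
    have l23 : p2 < p3 := by
      rw [← PrimeSpectrum.asIdeal_lt_asIdeal]
      refine lt_of_le_of_ne hle ?_
      intro h
      apply hmax
      have : RingHom.ker φ = M := h
      rw [this]; exact hM
    let S : LTSeries (PrimeSpectrum (MvPolynomial (Fin 2) k)) :=
      { length := 3
        toFun := ![p0, p1, p2, p3]
        step := by intro i; fin_cases i; exacts [l01, l12, l23] }
    have h3 := Order.LTSeries.length_le_krullDim S
    have hdim : ringKrullDim (MvPolynomial (Fin 2) k) = 2 := by
      rw [MvPolynomial.ringKrullDim_of_isNoetherianRing]; simp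
    have hl : S.length = 3 := rfl
    rw [hl] at h3
    change _ ≤ ringKrullDim _ at h3
    rw [hdim] at h3
    exact absurd h3 (by decide)
  obtain ⟨P, hP⟩ := (MvPolynomial.isMaximal_iff_eq_vanishingIdeal_singleton (K := k)).1 hmax
  refine ⟨P, fun h => ?_⟩
  have : h - MvPolynomial.C (MvPolynomial.aeval P h) ∈ RingHom.ker φ := by
    rw [hP, MvPolynomial.mem_vanishingIdeal_singleton_iff]
    simp
  have h2 : φ (h - MvPolynomial.C (MvPolynomial.aeval P h)) = 0 := this
  rw [map_sub, sub_eq_zero] at h2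
  rw [h2, ← MvPolynomial.algebraMap_eq, AlgHom.commutes]

end LineIrr

end

section
open Polynomial
open Polynomial

namespace LineIrr

lemma norm_eq_resultant {R : Type*} [CommRing R] [Nontrivial R] (f g : R[X]) (hf : f.Monic) (n : ℕ) (hg : g.natDegree ≤ n) :
    Algebra.norm R (AdjoinRoot.mk f g) = resultant f g f.natDegree n := by
  classical
  set m := f.natDegree with hm
  have hmf : f.natDegree ≤ m := le_rfl
  by_cases hf1 : f = 1
  · subst hf1
    have hm0 : m = 0 := by simp [hm]
    have : Subsingleton (AdjoinRoot (1 : R[X])) := by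
      refine ⟨fun a b => ?_⟩
      obtain ⟨a, rfl⟩ := AdjoinRoot.mk_surjective a
      obtain ⟨b, rfl⟩ := AdjoinRoot.mk_surjective b
      rw [AdjoinRoot.mk_eq_mk]; exact one_dvd _
    have h1 : AdjoinRoot.mk (1 : R[X]) g = 1 := Subsingleton.elim _ _
    rw [h1, map_one, hm0]; simp
  have hlt : ∀ p : R[X], p %ₘ f ∈ degreeLT R m := fun p => by
    rw [Polynomial.mem_degreeLT]
    exact (degree_modByMonic_lt _ hf).trans_eq (degree_eq_natDegree hf.ne_zero)
  have hdv : ∀ p ∈ degreeLT R m, (g * p) /ₘ f ∈ degreeLT R n := fun p hp => by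
    rw [Polynomial.mem_degreeLT] at hp ⊢
    by_cases h0 : (g * p) /ₘ f = 0
    · rw [h0]; simp
    by_cases hp0 : p = 0
    · simp [hp0] at h0
    rw [← natDegree_lt_iff_degree_lt h0, natDegree_divByMonic _ hf]
    rw [← natDegree_lt_iff_degree_lt hp0] at hp
    have := natDegree_mul_le (p := g) (q := p)
    by_cases hn : n = 0
    · exfalso
      apply h0
      rw [divByMonic_eq_zero_iff hf]
      rw [degree_eq_natDegree hf.ne_zero]
      refine (degree_le_natDegree).trans_lt ?_
      exact_mod_cast (by omega : (g * p).natDegree < f.natDegree)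
    · omega
  have hadd : ∀ p q : R[X], (p + q) /ₘ f = p /ₘ f + q /ₘ f := fun p q => by
    refine (div_modByMonic_unique (p /ₘ f + q /ₘ f) (p %ₘ f + q %ₘ f) hf ⟨?_, ?_⟩).1
    · conv_rhs => rw [← modByMonic_add_div p f, ← modByMonic_add_div q f]
      ring
    · exact (degree_add_le _ _).trans_lt (max_lt (degree_modByMonic_lt _ hf) (degree_modByMonic_lt _ hf))
  have hsm : ∀ (c : R) (p : R[X]), (c • p) /ₘ f = c • (p /ₘ f) := fun c p => by
    refine (div_modByMonic_unique (c • (p /ₘ f)) (c • (p %ₘ f)) hf ⟨?_, ?_⟩).1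
    · conv_rhs => rw [← modByMonic_add_div p f]
      rw [smul_add, mul_smul_comm]
    · exact (degree_smul_le _ _).trans_lt (degree_modByMonic_lt _ hf)
  let N : degreeLT R m →ₗ[R] degreeLT R m :=
    { toFun := fun p => ⟨(g * p) %ₘ f, hlt _⟩
      map_add' := fun p q => by ext1; simp [mul_add, add_modByMonic]
      map_smul' := fun c p => by ext1; simp [smul_modByMonic] }
  let S : degreeLT R m →ₗ[R] degreeLT R n :=
    { toFun := fun p => ⟨(g * p) /ₘ f, hdv _ p.2⟩
      map_add' := fun p q => by ext1; simp [mul_add, hadd]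
      map_smul' := fun c p => by ext1; simp [hsm] }
  let θ : (degreeLT R m × degreeLT R n) →ₗ[R] (degreeLT R m × degreeLT R n) :=
    (N ∘ₗ LinearMap.fst R _ _).prod (S ∘ₗ LinearMap.fst R _ _ + LinearMap.snd R _ _)
  have hcomp : sylvesterMap f g hmf hg = (sylvesterMap f 1 hmf (by simp)) ∘ₗ θ := by
    ext1 <;> ext1 x <;> ext1
    · simp [θ, N, S]
      have := modByMonic_add_div (g * x.1) f
      linear_combination -this
    · simp [θ, N, S]
  let b := ((degreeLT.basis R m).prod (degreeLT.basis R n))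
  let b' := b.reindex finSumFinEquiv
  have hM := congrArg (fun φ => LinearMap.det (1 : Module.End R R) * (LinearMap.toMatrix b' (degreeLT.basis R (m+n)) φ).det) hcomp
  simp only [map_one, one_mul] at hM
  rw [LinearMap.toMatrix_comp b' b' (degreeLT.basis R (m+n)), Matrix.det_mul, toMatrix_sylvesterMap', toMatrix_sylvesterMap'] at hM
  change resultant f g m n = resultant f 1 m n * _ at hM
  rw [resultant_one_right, show f.coeff m = 1 from hf, one_pow, one_mul] at hM
  rw [hM, LinearMap.det_toMatrix, ← LinearMap.det_toMatrix b]
  have hθ : LinearMap.toMatrix b b θ = Matrix.fromBlocks (LinearMap.toMatrix (degreeLT.basis R m) (degreeLT.basis R m) N) 0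
      (LinearMap.toMatrix (degreeLT.basis R m) (degreeLT.basis R n) S) 1 := by
    ext (i | i) (j | j)
    · simp [LinearMap.toMatrix_apply, b, θ]
    · simp [LinearMap.toMatrix_apply, b, θ]
    · simp [LinearMap.toMatrix_apply, b, θ]
    · simp [LinearMap.toMatrix_apply, b, θ, Matrix.one_apply, Finsupp.single_apply, eq_comm]
  rw [hθ, Matrix.det_fromBlocks_zero₁₂, Matrix.det_one, mul_one]
  rw [Algebra.norm_eq_matrix_det (AdjoinRoot.powerBasisAux' hf)]
  congr 1

end LineIrr

end

section
open Polynomial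
open Polynomial

namespace LineIrr

lemma natDegree_res {k : Type*} [Field k] [IsAlgClosed k] (G : k[X][X]) (d : ℕ) (hm : G.Monic) (hd : G.natDegree = d)
    (hlow : ∀ j, (G.coeff j).natDegree ≤ d - j) (hsep : (topP G d).Separable) :
    resultant G (derivative G) d (d-1) ≠ 0 ∧ (resultant G (derivative G) d (d-1)).natDegree = d * (d-1) := by
  classical
  obtain ⟨s, hs, hr⟩ := inf_split G d hm hd hlow hsep
  set P := resultant G (derivative G) d (d-1) with hP
  set τ : Fin d → LaurentSeries k := fun j => (zz k)⁻¹ * HahnSeries.ofPowerSeries ℤ k (s j) with hτ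
  have hinj : Function.Injective τ := by
    intro i j hij
    apply hs
    have := mul_left_cancel₀ (inv_ne_zero (zz_ne k)) hij
    simp only [HahnSeries.ofPowerSeries_injective this]
  have hmm : (G.map (evi k)).Monic := hm.map _
  have hprod : G.map (evi k) = ∏ j, (X - C (τ j)) := by
    refine eq_of_monic_of_dvd_of_natDegree_le (monic_prod_of_monic _ _ fun j _ => monic_X_sub_C _) hmm ?_ ?_
    · refine Finset.prod_dvd_of_coprime ?_ ?_
      · intro i _ j _ hij
        exact pairwise_coprime_X_sub_C hinj hij
      · intro j _
        exact dvd_iff_isRoot.2 (hr j)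
    · rw [natDegree_prod_of_monic _ _ fun j _ => monic_X_sub_C _]
      simp [hm.natDegree_map, hd]
  have hdd : (derivative (G.map (evi k))).natDegree ≤ d - 1 := by
    refine (natDegree_derivative_le _).trans ?_
    rw [hm.natDegree_map, hd]
  have h1 : evi k P = ∏ j, ∏ l ∈ Finset.univ.erase j, (τ j - τ l) := by
    rw [hP, ← resultant_map_map, ← derivative_map]
    have h2 := resultant_prod_left (Finset.univ : Finset (Fin d)) (fun j => X - C (τ j)) (derivative (G.map (evi k))) (d-1) (by simp) hdd
    rw [← hprod, hm.natDegree_map, hd] at h2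
    rw [h2]
    refine Finset.prod_congr rfl fun j _ => ?_
    rw [natDegree_X_sub_C, resultant_X_sub_C_left _ _ _ hdd, hprod, derivative_prod_finset, eval_finset_sum,
      Finset.sum_eq_single j]
    · simp [eval_prod]
    · intro l _ hl
      simp only [eval_mul, eval_prod]
      rw [Finset.prod_eq_zero (i := j)]
      · simp
      · simp [Ne.symm hl]
      · simp
    · simp
  set ρ : PowerSeries k := ∏ j, ∏ l ∈ Finset.univ.erase j, (s j - s l) with hρ
  have h2 : zz k ^ (d * (d-1)) * evi k P = HahnSeries.ofPowerSeries ℤ k ρ := by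
    rw [h1, hρ, map_prod]
    simp only [map_prod, hτ, ← mul_sub, Finset.prod_mul_distrib, Finset.prod_const, map_sub]
    simp only [Finset.card_erase_of_mem (Finset.mem_univ _), Finset.card_univ, Fintype.card_fin, Finset.prod_const]
    rw [← mul_assoc, ← pow_mul, mul_comm (d-1) d, ← mul_pow, mul_inv_cancel₀ (zz_ne k), one_pow, one_mul]
  have hle := evi_deg P _ ρ h2
  have h3 := evi_reflect (d * (d-1)) P hle
  rw [h2] at h3
  have h4 := HahnSeries.ofPowerSeries_injective h3
  have h5 : PowerSeries.constantCoeff ρ = P.coeff (d * (d-1)) := by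
    rw [h4]; simp [coeff_reflect]
  have h6 : PowerSeries.constantCoeff ρ ≠ 0 := by
    rw [hρ, map_prod]
    simp only [map_prod, map_sub]
    refine Finset.prod_ne_zero_iff.2 fun j _ => Finset.prod_ne_zero_iff.2 fun l hl => ?_
    exact sub_ne_zero.2 fun h => (Finset.ne_of_mem_erase hl) (hs h.symm)
  rw [h5] at h6
  exact ⟨fun h => h6 (by rw [h]; simp), le_antisymm hle (le_natDegree_of_ne_zero h6)⟩

end LineIrr

end

section
open Polynomial
open Polynomial

namespace LineIrr

section GG
variable {k : Type*} [Field k]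

lemma hom_top {A : Type*} [CommRing A] [Algebra k A] (F : MvPolynomial (Fin 3) k) (d : ℕ) (hF : F.IsHomogeneous d)
    (u v : A) : (MvPolynomial.aeval ![(1 : A[X]), C u * X, C v * X] F).natDegree ≤ d ∧
      (MvPolynomial.aeval ![(1 : A[X]), C u * X, C v * X] F).coeff d = MvPolynomial.aeval ![0, u, v] F := by
  have key : MvPolynomial.aeval ![(1 : A[X]), C u * X, C v * X] F =
      ∑ m ∈ F.support, C (algebraMap k A (F.coeff m) * (u ^ m 1 * v ^ m 2)) * X ^ (m 1 + m 2) := by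
    rw [MvPolynomial.aeval_def, MvPolynomial.eval₂_eq']
    refine Finset.sum_congr rfl fun m _ => ?_
    simp only [Fin.prod_univ_three, Matrix.cons_val_zero, Matrix.cons_val_one, Matrix.cons_val, one_pow, one_mul,
      map_mul, map_pow, mul_pow, pow_add, Polynomial.algebraMap_apply]
    ring
  have hm : ∀ m ∈ F.support, m 0 + (m 1 + m 2) = d := by
    intro m hm
    have := hF (MvPolynomial.mem_support_iff.1 hm)
    rw [Finsupp.weight_apply, Finsupp.sum_fintype _ _ (by simp)] at this
    simpa [Fin.sum_univ_three, add_assoc] using this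
  constructor
  · rw [key]
    refine natDegree_sum_le_of_forall_le _ _ fun m h => ?_
    refine (natDegree_C_mul_X_pow_le _ _).trans ?_
    have := hm m h; omega
  · rw [key, finset_sum_coeff, MvPolynomial.aeval_def, MvPolynomial.eval₂_eq']
    refine Finset.sum_congr rfl fun m h => ?_
    have := hm m h
    simp only [Fin.prod_univ_three, Matrix.cons_val_zero, Matrix.cons_val_one, Matrix.cons_val, coeff_C_mul,
      coeff_X_pow]
    by_cases h0 : m 0 = 0
    · rw [if_pos (by omega), h0]; simp
    · rw [if_neg (by omega), zero_pow h0]; simp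

variable {B : Type*} [CommRing B]

/-- substitution `T ↦ X·Y`, `a ↦ Y`. -/
noncomputable def tot : B[X][X] →+* B[X][X] :=
  eval₂RingHom (eval₂RingHom ((C : B[X] →+* B[X][X]).comp C) X) (C X * X)

lemma tot_coeff (G : B[X][X]) (n j : ℕ) :
    ((tot G).coeff n).coeff j = if j ≤ n then (G.coeff j).coeff (n - j) else 0 := by
  induction G using Polynomial.induction_on' with
  | add p q hp hq => simp only [map_add, coeff_add, hp, hq]; split_ifs <;> simp
  | monomial i p =>
    induction p using Polynomial.induction_on' with
    | add p q hp hq => simp only [map_add, coeff_add, hp, hq]; split_ifs <;> simp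
    | monomial l b =>
      have : tot (monomial i (monomial l b)) = C (monomial i b) * X ^ (l + i) := by
        simp only [tot, coe_eval₂RingHom, eval₂_monomial, RingHom.comp_apply]
        rw [mul_pow, ← C_mul_X_pow_eq_monomial (n := i), C_mul, pow_add]
        simp only [map_pow]; ring
      rw [this, coeff_C_mul, coeff_X_pow]
      by_cases hij : i = j
      · subst hij
        by_cases h1 : n = l + i
        · subst h1; simp [coeff_monomial]
        · rw [if_neg h1]
          split_ifs with h2
          · rw [coeff_monomial, if_pos rfl, coeff_monomial, if_neg (by omega)]; simp
          · simp
      · rw [coeff_monomial, if_neg hij]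
        split_ifs <;> simp [coeff_monomial, hij]

variable [Algebra k B]

noncomputable def GG (c : B) (F : MvPolynomial (Fin 3) k) : B[X][X] :=
  MvPolynomial.aeval ![1, X, C (C c) * X + C X] F

lemma GG_map {B' : Type*} [CommRing B'] [Algebra k B'] (φ : B →ₐ[k] B') (c : B) (F : MvPolynomial (Fin 3) k) :
    (GG c F).map (mapRingHom φ.toRingHom) = GG (φ c) F := by
  have h := MvPolynomial.map_aeval ![1, X, C (C c) * X + C X] (mapRingHom (mapRingHom φ.toRingHom)) F
  rw [coe_mapRingHom] at h
  rw [GG, h, GG, MvPolynomial.aeval_def, ← MvPolynomial.coe_eval₂Hom]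
  congr 2
  · ext x; simp
  · funext i; fin_cases i <;> simp

lemma GG_derivative (c : B) (F : MvPolynomial (Fin 3) k) :
    derivative (GG c F) = GG c (MvPolynomial.pderiv 1 F) + C (C c) * GG c (MvPolynomial.pderiv 2 F) := by
  have h := deriv_aeval (Derivation.restrictScalars k (derivative' (R := B[X]))) ![1, X, C (C c) * X + C X] F
  simp [Fin.sum_univ_three] at h
  rw [GG, h, GG, GG]; ring

lemma GG_evalEval (c a0 u : B) (F : MvPolynomial (Fin 3) k) :
    (GG c F).evalEval a0 u = MvPolynomial.aeval ![1, u, c * u + a0] F := by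
  have h := MvPolynomial.map_aeval ![1, X, C (C c) * X + C X] (evalEvalRingHom a0 u) F
  rw [coe_evalEvalRingHom] at h
  rw [GG, h, MvPolynomial.aeval_def, ← MvPolynomial.coe_eval₂Hom]
  congr 2
  · ext x; simp
  · funext i; fin_cases i <;> simp [evalEval]

lemma GG_evalC (c u : B) (F : MvPolynomial (Fin 3) k) :
    (GG c F).eval (C u) = MvPolynomial.aeval ![1, C u, C (c * u) + X] F := by
  have h := MvPolynomial.map_aeval ![1, X, C (C c) * X + C X] (evalRingHom (C u)) F
  rw [coe_evalRingHom] at h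
  rw [GG, h, MvPolynomial.aeval_def, ← MvPolynomial.coe_eval₂Hom]
  congr 2
  · ext x; simp
  · funext i; fin_cases i <;> simp

lemma GG_map_eval (c a0 : B) (F : MvPolynomial (Fin 3) k) :
    (GG c F).map (evalRingHom a0) = MvPolynomial.aeval ![1, X, C c * X + C a0] F := by
  have h := MvPolynomial.map_aeval ![1, X, C (C c) * X + C X] (mapRingHom (evalRingHom a0)) F
  rw [coe_mapRingHom] at h
  rw [GG, h, MvPolynomial.aeval_def, ← MvPolynomial.coe_eval₂Hom]
  congr 2
  · ext x; simp
  · funext i; fin_cases i <;> simp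

lemma GG_evalC_deriv (c u a0 : B) (F : MvPolynomial (Fin 3) k) :
    (derivative ((GG c F).eval (C u))).eval a0 = MvPolynomial.aeval ![1, u, c * u + a0] (MvPolynomial.pderiv 2 F) := by
  have h := deriv_aeval (Derivation.restrictScalars k (derivative' (R := B))) ![1, C u, C (c * u) + X] F
  simp [Fin.sum_univ_three] at h
  rw [GG_evalC, ← GG_evalEval, map_mul, h, ← map_mul, ← GG_evalC]

lemma tot_GG (c : B) (F : MvPolynomial (Fin 3) k) :
    tot (GG c F) = MvPolynomial.aeval ![(1 : B[X][X]), C X * X, C (C c * X + 1) * X] F := by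
  have h := MvPolynomial.map_aeval ![1, X, C (C c) * X + C X] (tot (B := B)) F
  rw [GG, h, MvPolynomial.aeval_def, ← MvPolynomial.coe_eval₂Hom]
  congr 2
  · ext x : 1; simp [tot]
  · funext i; fin_cases i <;> simp [tot]
    ring

variable (c : B) (F : MvPolynomial (Fin 3) k) (d : ℕ)
lemma GG_low0 (hF : F.IsHomogeneous d) (j l : ℕ) (h : d < j + l) : ((GG c F).coeff j).coeff l = 0 := by
  have h1 := tot_coeff (GG c F) (j + l) j
  rw [if_pos (by omega), tot_GG, Nat.add_sub_cancel_left] at h1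
  rw [← h1, coeff_eq_zero_of_natDegree_lt (n := j + l)]
  · simp
  · exact (hom_top F d hF _ _).1.trans_lt h

lemma GG_low (hF : F.IsHomogeneous d) (j : ℕ) : ((GG c F).coeff j).natDegree ≤ d - j := by
  rw [natDegree_le_iff_coeff_eq_zero]
  intro l hl
  exact GG_low0 c F d hF j l (by omega)

lemma GG_natDegree (hF : F.IsHomogeneous d) : (GG c F).natDegree ≤ d := by
  rw [natDegree_le_iff_coeff_eq_zero]
  intro j hj
  ext l
  rw [GG_low0 c F d hF j l (by omega)]; simp

lemma GG_lead (hF : F.IsHomogeneous d) : (GG c F).coeff d = C (MvPolynomial.aeval ![0, 1, c] F) := by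
  have h := GG_low c F d hF d
  rw [Nat.sub_self, Nat.le_zero] at h
  rw [eq_C_of_natDegree_eq_zero h]
  congr 1
  have h2 := (hom_top F d hF (1 : B) c).2
  rw [← h2]
  have := GG_map_eval c 0 F
  rw [C_0, add_zero] at this
  rw [C_1, one_mul, ← this, coeff_map]; simp [coeff_zero_eq_eval_zero]

lemma GG_topP (hF : F.IsHomogeneous d) {B : Type*} [Field B] [Algebra k B] (c : B) :
    topP (GG c F) d = MvPolynomial.aeval ![0, X, C c * X + 1] F := by
  rw [← (hom_top F d hF (A := B[X]) X (C c * X + 1)).2, ← tot_GG]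
  ext j
  rw [tot_coeff, topP, finset_sum_coeff]
  simp only [coeff_monomial]
  simp [Nat.lt_succ_iff]

end GG

end LineIrr

end

section
open Polynomial
open Polynomial

namespace LineIrr

/-- smooth plane curves, transversal to the line at infinity -/
structure Crv (k : Type) [Field k] (d : ℕ) where
  F : MvPolynomial (Fin 3) k
  hom : F.IsHomogeneous d
  smooth : ∀ t x : k, MvPolynomial.aeval ![1, t, x] F = 0 → MvPolynomial.aeval ![1, t, x] (MvPolynomial.pderiv 1 F) = 0 →
    MvPolynomial.aeval ![1, t, x] (MvPolynomial.pderiv 2 F) ≠ 0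
  trans : ∀ u v : k, (u ≠ 0 ∨ v ≠ 0) → MvPolynomial.aeval ![0, u, v] F = 0 →
    MvPolynomial.aeval ![0, u, v] (MvPolynomial.pderiv 1 F) = 0 →
    MvPolynomial.aeval ![0, u, v] (MvPolynomial.pderiv 2 F) ≠ 0
  irr : Irreducible (MvPolynomial.aeval ![1, MvPolynomial.X 0, MvPolynomial.X 1] F : MvPolynomial (Fin 2) k)
  hd : 2 ≤ d
  hc : ((d * (d - 1) : ℕ) : k) ≠ 0

/-- dehomogenization -/
noncomputable def aff {k : Type*} [Field k] (F : MvPolynomial (Fin 3) k) : MvPolynomial (Fin 2) k :=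
  MvPolynomial.aeval ![1, MvPolynomial.X 0, MvPolynomial.X 1] F

lemma aeval_aff {k : Type*} [Field k] (F : MvPolynomial (Fin 3) k) {E : Type*} [CommRing E] [Algebra k E] (v : Fin 2 → E) :
    MvPolynomial.aeval v (aff F) = MvPolynomial.aeval ![1, v 0, v 1] F := by
  have h := MvPolynomial.comp_aeval_apply ![1, MvPolynomial.X 0, MvPolynomial.X 1] (MvPolynomial.aeval (R := k) v) F
  rw [aff, h]
  congr 2
  funext i; fin_cases i <;> simp

lemma aeval_hom {k : Type*} [Field k] {F : MvPolynomial (Fin 3) k} {d : ℕ} (hF : F.IsHomogeneous d) {E : Type*} [CommRing E]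
    [Algebra k E] (s : E) (a b c a' b' c' : E) (ha : a' = s * a) (hb : b' = s * b) (hc : c' = s * c) :
    MvPolynomial.aeval ![a', b', c'] F = s ^ d * MvPolynomial.aeval ![a, b, c] F := by
  subst ha hb hc
  rw [MvPolynomial.aeval_def, MvPolynomial.eval₂_eq', MvPolynomial.aeval_def, MvPolynomial.eval₂_eq', Finset.mul_sum]
  refine Finset.sum_congr rfl fun m hm => ?_
  have := hF (MvPolynomial.mem_support_iff.1 hm)
  rw [Finsupp.weight_apply, Finsupp.sum_fintype _ _ (by simp)] at this
  simp [Fin.sum_univ_three] at this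
  rw [← this]
  simp [Fin.prod_univ_three]
  ring

namespace Crv
variable {k : Type} [Field k] [IsAlgClosed k] {d : ℕ} (Z : Crv k d) {E : Type*} [Field E] [Algebra k E]

lemma smooth' (t x : E) (h0 : MvPolynomial.aeval ![1, t, x] Z.F = 0)
    (h1 : MvPolynomial.aeval ![1, t, x] (MvPolynomial.pderiv 1 Z.F) = 0) :
    MvPolynomial.aeval ![1, t, x] (MvPolynomial.pderiv 2 Z.F) ≠ 0 := by
  intro h2
  obtain ⟨P, hP⟩ := nullst (MvPolynomial.aeval (R := k) ![t, x])
  have e : ∀ H : MvPolynomial (Fin 3) k, MvPolynomial.aeval ![1, t, x] H = 0 → MvPolynomial.aeval ![1, P 0, P 1] H = 0 := by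
    intro H hH
    rw [← aeval_aff H P]
    apply hP
    rw [aeval_aff]; simpa using hH
  exact Z.smooth _ _ (e _ h0) (e _ h1) (e _ h2)

lemma trans' (u v : E) (huv : u ≠ 0 ∨ v ≠ 0) (h0 : MvPolynomial.aeval ![0, u, v] Z.F = 0)
    (h1 : MvPolynomial.aeval ![0, u, v] (MvPolynomial.pderiv 1 Z.F) = 0) :
    MvPolynomial.aeval ![0, u, v] (MvPolynomial.pderiv 2 Z.F) ≠ 0 := by
  intro h2
  have key : ∀ (α β : MvPolynomial (Fin 1) k) (s w : E), s ≠ 0 → u = s * MvPolynomial.aeval ![w] α → v = s * MvPolynomial.aeval ![w] β →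
      (∀ P : Fin 1 → k, MvPolynomial.aeval P α ≠ 0 ∨ MvPolynomial.aeval P β ≠ 0) → False := by
    intro α β s w hs hu hv hab
    obtain ⟨P, hP⟩ := nullst (MvPolynomial.aeval (R := k) ![w])
    have e : ∀ (n : ℕ) (H : MvPolynomial (Fin 3) k), H.IsHomogeneous n → MvPolynomial.aeval ![0, u, v] H = 0 →
        MvPolynomial.aeval ![0, MvPolynomial.aeval P α, MvPolynomial.aeval P β] H = 0 := by
      intro n H hn hH
      rw [aeval_hom hn s 0 (MvPolynomial.aeval ![w] α) (MvPolynomial.aeval ![w] β) _ _ _ (by simp) hu hv] at hH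
      have hH2 := (mul_eq_zero.1 hH).resolve_left (pow_ne_zero _ hs)
      have g : ∀ {R : Type _} [CommRing R] [Algebra k R] (y : Fin 1 → R), MvPolynomial.aeval ![0, MvPolynomial.aeval y α, MvPolynomial.aeval y β] H
         = MvPolynomial.aeval y (MvPolynomial.aeval ![0, α, β] H) := by
        intro R _ _ y
        have h := MvPolynomial.comp_aeval_apply ![0, α, β] (MvPolynomial.aeval (R := k) y) H
        rw [h]; congr 2; funext i; fin_cases i <;> simp
      have g' : MvPolynomial.aeval ![0, MvPolynomial.aeval ![w] α, MvPolynomial.aeval ![w] β] H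
         = MvPolynomial.aeval ![w] (MvPolynomial.aeval ![0, α, β] H) := by
        have h := MvPolynomial.comp_aeval_apply ![0, α, β] (MvPolynomial.aeval (R := k) ![w]) H
        rw [h]; congr 2; funext i; fin_cases i <;> simp
      rw [g]; apply hP; rw [← g']; exact hH2
    exact Z.trans _ _ (hab P) (e _ _ Z.hom h0) (e _ _ Z.hom.pderiv h1) (e _ _ Z.hom.pderiv h2)
  rcases huv with h | h
  · exact key 1 (MvPolynomial.X 0) u (v / u) h (by simp) (by simp; field_simp) (fun P => by simp)
  · exact key (MvPolynomial.X 0) 1 v (u / v) h (by simp; field_simp) (by simp) (fun P => by simp)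

end Crv
end LineIrr

end

section
open Polynomial
open Polynomial

namespace LineIrr

namespace Crv
variable {k : Type} [Field k] [IsAlgClosed k] {d : ℕ} (Z : Crv k d) {E : Type*} [Field E] [Algebra k E]

noncomputable def lam (c : E) : E := MvPolynomial.aeval ![0, 1, c] Z.F

noncomputable def nG (c : E) : E[X][X] := C (C (Z.lam c)⁻¹) * GG c Z.F

/-- the discriminant polynomial -/
noncomputable def PP {B : Type*} [CommRing B] [Algebra k B] (c : B) : B[X] :=
  resultant (GG c Z.F) (derivative (GG c Z.F)) d (d - 1)

lemma PP_map {B B' : Type*} [CommRing B] [Algebra k B] [CommRing B'] [Algebra k B'] (φ : B →ₐ[k] B') (c : B) :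
    (Z.PP c).map φ.toRingHom = Z.PP (φ c) := by
  have := resultant_map_map (f := GG c Z.F) (g := derivative (GG c Z.F)) (m := d) (n := d - 1) (mapRingHom φ.toRingHom)
  rw [PP, ← coe_mapRingHom, ← this, ← derivative_map, GG_map]; rfl

variable (c : E)

lemma lam_eq : Z.lam c = MvPolynomial.aeval ![0, 1, c] Z.F := rfl

lemma topP_nG : topP (Z.nG c) d = C (Z.lam c)⁻¹ * MvPolynomial.aeval ![0, X, C c * X + 1] Z.F := by
  rw [← GG_topP Z.F d Z.hom c, topP, topP, Finset.mul_sum]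
  simp [nG, C_mul_monomial]

lemma nG_low (j : ℕ) : ((Z.nG c).coeff j).natDegree ≤ d - j := by
  rw [nG, coeff_C_mul]
  exact (natDegree_C_mul_le _ _).trans (GG_low c Z.F d Z.hom j)

lemma nG_natDegree_le : (Z.nG c).natDegree ≤ d := (natDegree_C_mul_le _ _).trans (GG_natDegree c Z.F d Z.hom)

variable (hc : Z.lam c ≠ 0)

lemma nG_coeff (hc : Z.lam c ≠ 0) : (Z.nG c).coeff d = 1 := by
  rw [nG, coeff_C_mul, GG_lead c Z.F d Z.hom, ← C_mul, ← lam_eq, inv_mul_cancel₀ hc, C_1]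

lemma nG_natDegree (hc : Z.lam c ≠ 0) : (Z.nG c).natDegree = d :=
  le_antisymm (Z.nG_natDegree_le c) (le_natDegree_of_ne_zero (by rw [Z.nG_coeff c hc]; exact one_ne_zero))

lemma nG_monic (hc : Z.lam c ≠ 0) : (Z.nG c).Monic := by
  rw [Monic, leadingCoeff, Z.nG_natDegree c hc, Z.nG_coeff c hc]

lemma euler {R : Type*} [CommRing R] [Algebra k R] (v : Fin 3 → R) (h0 : MvPolynomial.aeval v Z.F = 0) :
    v 0 * MvPolynomial.aeval v (MvPolynomial.pderiv 0 Z.F) + v 1 * MvPolynomial.aeval v (MvPolynomial.pderiv 1 Z.F)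
     + v 2 * MvPolynomial.aeval v (MvPolynomial.pderiv 2 Z.F) = 0 := by
  have := congrArg (MvPolynomial.aeval v) Z.hom.sum_X_mul_pderiv
  simp only [map_sum, map_mul, MvPolynomial.aeval_X, map_nsmul, h0, smul_zero, Fin.sum_univ_three] at this
  simpa using this

lemma nG_sep (hc : Z.lam c ≠ 0) : (topP (Z.nG c) d).Separable := by
  have hu : IsUnit (C (Z.lam c)⁻¹ : E[X]) := isUnit_C.2 (inv_ne_zero hc).isUnit
  rw [topP_nG, Separable]
  rw [derivative_C_mul, isCoprime_mul_unit_left_left hu, isCoprime_mul_unit_left_right hu]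
  rw [Polynomial.isCoprime_iff_aeval_ne_zero_of_isAlgClosed E (AlgebraicClosure E)]
  intro u
  by_contra! hcon
  obtain ⟨h1, h2⟩ := hcon
  have hder := deriv_aeval (Derivation.restrictScalars k (derivative' (R := E))) ![0, X, C c * X + 1] Z.F
  simp [Fin.sum_univ_three] at hder
  rw [hder, map_add, map_mul, aeval_C] at h2
  set c' : AlgebraicClosure E := algebraMap E _ c with hc'
  have e : ∀ H : MvPolynomial (Fin 3) k, aeval u (MvPolynomial.aeval ![0, (X : E[X]), C c * X + 1] H) =
      MvPolynomial.aeval ![0, u, c' * u + 1] H := by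
    intro H
    have h := MvPolynomial.comp_aeval_apply ![0, (X : E[X]), C c * X + 1] ((aeval u : E[X] →ₐ[E] _).restrictScalars k) H
    simp only [AlgHom.coe_restrictScalars'] at h
    rw [h]; congr 2; funext i; fin_cases i <;> simp [hc']
  rw [e] at h1 h2
  rw [e] at h2
  have h3 := Z.euler _ h1
  simp only [Matrix.cons_val_zero, Matrix.cons_val_one, Matrix.cons_val, zero_mul, zero_add] at h3
  have h4 : MvPolynomial.aeval ![0, u, c' * u + 1] (MvPolynomial.pderiv 2 Z.F) = 0 := by linear_combination h3 - u * h2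
  have h5 : MvPolynomial.aeval ![0, u, c' * u + 1] (MvPolynomial.pderiv 1 Z.F) = 0 := by
    rw [h4] at h2; simpa using h2
  refine Z.trans' u (c' * u + 1) ?_ h1 h5 h4
  by_contra! hcon
  rw [hcon.1] at hcon; simp at hcon

lemma nG_smooth (hc : Z.lam c ≠ 0) (u a0 : E) (h0 : (Z.nG c).evalEval a0 u = 0) (h1 : (derivative (Z.nG c)).evalEval a0 u = 0) :
    (derivative ((Z.nG c).eval (C u))).eval a0 ≠ 0 := by
  intro h2
  have hl := inv_ne_zero hc
  rw [nG] at h0 h1 h2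
  rw [derivative_C_mul] at h1
  rw [eval_mul, eval_C, derivative_C_mul, eval_mul, eval_C, GG_evalC_deriv] at h2
  simp only [evalEval_mul, evalEval_C, eval_C, GG_derivative, evalEval_add, GG_evalEval, mul_eq_zero, hl, false_or] at h0 h1 h2
  rw [h2, mul_zero, add_zero] at h1
  exact Z.smooth' u _ h0 h1 h2

lemma PP_eq (hc : Z.lam c ≠ 0) : resultant (Z.nG c) (derivative (Z.nG c)) d (d-1) = C ((Z.lam c)⁻¹ ^ (d - 1) * (Z.lam c)⁻¹ ^ d) * Z.PP c := by
  rw [nG, derivative_C_mul, resultant_C_mul_left, resultant_C_mul_right, PP]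
  simp only [C_mul, C_pow]; ring

lemma PP_deg (hc : Z.lam c ≠ 0) : Z.PP c ≠ 0 ∧ (Z.PP c).natDegree = d * (d-1) := by
  let A := AlgebraicClosure E
  let φ : E →ₐ[k] A := IsScalarTower.toAlgHom k E A
  have hl : Z.lam (φ c) = φ (Z.lam c) := by
    rw [lam, lam]
    have h := MvPolynomial.comp_aeval_apply ![0, 1, c] φ Z.F
    rw [h]; congr 2; funext i; fin_cases i <;> simp
  have hl' : Z.lam (φ c) ≠ 0 := by
    rw [hl]; exact (map_ne_zero_iff _ φ.toRingHom.injective).2 hc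
  obtain ⟨h1, h2⟩ := natDegree_res (Z.nG (φ c)) d (Z.nG_monic _ hl') (Z.nG_natDegree _ hl') (Z.nG_low _) (Z.nG_sep _ hl')
  rw [PP_eq _ _ hl'] at h1 h2
  have hne : (Z.lam (φ c))⁻¹ ^ (d - 1) * (Z.lam (φ c))⁻¹ ^ d ≠ 0 := mul_ne_zero (pow_ne_zero _ (inv_ne_zero hl')) (pow_ne_zero _ (inv_ne_zero hl'))
  rw [natDegree_C_mul hne] at h2
  have h3 := right_ne_zero_of_mul h1
  rw [← PP_map] at h2 h3
  rw [natDegree_map_eq_of_injective φ.toRingHom.injective] at h2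
  exact ⟨fun h => h3 (by rw [h]; simp), h2⟩

end Crv
end LineIrr

end

section
open Polynomial
open Polynomial

namespace LineIrr

namespace Crv
variable {k : Type} [Field k] [IsAlgClosed k] {d : ℕ} (Z : Crv k d)

lemma irr' : Irreducible (aff Z.F) := Z.irr

variable {Q : Type} [CommRing Q] [Nontrivial Q] [Algebra (RatFunc k) Q] [Algebra k Q] [IsScalarTower k (RatFunc k) Q] (t x : Q)

lemma unit_of_not_dvd (h0 : MvPolynomial.aeval ![1, t, x] Z.F = 0)
    (h1 : MvPolynomial.aeval ![1, t, x] (MvPolynomial.pderiv 1 Z.F) + algebraMap (RatFunc k) Q RatFunc.X *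
      MvPolynomial.aeval ![1, t, x] (MvPolynomial.pderiv 2 Z.F) = 0) (b : MvPolynomial (Fin 2) k) (hb : ¬ aff Z.F ∣ b) :
    IsUnit (MvPolynomial.aeval ![t, x] b) := by
  by_contra hu
  obtain ⟨m, hm, hbm⟩ := exists_max_ideal_of_mem_nonunits hu
  letI : Field (Q ⧸ m) := Ideal.Quotient.field m
  let π : Q →ₐ[k] Q ⧸ m := Ideal.Quotient.mkₐ k m
  let φ : MvPolynomial (Fin 2) k →ₐ[k] Q ⧸ m := π.comp (MvPolynomial.aeval ![t, x])
  have e : ∀ H : MvPolynomial (Fin 3) k, φ (aff H) = π (MvPolynomial.aeval ![1, t, x] H) := by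
    intro H
    simp only [φ, AlgHom.comp_apply, aeval_aff]; simp
  obtain ⟨P, hP⟩ := point_of_two (aff Z.F) b Z.irr' φ (by rw [e, h0, map_zero]) (Ideal.Quotient.eq_zero_iff_mem.2 hbm) hb
  have e2 : ∀ H : MvPolynomial (Fin 3) k, π (MvPolynomial.aeval ![1, t, x] H) = algebraMap k (Q ⧸ m) (MvPolynomial.aeval ![1, P 0, P 1] H) := by
    intro H
    rw [← e, hP, aeval_aff]
  have a0 : MvPolynomial.aeval ![1, P 0, P 1] Z.F = 0 := by
    apply (algebraMap k (Q ⧸ m)).injective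
    rw [← e2, h0, map_zero, map_zero]
  have h2 := congrArg π h1
  rw [map_add, map_mul, e2, e2, map_zero] at h2
  set y1 := MvPolynomial.aeval ![1, P 0, P 1] (MvPolynomial.pderiv 1 Z.F)
  set y2 := MvPolynomial.aeval ![1, P 0, P 1] (MvPolynomial.pderiv 2 Z.F)
  have h3 : algebraMap (RatFunc k) (Q ⧸ m) (algebraMap k[X] (RatFunc k) (C y1 + X * C y2)) = 0 := by
    rw [← h2]
    have ec : ∀ y : k, algebraMap k (Q ⧸ m) y = algebraMap (RatFunc k) (Q ⧸ m) (RatFunc.C y) := fun y => by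
      change π (algebraMap k Q y) = π (algebraMap (RatFunc k) Q (RatFunc.C y))
      rw [IsScalarTower.algebraMap_apply k (RatFunc k) Q]
      simp [RatFunc.algebraMap_eq_C]
    simp only [map_add, map_mul, RatFunc.algebraMap_X, RatFunc.algebraMap_C, ec]
    rfl
  have h4 : (C y1 + X * C y2 : k[X]) = 0 := by
    apply RatFunc.algebraMap_injective k
    apply (algebraMap (RatFunc k) (Q ⧸ m)).injective
    rw [h3]; simp
  have h5 := congrArg (fun p => coeff p 0) h4
  have h6 := congrArg (fun p => coeff p 1) h4
  simp at h5 h6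
  exact Z.smooth _ _ a0 h5 h6

lemma unit_FX (h0 : MvPolynomial.aeval ![1, t, x] Z.F = 0)
    (h1 : MvPolynomial.aeval ![1, t, x] (MvPolynomial.pderiv 1 Z.F) + algebraMap (RatFunc k) Q RatFunc.X *
      MvPolynomial.aeval ![1, t, x] (MvPolynomial.pderiv 2 Z.F) = 0) :
    IsUnit (MvPolynomial.aeval ![1, t, x] (MvPolynomial.pderiv 2 Z.F)) ∧ ¬ aff Z.F ∣ aff (MvPolynomial.pderiv 2 Z.F) := by
  have e : ∀ H : MvPolynomial (Fin 3) k, MvPolynomial.aeval ![t, x] (aff H) = MvPolynomial.aeval ![1, t, x] H := by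
    intro H; rw [aeval_aff]; simp
  have hnd : ¬ aff Z.F ∣ aff (MvPolynomial.pderiv 2 Z.F) := by
    rintro ⟨w, hw⟩
    have h2 : MvPolynomial.aeval ![1, t, x] (MvPolynomial.pderiv 2 Z.F) = 0 := by
      rw [← e, hw, map_mul, e, h0, zero_mul]
    rw [h2, mul_zero, add_zero] at h1
    obtain ⟨m, hm⟩ := Ideal.exists_maximal Q
    letI : Field (Q ⧸ m) := Ideal.Quotient.field m
    let π : Q →ₐ[k] Q ⧸ m := Ideal.Quotient.mkₐ k m
    have e2 : ∀ H : MvPolynomial (Fin 3) k, π (MvPolynomial.aeval ![1, t, x] H) = MvPolynomial.aeval ![1, π t, π x] H := by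
      intro H
      rw [MvPolynomial.comp_aeval_apply ![1, t, x] π H]
      congr 2; funext i; fin_cases i <;> simp
    exact Z.smooth' (π t) (π x) (by rw [← e2, h0, map_zero]) (by rw [← e2, h1, map_zero]) (by rw [← e2, h2, map_zero])
  refine ⟨?_, hnd⟩
  rw [← e]
  exact Z.unit_of_not_dvd t x h0 h1 _ hnd

lemma isField (h0 : MvPolynomial.aeval ![1, t, x] Z.F = 0)
    (h1 : MvPolynomial.aeval ![1, t, x] (MvPolynomial.pderiv 1 Z.F) + algebraMap (RatFunc k) Q RatFunc.X *
      MvPolynomial.aeval ![1, t, x] (MvPolynomial.pderiv 2 Z.F) = 0)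
    (htop : Algebra.adjoin (RatFunc k) {t, x} = ⊤) : IsField Q := by
  set φ := MvPolynomial.aeval (R := k) ![t, x] with hφ
  have e : ∀ H : MvPolynomial (Fin 3) k, φ (aff H) = MvPolynomial.aeval ![1, t, x] H := by
    intro H; rw [hφ, aeval_aff]; simp
  have hU := Z.unit_of_not_dvd t x h0 h1
  have hprime : Prime (aff Z.F) := Z.irr'.prime
  have hmul : ∀ {u v}, ¬ aff Z.F ∣ u → ¬ aff Z.F ∣ v → ¬ aff Z.F ∣ u * v := fun hu hv h =>
    (hprime.dvd_or_dvd h).elim hu hv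
  have hz : ∀ {b}, φ b ≠ 0 → ¬ aff Z.F ∣ b := by
    rintro b hb ⟨w, rfl⟩
    apply hb; rw [map_mul, e, h0, zero_mul]
  have hone : ¬ aff Z.F ∣ 1 := fun h => hprime.not_unit (isUnit_of_dvd_one h)
  let S : Subring Q :=
    { carrier := {z | ∃ s u, ¬ aff Z.F ∣ u ∧ z * φ u = φ s}
      mul_mem' := by
        rintro a b ⟨s, u, hu, h⟩ ⟨s', u', hu', h'⟩
        exact ⟨s * s', u * u', hmul hu hu', by rw [map_mul, map_mul, ← h, ← h']; ring⟩
      one_mem' := ⟨1, 1, hone, by simp⟩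
      add_mem' := by
        rintro a b ⟨s, u, hu, h⟩ ⟨s', u', hu', h'⟩
        exact ⟨s * u' + s' * u, u * u', hmul hu hu', by simp only [map_mul, map_add, ← h, ← h']; ring⟩
      zero_mem' := ⟨0, 1, hone, by simp⟩
      neg_mem' := by
        rintro a ⟨s, u, hu, h⟩
        exact ⟨-s, u, hu, by rw [map_neg, ← h]; ring⟩ }
  have hφS : ∀ b, φ b ∈ S := fun b => ⟨b, 1, hone, by simp⟩
  have hS : algebraMap (RatFunc k) Q RatFunc.X ∈ S := by
    obtain ⟨-, hnd⟩ := Z.unit_FX t x h0 h1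
    refine ⟨- aff (MvPolynomial.pderiv 1 Z.F), _, hnd, ?_⟩
    rw [map_neg, e, e]; linear_combination h1
  have hinv : ∀ z z' : Q, z * z' = 1 → z ∈ S → z' ∈ S := by
    rintro z z' hzz ⟨s, u, hu, h⟩
    refine ⟨u, s, hz ?_, ?_⟩
    · rw [← h]
      exact ((IsUnit.of_mul_eq_one z' hzz).mul (hU u hu)).ne_zero
    · rw [← h]; linear_combination (φ u) * hzz
  have hpol : ∀ p : k[X], algebraMap (RatFunc k) Q (algebraMap k[X] (RatFunc k) p) ∈ S := by
    intro p
    induction p using Polynomial.induction_on' with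
    | add p q hp hq => rw [map_add, map_add]; exact S.add_mem hp hq
    | monomial n c =>
      rw [← C_mul_X_pow_eq_monomial]
      simp only [map_mul, map_pow, RatFunc.algebraMap_X, RatFunc.algebraMap_C]
      refine S.mul_mem ?_ (S.pow_mem hS n)
      have : algebraMap (RatFunc k) Q (RatFunc.C c) = φ (MvPolynomial.C c) := by
        rw [← MvPolynomial.algebraMap_eq, AlgHom.commutes, IsScalarTower.algebraMap_apply k (RatFunc k) Q]; rfl
      rw [this]; exact hφS _
  have hK : ∀ r : RatFunc k, algebraMap (RatFunc k) Q r ∈ S := by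
    intro r
    induction r using RatFunc.induction_on with
    | f p q hq =>
      rw [div_eq_mul_inv, map_mul]
      refine S.mul_mem (hpol p) (hinv _ _ ?_ (hpol q))
      rw [← map_mul, mul_inv_cancel₀, map_one]
      exact (map_ne_zero_iff _ (RatFunc.algebraMap_injective k)).2 hq
  have hall : ∀ z : Q, z ∈ S := by
    intro z
    have : z ∈ Algebra.adjoin (RatFunc k) {t, x} := by rw [htop]; trivial
    induction this using Algebra.adjoin_induction with
    | mem y hy =>
      rcases hy with rfl | rfl
      · have := hφS (MvPolynomial.X 0); simpa [hφ] using this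
      · have := hφS (MvPolynomial.X 1); simpa [hφ] using this
    | algebraMap r => exact hK r
    | add a b _ _ ha hb => exact S.add_mem ha hb
    | mul a b _ _ ha hb => exact S.mul_mem ha hb
  refine ⟨exists_pair_ne Q, mul_comm, fun {z} hz0 => ?_⟩
  obtain ⟨s, u, hu, h⟩ := hall z
  have hs : φ s ≠ 0 := by
    rw [← h]; intro h'
    exact hz0 ((hU u hu).mul_left_eq_zero.1 h')
  have := hU s (hz hs)
  rw [← hφ, ← h] at this
  exact (isUnit_of_mul_isUnit_left this).exists_right_inv

end Crv
end LineIrr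

end

section
open Polynomial
open Polynomial

namespace LineIrr

lemma prime_transfer {A B : Type*} [CommRing A] [CommRing B] (f : A →+* B) (g : B →+* A) (h1 : ∀ z, g (f z) = z)
    (h2 : ∀ z, f (g z) = z) (a : A) (ha : Prime a) : Prime (f a) := by
  let e : A ≃+* B := { f with
    invFun := g
    left_inv := h1
    right_inv := h2 }
  exact (MulEquiv.prime_iff e.toMulEquiv).2 ha

lemma prime_loc {R K : Type*} [CommRing R] [IsDomain R] [Field K] [Algebra R K] [IsFractionRing R K] (g : R[X][X]) (hP : Prime g)
    (hd : 0 < g.natDegree) : Prime (g.map (mapRingHom (algebraMap R K))) := by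
  letI i1 : Algebra R[X] K[X] := (mapRingHom (algebraMap R K)).toAlgebra
  have l1 : IsLocalization ((nonZeroDivisors R).map (C : R →+* R[X])) K[X] := Polynomial.isLocalization _ _
  letI i2 : Algebra R[X][X] K[X][X] := (mapRingHom (algebraMap R[X] K[X])).toAlgebra
  have l2 : IsLocalization (((nonZeroDivisors R).map (C : R →+* R[X])).map (C : R[X] →+* R[X][X])) K[X][X] :=
    Polynomial.isLocalization _ _
  set M := (((nonZeroDivisors R).map (C : R →+* R[X])).map (C : R[X] →+* R[X][X]))
  have hI : (Ideal.span {g}).IsPrime := (Ideal.span_singleton_prime hP.ne_zero).2 hP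
  have hdis : Disjoint (M : Set R[X][X]) (Ideal.span {g} : Ideal _) := by
    rw [Set.disjoint_left]
    rintro _ ⟨_, ⟨b, hb, rfl⟩, rfl⟩ hx
    obtain ⟨w, hw⟩ := Ideal.mem_span_singleton.1 hx
    have hb0 : (b : R) ≠ 0 := nonZeroDivisors.ne_zero hb
    have hw0 : w ≠ 0 := by rintro rfl; rw [mul_zero] at hw; simp at hw; exact hb0 hw
    have h1 := congrArg natDegree hw
    rw [natDegree_C, natDegree_mul hP.ne_zero hw0] at h1
    omega
  have h1 := IsLocalization.isPrime_of_isPrime_disjoint M K[X][X] _ hI hdis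
  rw [Ideal.map_span, Set.image_singleton] at h1
  refine (Ideal.span_singleton_prime ?_).1 h1
  rw [Polynomial.map_ne_zero_iff (map_injective _ (IsFractionRing.injective R K))]
  exact hP.ne_zero

namespace Crv
variable {k : Type} [Field k] [IsAlgClosed k] {d : ℕ} (Z : Crv k d)

noncomputable def lamP : k[X] := MvPolynomial.aeval ![0, 1, X] Z.F

lemma lamP_map {E : Type*} [Field E] [Algebra k E] (c : E) : aeval c Z.lamP = Z.lam c := by
  have h := MvPolynomial.comp_aeval_apply ![0, 1, X] (aeval c : k[X] →ₐ[k] E) Z.F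
  rw [lamP, lam, h]; congr 2; funext i; fin_cases i <;> simp

lemma lamP_ne : Z.lamP ≠ 0 := by
  intro h0
  have hder := deriv_aeval (derivative' (R := k)) ![0, 1, X] Z.F
  simp [Fin.sum_univ_three] at hder
  rw [← lamP, h0, derivative_zero] at hder
  have e : ∀ H : MvPolynomial (Fin 3) k, aeval (0:k) (MvPolynomial.aeval ![0, 1, (X : k[X])] H) =
      MvPolynomial.aeval ![0, 1, (0:k)] H := by
    intro H
    have h := MvPolynomial.comp_aeval_apply ![0, 1, (X : k[X])] (aeval (0:k) : k[X] →ₐ[k] k) H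
    rw [h]; congr 2; funext i; fin_cases i <;> simp
  have h1 := e Z.F
  have h2 := e (MvPolynomial.pderiv 2 Z.F)
  rw [← lamP, h0, map_zero] at h1
  rw [← hder, map_zero] at h2
  have h3 := Z.euler _ h1.symm
  simp at h3
  exact Z.trans 1 0 (by simp) h1.symm h3 h2.symm

lemma lamX_ne : Z.lam (RatFunc.X : RatFunc k) ≠ 0 := by
  rw [← lamP_map, ← RatFunc.algebraMap_X, aeval_algebraMap_apply, aeval_X_left_apply]
  exact (map_ne_zero_iff _ (RatFunc.algebraMap_injective k)).2 Z.lamP_ne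

lemma GG_prime : Prime (GG (X : k[X]) Z.F) := by
  let A := MvPolynomial (Fin 2) k
  let ι : A →ₐ[k] A[X] := IsScalarTower.toAlgHom k A A[X]
  have hι : ∀ a : A, ι a = C a := fun a => rfl
  let φ : A →ₐ[k] k[X][X][X] := MvPolynomial.aeval (R := k) (S₁ := k[X][X][X]) ![X, C (C X) * X + C X]
  let f1 : k[X] →ₐ[k] A[X] := aeval X
  let f2 : k[X][X] →ₐ[k] A[X] := { eval₂RingHom f1.toRingHom (C (MvPolynomial.X 1) - X * C (MvPolynomial.X 0)) with
    commutes' := fun a => by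
      change eval₂ _ _ (C (C a)) = _
      rw [eval₂_C]; exact f1.commutes a }
  let f3 : k[X][X][X] →ₐ[k] A[X] := { eval₂RingHom f2.toRingHom (C (MvPolynomial.X 0)) with
    commutes' := fun a => by
      change eval₂ _ _ (C (C (C a))) = _
      rw [eval₂_C]; exact f2.commutes a }
  let φ0 : A →+* k[X][X][X] := φ.toRingHom
  let b0 : A[X] →+* k[X][X][X] := eval₂RingHom (R := A) (S := k[X][X][X]) φ0 (C (C X))
  let b : A[X] →ₐ[k] k[X][X][X] := { b0 with
    commutes' := fun a => by
      change eval₂ _ _ (C (algebraMap k A a)) = _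
      rw [eval₂_C]; exact φ.commutes a }
  have f3X : f3 X = C (MvPolynomial.X 0) := eval₂_X _ _
  have f3C : ∀ p, f3 (C p) = f2 p := fun p => eval₂_C _ _
  have f2X : f2 X = C (MvPolynomial.X 1) - X * C (MvPolynomial.X 0) := eval₂_X _ _
  have f2C : ∀ p, f2 (C p) = f1 p := fun p => eval₂_C _ _
  have f1X : f1 X = X := aeval_X _
  have bX : b X = C (C X) := eval₂_X _ _
  have bC : ∀ p, b (C p) = φ p := fun p => eval₂_C _ _
  have φ0 : φ (MvPolynomial.X 0) = X := MvPolynomial.aeval_X (R := k) _ _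
  have φ1 : φ (MvPolynomial.X 1) = C (C X) * X + C X := MvPolynomial.aeval_X (R := k) _ _
  have hfb : ∀ z, f3 (b z) = z := by
    intro z
    have h1 : (f3.comp b).toRingHom = RingHom.id _ := by
      apply Polynomial.ringHom_ext
      · intro a
        have : (f3.comp φ) = ι := by
          apply MvPolynomial.algHom_ext
          intro i; fin_cases i
          · change f3 (φ (MvPolynomial.X 0)) = _
            rw [φ0, f3X]; rfl
          · change f3 (φ (MvPolynomial.X 1)) = _
            rw [φ1, map_add, map_mul, f3X, f3C, f3C, f2C, f1X, f2X, hι]; change _ = C (MvPolynomial.X 1); ring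
        have h2 := DFunLike.congr_fun this a
        change f3 (b (C a)) = C a
        rw [bC]; exact h2
      · change f3 (b X) = X
        rw [bX, f3C, f2C, f1X]
    exact DFunLike.congr_fun h1 z
  have hbf : ∀ z, b (f3 z) = z := by
    intro z
    have h1 : (b.comp f3).toRingHom = RingHom.id _ := by
      apply Polynomial.ringHom_ext'
      · apply Polynomial.ringHom_ext'
        · apply Polynomial.ringHom_ext
          · intro a
            change b (f3 (C (C (C a)))) = C (C (C a))
            rw [f3C, f2C]
            exact (b.comp f1).commutes a
          · change b (f3 (C (C X))) = C (C X)
            rw [f3C, f2C, f1X, bX]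
        · change b (f3 (C X)) = C X
          rw [f3C, f2X, map_sub, map_mul, bC, bC, bX, φ0, φ1]; ring
      · change b (f3 X) = X
        rw [f3X, bC, φ0]
    exact DFunLike.congr_fun h1 z
  have hp : Prime (C (aff Z.F) : A[X]) := prime_C_iff.2 Z.irr'.prime
  have h2 := prime_transfer (A := A[X]) (B := k[X][X][X]) b.toRingHom f3.toRingHom (fun z => hfb z) (fun z => hbf z) _ hp
  have h3 : b.toRingHom (C (aff Z.F)) = GG (X : k[X]) Z.F := by
    change b (C (aff Z.F)) = _
    rw [bC]
    have h5 := aeval_aff Z.F (E := k[X][X][X]) ![X, C (C X) * X + C X]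
    refine Eq.trans ?_ (h5.trans ?_)
    · rfl
    · rfl
  rwa [h3] at h2

lemma nG_prime : Prime (Z.nG (RatFunc.X : RatFunc k)) := by
  have hP := Z.GG_prime
  have h2 : d ≤ (GG (X : k[X]) Z.F).natDegree := by
    apply le_natDegree_of_ne_zero
    rw [GG_lead _ _ _ Z.hom]
    exact C_ne_zero.2 Z.lamP_ne
  have h3 := prime_loc (K := RatFunc k) _ hP (lt_of_lt_of_le (by have := Z.hd; omega) h2)
  have h2 : (GG (X : k[X]) Z.F).map (mapRingHom (algebraMap k[X] (RatFunc k))) = GG RatFunc.X Z.F := by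
    have := GG_map (IsScalarTower.toAlgHom k k[X] (RatFunc k)) X Z.F
    simp only [IsScalarTower.coe_toAlgHom', RatFunc.algebraMap_X] at this
    exact this
  rw [h2] at h3
  have hu : IsUnit (C (C (Z.lam (RatFunc.X : RatFunc k))⁻¹) : (RatFunc k)[X][X]) := isUnit_C.2 (isUnit_C.2 (inv_ne_zero Z.lamX_ne).isUnit)
  rw [nG]
  exact (associated_unit_mul_right _ _ hu).prime h3

end Crv
end LineIrr

end

section
open Polynomial
open Polynomial

namespace LineIrr

namespace Crv
variable {k : Type} [Field k] [IsAlgClosed k] {d : ℕ} (Z : Crv k d)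

set_option maxHeartbeats 800000 in
lemma exists_Q : ∃ (Q : Type) (_ : CommRing Q) (_ : Algebra (RatFunc k) Q) (_ : Algebra k Q) (_ : IsScalarTower k (RatFunc k) Q)
    (t α : Q), Module.finrank (RatFunc k) Q = d * (d - 1) ∧ Algebra.adjoin (RatFunc k) {t, algebraMap (RatFunc k) Q RatFunc.X * t + α} = ⊤ ∧
    MvPolynomial.aeval ![1, t, algebraMap (RatFunc k) Q RatFunc.X * t + α] Z.F = 0 ∧
    MvPolynomial.aeval ![1, t, algebraMap (RatFunc k) Q RatFunc.X * t + α] (MvPolynomial.pderiv 1 Z.F) +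
      algebraMap (RatFunc k) Q RatFunc.X * MvPolynomial.aeval ![1, t, algebraMap (RatFunc k) Q RatFunc.X * t + α] (MvPolynomial.pderiv 2 Z.F) = 0 ∧
    aeval α (Z.PP (RatFunc.X : RatFunc k)) = 0 := by
  set s : RatFunc k := RatFunc.X with hs
  have hl := Z.lamX_ne
  set g := Z.nG s with hg
  have hm := Z.nG_monic s hl
  have hdeg := Z.nG_natDegree s hl
  have hdd : (derivative g).natDegree ≤ d - 1 := (natDegree_derivative_le _).trans (by rw [hdeg])
  have hnorm := norm_eq_resultant g (derivative g) hm (d-1) hdd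
  rw [hdeg, Z.PP_eq s hl] at hnorm
  have hne : (Z.lam s)⁻¹ ^ (d - 1) * (Z.lam s)⁻¹ ^ d ≠ 0 := mul_ne_zero (pow_ne_zero _ (inv_ne_zero hl)) (pow_ne_zero _ (inv_ne_zero hl))
  obtain ⟨hP0, hPd⟩ := Z.PP_deg s hl
  have hn0 : Algebra.norm (RatFunc k)[X] (AdjoinRoot.mk g (derivative g)) ≠ 0 := by
    rw [hnorm]; exact mul_ne_zero (C_ne_zero.2 hne) hP0
  have hg0 : AdjoinRoot.mk g (derivative g) ≠ 0 := by
    intro h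
    have h2 : AdjoinRoot.mk g (derivative g) = AdjoinRoot.mk g 0 := by rw [h, map_zero]
    rw [h2, norm_eq_resultant g 0 hm (d-1) (by simp), resultant_zero_right, hdeg] at hn0
    have := Z.hd
    apply hn0
    rw [zero_pow (by omega), zero_mul]
  have hdom : IsDomain (AdjoinRoot g) := AdjoinRoot.isDomain_of_prime Z.nG_prime
  have hfin := finrank_quotient_span_eq_natDegree_norm (F := RatFunc k) (AdjoinRoot.powerBasisAux' hm) hg0
  rw [hnorm, natDegree_C_mul hne, hPd] at hfin
  let Q := AdjoinRoot g ⧸ Ideal.span {AdjoinRoot.mk g (derivative g)}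
  let pr : (RatFunc k)[X][X] →ₐ[RatFunc k] Q := (Ideal.Quotient.mkₐ (RatFunc k) (Ideal.span {AdjoinRoot.mk g (derivative g)})).comp
    ((AdjoinRoot.mkₐ g).restrictScalars (RatFunc k))
  have hsurj : Function.Surjective pr := by
    intro z
    obtain ⟨z, rfl⟩ := Ideal.Quotient.mk_surjective z
    obtain ⟨z, rfl⟩ := AdjoinRoot.mk_surjective z
    exact ⟨z, rfl⟩
  have hprg : pr g = 0 := by
    change Ideal.Quotient.mk _ (AdjoinRoot.mk g g) = 0
    rw [AdjoinRoot.mk_self, map_zero]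
  have hprg' : pr (derivative g) = 0 := by
    change Ideal.Quotient.mk _ (AdjoinRoot.mk g (derivative g)) = 0
    exact Ideal.Quotient.eq_zero_iff_mem.2 (Ideal.mem_span_singleton_self _)
  have hu : IsUnit (C (C (Z.lam s)⁻¹) : (RatFunc k)[X][X]) := isUnit_C.2 (isUnit_C.2 (inv_ne_zero hl).isUnit)
  have hprG : pr (GG s Z.F) = 0 := by
    have hprg : pr (C (C (Z.lam s)⁻¹) * GG s Z.F) = 0 := hprg
    rw [map_mul] at hprg
    exact (hu.map pr).mul_right_eq_zero.1 hprg
  have hprG' : pr (derivative (GG s Z.F)) = 0 := by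
    have hprg' : pr (derivative (C (C (Z.lam s)⁻¹) * GG s Z.F)) = 0 := hprg'
    rw [derivative_C_mul, map_mul] at hprg'
    exact (hu.map pr).mul_right_eq_zero.1 hprg'
  have hCC : ∀ c : RatFunc k, pr (C (C c)) = algebraMap (RatFunc k) Q c := fun c => pr.commutes c
  have e : ∀ H : MvPolynomial (Fin 3) k, pr (GG s H) = MvPolynomial.aeval ![1, pr X, algebraMap (RatFunc k) Q s * pr X + pr (C X)] H := by
    intro H
    have h := MvPolynomial.comp_aeval_apply ![1, X, C (C s) * X + C X] (pr.restrictScalars k) H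
    rw [GG]
    refine h.trans ?_
    congr 2
    funext i; fin_cases i <;> simp [hCC]
  refine ⟨Q, inferInstance, inferInstance, inferInstance, inferInstance, pr X, pr (C X), hfin, ?_, ?_, ?_, ?_⟩
  · rw [eq_top_iff]
    rintro z -
    obtain ⟨p, rfl⟩ := hsurj z
    set S := Algebra.adjoin (RatFunc k) {pr X, algebraMap (RatFunc k) Q s * pr X + pr (C X)} with hS
    have hX : pr X ∈ S := Algebra.subset_adjoin (by simp)
    have hα : pr (C X) ∈ S := by
      have h1 : algebraMap (RatFunc k) Q s * pr X + pr (C X) ∈ S := Algebra.subset_adjoin (by simp)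
      have h2 := S.sub_mem h1 (S.mul_mem (S.algebraMap_mem s) hX)
      simpa using h2
    have hC : ∀ q : (RatFunc k)[X], pr (C q) ∈ S := by
      intro q
      induction q using Polynomial.induction_on' with
      | add p q hp hq => rw [map_add, map_add]; exact S.add_mem hp hq
      | monomial n c =>
        rw [← C_mul_X_pow_eq_monomial, C_mul, C_pow, map_mul, map_pow, hCC]
        exact S.mul_mem (S.algebraMap_mem c) (S.pow_mem hα n)
    induction p using Polynomial.induction_on' with
    | add p q hp hq => rw [map_add]; exact S.add_mem hp hq
    | monomial n c =>
      rw [← C_mul_X_pow_eq_monomial, map_mul, map_pow]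
      exact S.mul_mem (hC c) (S.pow_mem hX n)
  · rw [← e]; exact hprG
  · rw [← e, ← e, ← hCC, ← map_mul, ← map_add, ← GG_derivative]; exact hprG'
  · obtain ⟨p, q, -, -, hpq⟩ := exists_mul_add_mul_eq_C_resultant (GG s Z.F) (derivative (GG s Z.F)) (m := d) (n := d - 1)
      (GG_natDegree s Z.F d Z.hom) ((natDegree_derivative_le _).trans (Nat.sub_le_sub_right (GG_natDegree s Z.F d Z.hom) 1))
      (Or.inl (by have := Z.hd; omega))
    have h1 := congrArg pr hpq
    rw [map_add, map_mul, map_mul, hprG, hprG', zero_mul, zero_mul, add_zero] at h1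
    have h2 : ∀ P : (RatFunc k)[X], aeval (pr (C X)) P = pr (C P) := by
      intro P
      induction P using Polynomial.induction_on' with
      | add p q hp hq => rw [map_add, hp, hq, C_add, map_add]
      | monomial n c =>
        rw [← C_mul_X_pow_eq_monomial, C_mul, C_pow, map_mul, map_mul, map_pow, map_pow, hCC, aeval_C, aeval_X]
    rw [h2]; exact h1.symm

end Crv
end LineIrr

end

section
open Polynomial
open Polynomial

namespace LineIrr

noncomputable def dl {R A : Type*} [CommRing R] [CommRing A] [Algebra R A] (δ : Derivation R A A) (p : A[X]) : A[X] :=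
  ∑ i ∈ Finset.range (p.natDegree + 1), monomial i (δ (p.coeff i))

lemma D_aeval {R A B : Type*} [CommRing R] [CommRing A] [Algebra R A] [CommRing B] [Algebra R B] [Algebra A B] (δ : Derivation R A A)
    (D : Derivation R B B) (hD : ∀ a, D (algebraMap A B a) = algebraMap A B (δ a)) (p : A[X]) (α : B) :
    D (aeval α p) = aeval α (dl δ p) + aeval α (derivative p) * D α := by
  have h1 : aeval α (derivative p) = ∑ i ∈ Finset.range (p.natDegree + 1), algebraMap A B (p.coeff i) * i * α ^ (i-1) := by
    conv_lhs => rw [p.as_sum_range_C_mul_X_pow]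
    simp [map_sum, derivative_mul, derivative_X_pow, mul_assoc]
  rw [h1, aeval_eq_sum_range, map_sum, dl, map_sum, Finset.sum_mul, ← Finset.sum_add_distrib]
  refine Finset.sum_congr rfl fun i _ => ?_
  rw [Algebra.smul_def, D.leibniz, hD, D.leibniz_pow, aeval_monomial]
  simp only [smul_eq_mul, nsmul_eq_mul]
  ring

lemma exists_dX (k : Type) [Field k] : ∃ δ : Derivation k (RatFunc k) (RatFunc k), δ RatFunc.X = 1 := by
  have : Algebra.FormallyEtale k[X] (RatFunc k) := Algebra.FormallyEtale.of_isLocalization (nonZeroDivisors k[X])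
  obtain ⟨D, hD⟩ := exists_deriv ((Algebra.linearMap k[X] (RatFunc k)).compDer (derivative' (R := k)))
  refine ⟨D, ?_⟩
  have := hD X
  simpa [RatFunc.algebraMap_X] using this

lemma sep_of_finrank {K' Q : Type*} [Field K'] [Field Q] [Algebra K' Q] [FiniteDimensional K' Q] (h : (Module.finrank K' Q : K') ≠ 0) :
    Algebra.IsSeparable K' Q := by
  obtain ⟨p, hp⟩ := ExpChar.exists K'
  rw [isSeparable_iff_finInsepDegree_eq_one]
  obtain ⟨n, hn⟩ := finInsepDegree_eq_pow K' Q p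
  rw [← Field.finSepDegree_mul_finInsepDegree, hn] at h
  rw [hn]
  cases hp with
  | zero => simp
  | prime hq =>
    rcases Nat.eq_zero_or_pos n with rfl | h0
    · simp
    · exfalso; apply h
      simp [h0.ne']

namespace Crv
variable {k : Type} [Field k] [IsAlgClosed k] {d : ℕ} (Z : Crv k d)

set_option maxHeartbeats 1000000 in
theorem main_mu (δ : Derivation k (RatFunc k) (RatFunc k)) (hδ : δ RatFunc.X = 1) :
    ∃ μ : (RatFunc k)[X], μ.Monic ∧ Irreducible μ ∧ μ.Separable ∧ (∃ c, c ≠ 0 ∧ Z.PP (RatFunc.X : RatFunc k) = C c * μ) ∧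
      ∀ R : (RatFunc k)[X], μ ∣ R * derivative μ - dl δ μ → ∀ h : MvPolynomial (Fin 2) k,
        μ ∣ MvPolynomial.aeval ![R, C RatFunc.X * R + X] h ↔ aff Z.F ∣ h := by
  obtain ⟨Q, _, _, _, _, t, α, hfin, htop, h0, h1, hP⟩ := Z.exists_Q
  set x := algebraMap (RatFunc k) Q RatFunc.X * t + α with hx
  have hpos : 0 < d * (d - 1) := by
    have := Z.hd
    exact Nat.mul_pos (by omega) (by omega)
  have hnt : Nontrivial Q := Module.nontrivial_of_finrank_pos (R := RatFunc k) (by omega)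
  have hF : IsField Q := Z.isField t x h0 h1 htop
  obtain ⟨hu2, -⟩ := Z.unit_FX t x h0 h1
  have hun := Z.unit_of_not_dvd t x h0 h1
  letI : Field Q := hF.toField
  have hfd : FiniteDimensional (RatFunc k) Q := Module.finite_of_finrank_pos (by omega)
  have hsep : Algebra.IsSeparable (RatFunc k) Q := by
    apply sep_of_finrank
    rw [hfin]
    have := (map_ne_zero_iff (algebraMap k (RatFunc k)) (algebraMap k (RatFunc k)).injective).2 Z.hc
    rwa [map_natCast] at this
  have hfe : Algebra.FormallyEtale (RatFunc k) Q := Algebra.FormallyEtale.of_isSeparable _ _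
  obtain ⟨D, hD⟩ := exists_deriv ((Algebra.linearMap (RatFunc k) Q).compDer δ)
  replace hD : ∀ a, D (algebraMap (RatFunc k) Q a) = algebraMap (RatFunc k) Q (δ a) := fun a => by rw [hD]; rfl
  have hDα : D α = - t := by
    have h2 := deriv_aeval D ![1, t, x] Z.F
    rw [h0, map_zero] at h2
    simp [Fin.sum_univ_three] at h2
    have hDx : D x = t + algebraMap (RatFunc k) Q RatFunc.X * D t + D α := by
      rw [hx, map_add, D.leibniz, hD, hδ]; simp; ring
    rw [hDx] at h2
    have h3 : MvPolynomial.aeval ![1, t, x] (MvPolynomial.pderiv 2 Z.F) * (t + D α) = 0 := by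
      linear_combination - h2 - D t * h1
    have h4 := (mul_eq_zero.1 h3).resolve_left hu2.ne_zero
    linear_combination h4
  set μ := minpoly (RatFunc k) α with hμ
  have h_integral : IsIntegral (RatFunc k) α := IsIntegral.of_finite _ _
  have hirr : Irreducible μ := minpoly.irreducible h_integral
  have hmon : μ.Monic := minpoly.monic h_integral
  have hms : μ.Separable := Algebra.IsSeparable.isSeparable (RatFunc k) α
  have hμα : aeval α μ = 0 := minpoly.aeval _ _
  have hμ' : aeval α (derivative μ) ≠ 0 := hms.aeval_derivative_ne_zero hμα
  have ht : aeval α (dl δ μ) = aeval α (derivative μ) * t := by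
    have h2 := D_aeval δ D hD μ α
    rw [hμα, map_zero, hDα] at h2
    linear_combination - h2
  have hgen : IntermediateField.adjoin (RatFunc k) {α} = ⊤ := by
    set I := IntermediateField.adjoin (RatFunc k) {α}
    have hα : α ∈ I := IntermediateField.mem_adjoin_simple_self _ _
    have hpol : ∀ p : (RatFunc k)[X], aeval α p ∈ I := fun p => by
      have := (aeval (⟨α, hα⟩ : I) p).2
      rwa [show ((aeval (⟨α, hα⟩ : I) p : I) : Q) = aeval α p from (aeval_algebraMap_apply Q (⟨α, hα⟩ : I) p).symm] at this
    have htI : t ∈ I := by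
      have : t = aeval α (dl δ μ) / aeval α (derivative μ) := by rw [ht]; field_simp
      rw [this]; exact I.div_mem (hpol _) (hpol _)
    have hxI : x ∈ I := I.add_mem (I.mul_mem (I.algebraMap_mem _) htI) hα
    rw [eq_top_iff]
    rintro z -
    have hz : z ∈ Algebra.adjoin (RatFunc k) {t, x} := by rw [htop]; trivial
    have hle : Algebra.adjoin (RatFunc k) {t, x} ≤ I.toSubalgebra := by
      rw [Algebra.adjoin_le_iff]
      rintro y (rfl | rfl)
      · exact htI
      · exact hxI
    exact hle hz
  have hdeg : μ.natDegree = d * (d - 1) := by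
    rw [← hfin, ← IntermediateField.adjoin.finrank h_integral, hgen, IntermediateField.finrank_top']
  refine ⟨μ, hmon, hirr, hms, ?_, ?_⟩
  · obtain ⟨w, hw⟩ := minpoly.dvd _ _ hP
    obtain ⟨hP0, hPd⟩ := Z.PP_deg _ Z.lamX_ne
    have hw0 : w ≠ 0 := by rintro rfl; rw [mul_zero] at hw; exact hP0 hw
    have h2 := congrArg natDegree hw
    rw [natDegree_mul hmon.ne_zero hw0, hPd, hdeg] at h2
    have h3 : w.natDegree = 0 := by omega
    rw [eq_C_of_natDegree_eq_zero h3] at hw hw0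
    exact ⟨w.coeff 0, fun h => hw0 (by rw [h]; simp), by rw [hw]; ring⟩
  · intro R hR h
    have hRt : aeval α R = t := by
      have h2 : aeval α (R * derivative μ - dl δ μ) = 0 := by
        obtain ⟨w, hw⟩ := hR
        rw [hw, map_mul, hμα, zero_mul]
      rw [map_sub, map_mul, ht] at h2
      have h3 : (aeval α R - t) * aeval α (derivative μ) = 0 := by linear_combination h2
      exact sub_eq_zero.1 ((mul_eq_zero.1 h3).resolve_right hμ')
    have h2 : aeval α (MvPolynomial.aeval ![R, C RatFunc.X * R + X] h) = MvPolynomial.aeval ![t, x] h := by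
      have h3 := MvPolynomial.comp_aeval_apply ![R, C RatFunc.X * R + X] ((aeval α : (RatFunc k)[X] →ₐ[RatFunc k] Q).restrictScalars k) h
      refine h3.trans ?_
      congr 2; funext i; fin_cases i
      · exact hRt
      · simp [hRt, hx]
    rw [minpoly.dvd_iff, h2]
    constructor
    · intro h3
      by_contra hcon
      exact (hun h hcon).ne_zero h3
    · rintro ⟨w, rfl⟩
      rw [map_mul, aeval_aff]
      have : ![1, ![t, x] 0, ![t, x] 1] = ![1, t, x] := by simp
      rw [this, h0, zero_mul]

end Crv

/-- all discriminants together are separable -/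
theorem prod_PP_sep {k : Type} [Field k] [IsAlgClosed k] {r : ℕ} {d : Fin r → ℕ} (Z : ∀ i, Crv k (d i))
    (hZ : ∀ i j, i ≠ j → ¬ aff (Z i).F ∣ aff (Z j).F) :
    (∏ i, (Z i).PP (RatFunc.X : RatFunc k)).Separable := by
  obtain ⟨δ, hδ⟩ := exists_dX k
  choose μ hm hi hs hc hR using fun i => (Z i).main_mu δ hδ
  choose c hc0 hc using hc
  apply separable_prod'
  · intro i _ j _ hij
    rw [hc, hc, isCoprime_mul_unit_left_left (isUnit_C.2 (hc0 i).isUnit), isCoprime_mul_unit_left_right (isUnit_C.2 (hc0 j).isUnit)]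
    rw [(hi i).coprime_iff_not_dvd]
    intro hdvd
    have heq : μ i = μ j := eq_of_monic_of_associated (hm i) (hm j) ((hi i).associated_of_dvd (hi j) hdvd)
    obtain ⟨a, b, hab⟩ := hs i
    have hR' : μ i ∣ (b * dl δ (μ i)) * derivative (μ i) - dl δ (μ i) := ⟨- a * dl δ (μ i), by linear_combination (dl δ (μ i)) * hab⟩
    have h1 := hR i _ hR' (aff (Z i).F)
    have h2 := hR j (b * dl δ (μ i)) (by rw [← heq]; exact hR') (aff (Z i).F)
    rw [← heq] at h2
    exact hZ j i hij.symm (h2.1 (h1.2 dvd_rfl))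
  · intro i _
    rw [hc]
    exact (hs i).unit_mul (isUnit_C.2 (hc0 i).isUnit)

end LineIrr

end

section
open Polynomial
open Polynomial

namespace LineIrr

lemma det_sq {k ι : Type*} [Field k] [Fintype ι] [DecidableEq ι] (M : Matrix ι ι k[X]) (a0 : k)
    (h : ∀ s, ∃ v : ι → k, v ≠ 0 ∧ v s = 0 ∧ (M.map (evalRingHom a0)).mulVec v = 0) (hne : Nonempty ι) :
    (X - C a0) ^ 2 ∣ M.det := by
  set M0 := M.map (evalRingHom a0) with hM0
  have hadj : M0.adjugate = 0 := by
    ext s j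
    obtain ⟨v, hv, hvs, hMv⟩ := h s
    rw [Matrix.adjugate_apply, Matrix.zero_apply]
    refine Matrix.exists_mulVec_eq_zero_iff.1 ⟨v, hv, ?_⟩
    ext i
    by_cases hij : i = j
    · subst hij
      simp [Matrix.mulVec, Matrix.updateRow_self, hvs]
    · have := congrFun hMv i
      simp only [Matrix.mulVec, Matrix.updateRow_ne hij] at this ⊢
      exact this
  have hdvd : ∀ i j, (X - C a0) ∣ M.adjugate i j := by
    intro i j
    rw [dvd_iff_isRoot, IsRoot.def]
    have := congrFun (congrFun hadj i) j
    rw [hM0, ← RingHom.mapMatrix_apply, ← RingHom.map_adjugate] at this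
    simpa using this
  choose B hB using hdvd
  have hB' : M.adjugate = (X - C a0) • (Matrix.of B) := by
    ext1 i j; rw [hB]; rfl
  obtain ⟨s⟩ := hne
  obtain ⟨v, hv, hvs, hMv⟩ := h s
  have hd0 : M0.det = 0 := Matrix.exists_mulVec_eq_zero_iff.1 ⟨v, hv, hMv⟩
  have hd1 : (X - C a0) ∣ M.det := by
    rw [dvd_iff_isRoot, IsRoot.def]
    rw [hM0, ← RingHom.mapMatrix_apply, ← RingHom.map_det] at hd0
    exact hd0
  obtain ⟨e, he⟩ := hd1
  have hMB : M * Matrix.of B = e • (1 : Matrix ι ι k[X]) := by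
    have h1 := M.mul_adjugate
    rw [hB', he, Matrix.mul_smul, mul_smul] at h1
    exact smul_right_injective _ (X_sub_C_ne_zero a0) h1
  have h2 := congrArg (fun N : Matrix ι ι k[X] => eval a0 N.det) hMB
  simp only [Matrix.det_mul, eval_mul, Matrix.det_smul, Matrix.det_one, mul_one, eval_pow] at h2
  rw [show eval a0 M.det = 0 by rw [he]; simp, zero_mul] at h2
  have h3 : eval a0 e = 0 := by
    by_contra hc
    exact pow_ne_zero _ hc h2.symm
  obtain ⟨w, hw⟩ := dvd_iff_isRoot.2 h3
  exact ⟨w, by rw [he, hw]; ring⟩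

lemma res_sq {k : Type*} [Field k] (f g : k[X][X]) (m n : ℕ) (hf : f.natDegree ≤ m) (hg : g.natDegree ≤ n) (a0 : k) (h a b : k[X])
    (hfa : f.map (evalRingHom a0) = h * a) (hgb : g.map (evalRingHom a0) = h * b) (ha : a ≠ 0) (hh : h.natDegree = 2) (hmn : 0 < m + n) :
    (X - C a0) ^ 2 ∣ resultant f g m n := by
  set f0 := f.map (evalRingHom a0) with hf0
  set g0 := g.map (evalRingHom a0) with hg0
  have hh0 : h ≠ 0 := by rintro rfl; simp at hh
  have hf0d : f0.natDegree ≤ m := natDegree_map_le.trans hf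
  have hg0d : g0.natDegree ≤ n := natDegree_map_le.trans hg
  have had : a.natDegree + 2 ≤ m := by
    rw [hfa, natDegree_mul hh0 ha, hh] at hf0d; omega
  have hmem : ∀ l : k[X], l.natDegree ≤ 1 → a * l ∈ degreeLT k m ∧ - (b * l) ∈ degreeLT k n := by
    intro l hl
    constructor
    · rw [mem_degreeLT]
      refine lt_of_le_of_lt degree_le_natDegree ?_
      exact_mod_cast lt_of_le_of_lt (natDegree_mul_le) (by omega)
    · refine Submodule.neg_mem _ ?_
      by_cases hb : b = 0
      · rw [hb, zero_mul]; exact Submodule.zero_mem _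
      rw [hgb, natDegree_mul hh0 hb, hh] at hg0d
      rw [mem_degreeLT]
      refine lt_of_le_of_lt degree_le_natDegree ?_
      exact_mod_cast lt_of_le_of_lt (natDegree_mul_le) (by omega)
  set b1 := ((degreeLT.basis k m).prod (degreeLT.basis k n)).reindex finSumFinEquiv with hb1
  set b2 := degreeLT.basis k (m + n)
  have hM := toMatrix_sylvesterMap' f0 g0 hf0d hg0d
  have hMM : (sylvester f g m n).map (evalRingHom a0) = sylvester f0 g0 m n := (sylvester_map_map f g m n _).symm
  let vec : ∀ l : k[X], l.natDegree ≤ 1 → degreeLT k m × degreeLT k n := fun l hl => (⟨a * l, (hmem l hl).1⟩, ⟨-(b * l), (hmem l hl).2⟩)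
  have hker : ∀ l hl, sylvesterMap f0 g0 hf0d hg0d (vec l hl) = 0 := by
    intro l hl
    apply Subtype.ext
    rw [sylvesterMap_apply_coe, hfa, hgb]
    change h * a * (-(b * l)) + h * b * (a * l) = 0
    ring
  have hnz : ∀ l hl, l ≠ 0 → vec l hl ≠ 0 := by
    intro l hl h0 hv
    have := congrArg (fun z => (z.1 : k[X])) hv
    change a * l = 0 at this
    exact mul_ne_zero ha h0 this
  have : resultant f g m n = (sylvester f g m n).det := rfl
  rw [this]
  refine det_sq _ a0 ?_ ⟨⟨0, hmn⟩⟩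
  intro s
  have key : ∃ l : k[X], ∃ hl : l.natDegree ≤ 1, l ≠ 0 ∧ b1.repr (vec l hl) s = 0 := by
    set e1 := b1.repr (vec 1 (by simp)) s with he1
    set e2 := b1.repr (vec X (by simp)) s with he2
    by_cases h0 : e2 = 0
    · exact ⟨X, by simp, X_ne_zero, h0⟩
    · have hlin : vec (C e1 * X - C e2) (by compute_degree) = e1 • vec X (by simp) - e2 • vec 1 (by simp) := by
        refine Prod.ext (Subtype.ext ?_) (Subtype.ext ?_)
        · change a * (C e1 * X - C e2) = e1 • (a * X) - e2 • (a * 1)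
          simp only [smul_eq_C_mul]; ring
        · change -(b * (C e1 * X - C e2)) = e1 • (-(b * X)) - e2 • (-(b * 1))
          simp only [smul_eq_C_mul]; ring
      refine ⟨C e1 * X - C e2, by compute_degree, ?_, ?_⟩
      · intro h1
        have := congrArg (fun p => coeff p 0) h1
        simp at this; exact h0 this
      · rw [hlin]
        simp only [map_sub, map_smul, Finsupp.sub_apply, Finsupp.smul_apply, smul_eq_mul, ← he1, ← he2]
        ring
  obtain ⟨l, hl, hl0, hs⟩ := key
  refine ⟨b1.repr (vec l hl), ?_, hs, ?_⟩
  · intro h1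
    apply hnz l hl hl0
    apply b1.repr.injective
    rw [map_zero]; exact DFunLike.coe_injective h1
  · rw [hMM, ← hM, LinearMap.toMatrix_mulVec_repr, hker l hl]; simp

lemma res_root {k : Type*} [Field k] (f g : k[X][X]) (m n : ℕ) (hf : f.natDegree ≤ m) (hg : g.natDegree ≤ n) (a0 u : k)
   (hfa : f.evalEval a0 u = 0) (hgb : g.evalEval a0 u = 0) (hmn : m ≠ 0) :
    (X - C a0) ∣ resultant f g m n := by
  obtain ⟨p, q, -, -, h⟩ := exists_mul_add_mul_eq_C_resultant f g hf hg (Or.inl hmn)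
  have := congrArg (evalEval a0 u) h
  rw [evalEval_add, evalEval_mul, evalEval_mul, hfa, hgb, evalEval_C] at this
  rw [dvd_iff_isRoot, IsRoot.def, ← this]; ring

lemma two_coll {k : Type*} [Field k] {n : ℕ} (v : Fin n → k) (j j' l l' : Fin n) (hjj : j ≠ j') (hll : l ≠ l') (h1 : j ≠ l) (h2 : j ≠ l')
    (e1 : v j = v j') (e2 : v l = v l') :
    ∃ h : k[X], h.natDegree = 2 ∧ h ∣ ∏ i, (X - C (v i)) ∧ h ∣ derivative (∏ i, (X - C (v i))) := by
  set G := ∏ i, (X - C (v i)) with hG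
  have hsub : ∀ S : Finset (Fin n), ∏ i ∈ S, (X - C (v i)) ∣ G := fun S => Finset.prod_dvd_prod_of_subset _ _ _ (Finset.subset_univ _)
  have hj := hsub {j, j'}
  have hl := hsub {l, l'}
  rw [Finset.prod_pair hjj, ← e1] at hj
  rw [Finset.prod_pair hll, ← e2] at hl
  have hd : ∀ u, (X - C u) * (X - C u) ∣ G → (X - C u) ∣ derivative G := by
    rintro u ⟨w, hw⟩
    rw [hw]; simp only [derivative_mul, derivative_sub, derivative_X, derivative_C]
    exact ⟨2 * w + (X - C u) * derivative w, by ring⟩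
  by_cases hvv : v j = v l
  · have h3 := hsub {j, l, l'}
    rw [Finset.prod_insert (by simp [h1, h2]), Finset.prod_pair hll, ← e2, hvv] at h3
    refine ⟨(X - C (v l)) ^ 2, by simp, ?_, ?_⟩
    · rw [pow_two]; exact hl
    · obtain ⟨w, hw⟩ := h3
      rw [hw]; simp only [derivative_mul, derivative_sub, derivative_X, derivative_C]
      exact ⟨3 * w + (X - C (v l)) * derivative w, by ring⟩
  · have hcop : IsCoprime (X - C (v j)) (X - C (v l)) := isCoprime_X_sub_C_of_isUnit_sub (sub_ne_zero.2 hvv).isUnit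
    refine ⟨(X - C (v j)) * (X - C (v l)), ?_, hcop.mul_dvd ((dvd_mul_right _ _).trans hj) ((dvd_mul_right _ _).trans hl), hcop.mul_dvd (hd _ hj) (hd _ hl)⟩
    rw [natDegree_mul (X_sub_C_ne_zero _) (X_sub_C_ne_zero _), natDegree_X_sub_C, natDegree_X_sub_C]

lemma one_coll {k : Type*} [Field k] {n : ℕ} (v : Fin n → k) (j j' : Fin n) (hjj : j ≠ j') 
    (e1 : v j = v j') : eval (v j) (∏ i, (X - C (v i))) = 0 ∧ eval (v j) (derivative (∏ i, (X - C (v i)))) = 0 := by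
  set G := ∏ i, (X - C (v i)) with hG
  have hj : ∏ i ∈ {j, j'}, (X - C (v i)) ∣ G := Finset.prod_dvd_prod_of_subset _ _ _ (Finset.subset_univ _)
  rw [Finset.prod_pair hjj, ← e1] at hj
  obtain ⟨w, hw⟩ := hj
  rw [hw]
  simp [derivative_mul]

end LineIrr

end

section
open Polynomial
open Polynomial

namespace LineIrr

lemma res_map_ne {A E : Type*} [CommRing A] [Field E] (ι : A →+* E) (P : A[X]) (n : ℕ)
    (hn : (P.map ι).natDegree = n) (hs : (P.map ι).Separable) : resultant P (derivative P) n (n - 1) ≠ 0 := by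
  intro h0
  have h1 := resultant_map_map P (derivative P) n (n - 1) ι
  rw [h0, map_zero, ← derivative_map] at h1
  set P' := P.map ι
  have hd : (derivative P').natDegree ≤ n - 1 := by rw [← hn]; exact natDegree_derivative_le _
  obtain ⟨e, he⟩ := Nat.exists_eq_add_of_le hd
  rw [he, resultant_add_right_deg _ _ _ _ _ le_rfl, ← hn] at h1
  rcases mul_eq_zero.1 h1 with h | h
  · skip
    have h3 : P'.coeff P'.natDegree = 0 := eq_zero_of_pow_eq_zero h
    exact hs.ne_zero (leadingCoeff_eq_zero.1 h3)
  · exact resultant_ne_zero _ _ hs h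

lemma not_sq_dvd {A k : Type*} [CommRing A] [Field k] (φ : A →+* k) (P : A[X]) (n : ℕ) (hn : n ≠ 0) (hP : P.natDegree ≤ n)
    (h : φ (resultant P (derivative P) n (n - 1)) ≠ 0) (a0 : k) : ¬ (X - C a0) ^ 2 ∣ P.map φ := by
  rintro ⟨w, hw⟩
  obtain ⟨p, q, -, -, h1⟩ := exists_mul_add_mul_eq_C_resultant P (derivative P) hP
    ((natDegree_derivative_le P).trans (Nat.sub_le_sub_right hP 1)) (Or.inl hn)
  have h2 := congrArg (fun R => eval a0 (map φ R)) h1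
  simp only [Polynomial.map_add, Polynomial.map_mul, ← derivative_map, hw, map_C, eval_C] at h2
  apply h
  rw [← h2]
  simp [derivative_mul, derivative_pow]

section
variable {k : Type} [Field k] [IsAlgClosed k] {r : ℕ} {d : Fin r → ℕ} (Z : ∀ i, Crv k (d i))

/-- product of discriminants -/
noncomputable def PPP : k[X][X] := ∏ i, (Z i).PP (X : k[X])

noncomputable def rho0 : k[X] := resultant (PPP Z) (derivative (PPP Z)) (∑ i, d i * (d i - 1)) ((∑ i, d i * (d i - 1)) - 1)

lemma PPP_map {B : Type*} [CommRing B] [Algebra k B] (φ : k[X] →ₐ[k] B) : (PPP Z).map φ.toRingHom = ∏ i, (Z i).PP (φ X) := by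
  rw [PPP, Polynomial.map_prod]
  exact Finset.prod_congr rfl fun i _ => (Z i).PP_map φ X

lemma PPP_RF : (PPP Z).map (algebraMap k[X] (RatFunc k)) = ∏ i, (Z i).PP (RatFunc.X : RatFunc k) := by
  have h := PPP_map Z (IsScalarTower.toAlgHom k k[X] (RatFunc k))
  simp only [IsScalarTower.coe_toAlgHom', RatFunc.algebraMap_X] at h
  exact h

lemma PPP_RF_deg : ((PPP Z).map (algebraMap k[X] (RatFunc k))).natDegree = ∑ i, d i * (d i - 1) := by
  rw [PPP_RF, natDegree_prod _ _ fun i _ => ((Z i).PP_deg _ (Z i).lamX_ne).1]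
  exact Finset.sum_congr rfl fun i _ => ((Z i).PP_deg _ (Z i).lamX_ne).2

lemma PPP_deg : (PPP Z).natDegree = ∑ i, d i * (d i - 1) := by
  rw [← PPP_RF_deg Z, natDegree_map_eq_of_injective (RatFunc.algebraMap_injective k)]

lemma rho0_ne (hZ : ∀ i j, i ≠ j → ¬ aff (Z i).F ∣ aff (Z j).F) : rho0 Z ≠ 0 :=
  res_map_ne (algebraMap k[X] (RatFunc k)) _ _ (PPP_RF_deg Z) (by rw [PPP_RF]; exact prod_PP_sep Z hZ)

lemma prod_not_sq (i0 : Fin r) (c : k) (hc : (rho0 Z).eval c ≠ 0) (a0 : k) : ¬ (X - C a0) ^ 2 ∣ ∏ i, (Z i).PP c := by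
  have h := PPP_map Z (aeval c : k[X] →ₐ[k] k)
  rw [aeval_X] at h
  rw [← h]
  refine not_sq_dvd _ _ (∑ i, d i * (d i - 1)) ?_ (PPP_deg Z).le ?_ a0
  · have h1 : d i0 * (d i0 - 1) ≤ ∑ i, d i * (d i - 1) :=
      Finset.single_le_sum (f := fun i => d i * (d i - 1)) (fun _ _ => Nat.zero_le _) (Finset.mem_univ i0)
    have h2 := (Z i0).hd
    have h3 : 0 < d i0 * (d i0 - 1) := Nat.mul_pos (by omega) (by omega)
    omega
  · exact hc

lemma GG_eq {d : ℕ} (Z : Crv k d) (c : k) (hc : Z.lam c ≠ 0) : GG c Z.F = C (C (Z.lam c)) * Z.nG c := by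
  rw [Crv.nG, ← mul_assoc, ← C_mul, ← C_mul, mul_inv_cancel₀ hc]; simp

lemma mk_fam (c : k) (hl : ∀ i, (Z i).lam c ≠ 0) (hc : (rho0 Z).eval c ≠ 0) : ∃ Fm : Fam k r d, ∀ i, Fm.g i = (Z i).nG c := by
  refine ⟨{ g := fun i => (Z i).nG c, monic := fun i => (Z i).nG_monic c (hl i), deg := fun i => (Z i).nG_natDegree c (hl i),
            low := fun i j => (Z i).nG_low c j, sep := fun i => (Z i).nG_sep c (hl i),
            smooth := fun i u a0 h0 h1 => (Z i).nG_smooth c (hl i) u a0 h0 h1, coll := ?_}, fun i => rfl⟩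
  intro a0 v hv i j j' i' l l' hjj hll e1 e2
  have hroot : ∀ i (j j' : Fin (d i)), j ≠ j' → v ⟨i, j⟩ = v ⟨i, j'⟩ → (X - C a0) ∣ (Z i).PP c := by
    intro i j j' hjj e
    obtain ⟨h1, h2⟩ := one_coll (fun j => v ⟨i, j⟩) j j' hjj e
    rw [← hv i] at h1 h2
    have hd := (Z i).hd
    refine res_root _ _ _ _ (GG_natDegree c (Z i).F (d i) (Z i).hom) ((natDegree_derivative_le _).trans
      (Nat.sub_le_sub_right (GG_natDegree c (Z i).F (d i) (Z i).hom) 1)) a0 (v ⟨i, j⟩) ?_ ?_ (by omega)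
    · rw [GG_eq _ _ (hl i), evalEval_mul, ← map_evalRingHom_eval _ _ ((Z i).nG c)]
      simp only [h1, mul_zero]
    · rw [GG_eq _ _ (hl i), derivative_C_mul, evalEval_mul]
      rw [derivative_map, map_evalRingHom_eval] at h2
      simp only [h2, mul_zero]
  by_cases hii : i = i'
  · subst hii
    refine ⟨rfl, ?_⟩
    by_contra hcon
    push Not at hcon
    have hcon1 : j ≠ l := fun h => hcon.1 (by rw [h])
    have hcon2 : j ≠ l' := fun h => hcon.2 (by rw [h])
    obtain ⟨h, hh, ⟨a, ha⟩, ⟨b, hb⟩⟩ := two_coll (fun j => v ⟨i, j⟩) j j' l l' hjj hll hcon1 hcon2 e1 e2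
    rw [← hv i] at ha hb
    have hd := (Z i).hd
    have hsq : (X - C a0) ^ 2 ∣ (Z i).PP c := by
      refine res_sq _ _ _ _ (GG_natDegree c (Z i).F (d i) (Z i).hom) ((natDegree_derivative_le _).trans
        (Nat.sub_le_sub_right (GG_natDegree c (Z i).F (d i) (Z i).hom) 1)) a0 h (C ((Z i).lam c) * a) (C ((Z i).lam c) * b) ?_ ?_ ?_ hh (by omega)
      · rw [GG_eq _ _ (hl i), Polynomial.map_mul, ha]; simp; ring
      · rw [GG_eq _ _ (hl i), derivative_C_mul, Polynomial.map_mul, ← derivative_map, hb]; simp; ring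
      · refine mul_ne_zero (C_ne_zero.2 (hl i)) ?_
        rintro rfl
        rw [mul_zero] at ha
        exact ((Z i).nG_monic c (hl i)).map (evalRingHom a0) |>.ne_zero ha
    exact prod_not_sq Z i c hc a0 (hsq.trans (Finset.dvd_prod_of_mem (fun i => (Z i).PP c) (Finset.mem_univ i)))
  · exfalso
    have h1 := hroot i j j' hjj e1
    have h2 := hroot i' l l' hll e2
    apply prod_not_sq Z i c hc a0
    have h3 : ∏ x ∈ {i, i'}, (Z x).PP c ∣ ∏ i, (Z i).PP c := Finset.prod_dvd_prod_of_subset _ _ _ (Finset.subset_univ _)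
    rw [Finset.prod_pair hii] at h3
    rw [pow_two]
    exact (mul_dvd_mul h1 h2).trans h3

end
end LineIrr

end

section
open Polynomial
open Polynomial

namespace LineIrr

/-- multiplicative filtrations -/
structure Filt (R : Type*) [CommRing R] where
  S : ℕ → AddSubgroup R
  mono : ∀ {i j x}, i ≤ j → x ∈ S i → x ∈ S j
  one : 1 ∈ S 0
  mul : ∀ {i j x y}, x ∈ S i → y ∈ S j → x * y ∈ S (i + j)

namespace Filt
variable {R : Type*} [CommRing R] (Φ : Filt R)

lemma prod {ι : Type*} (s : Finset ι) (f : ι → R) (e : ι → ℕ) (h : ∀ i ∈ s, f i ∈ Φ.S (e i)) : ∏ i ∈ s, f i ∈ Φ.S (∑ i ∈ s, e i) := by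
  classical
  induction s using Finset.induction_on with
  | empty => simpa using Φ.one
  | insert a s ha ih =>
    rw [Finset.prod_insert ha, Finset.sum_insert ha]
    exact Φ.mul (h a (by simp)) (ih fun i hi => h i (by simp [hi]))

lemma det {ι : Type*} [Fintype ι] [DecidableEq ι] (M : Matrix ι ι R) (e : ℕ) (h : ∀ i j, M i j ∈ Φ.S e) :
    M.det ∈ Φ.S (Fintype.card ι * e) := by
  rw [Matrix.det_apply]
  refine AddSubgroup.sum_mem _ fun σ _ => ?_
  rw [Units.smul_def]
  refine AddSubgroup.zsmul_mem _ ?_ _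
  have := Φ.prod Finset.univ (fun i => M (σ i) i) (fun _ => e) (fun i _ => h _ _)
  simpa using this

/-- coefficientwise -/
def poly : Filt R[X] where
  S n := { carrier := {p | ∀ j, p.coeff j ∈ Φ.S n}
           zero_mem' := fun j => by simp
           add_mem' := fun ha hb j => by rw [coeff_add]; exact add_mem (ha j) (hb j)
           neg_mem' := fun ha j => by rw [coeff_neg]; exact neg_mem (ha j) }
  mono := fun h hx j => Φ.mono h (hx j)
  one := fun j => by
    rw [coeff_one]; split_ifs
    · exact Φ.one
    · exact zero_mem _
  mul := fun {i j x y} hx hy l => by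
    rw [coeff_mul]
    exact sum_mem fun z _ => Φ.mul (hx _) (hy _)

lemma mem_poly {n : ℕ} {p : R[X]} : p ∈ Φ.poly.S n ↔ ∀ j, p.coeff j ∈ Φ.S n := Iff.rfl

lemma deriv {n : ℕ} {p : R[X]} (h : p ∈ Φ.poly.S n) : derivative p ∈ Φ.poly.S n := by
  intro j
  rw [coeff_derivative]
  have := nsmul_mem (h (j + 1)) (j + 1)
  rw [nsmul_eq_mul, mul_comm] at this
  exact_mod_cast this

lemma res {e : ℕ} {f g : R[X]} (hf : f ∈ Φ.poly.S e) (hg : g ∈ Φ.poly.S e) (m n : ℕ) : resultant f g m n ∈ Φ.S ((m + n) * e) := by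
  have := Φ.det (sylvester f g m n) e ?_
  · rw [Fintype.card_fin] at this; exact this
  · intro i j
    rw [sylvester, Matrix.of_apply]
    refine Fin.addCases (fun j => ?_) (fun j => ?_) j
    · rw [Fin.addCases_left]; split_ifs
      · exact hg _
      · exact zero_mem _
    · rw [Fin.addCases_right]; split_ifs
      · exact hf _
      · exact zero_mem _

lemma C_mem {n : ℕ} {x : R} (h : x ∈ Φ.S n) : C x ∈ Φ.poly.S n := by
  intro j
  rw [coeff_C]; split_ifs
  · exact h
  · exact zero_mem _

lemma X_mem : X ∈ Φ.poly.S 0 := by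
  intro j
  rw [coeff_X]; split_ifs
  · exact Φ.one
  · exact zero_mem _

lemma aeval {k : Type*} [Field k] [Algebra k R] (hk : ∀ c : k, algebraMap k R c ∈ Φ.S 0) {d : ℕ} {F : MvPolynomial (Fin 3) k}
    (hF : F.IsHomogeneous d) (v : Fin 3 → R) (hv : ∀ i, v i ∈ Φ.S 1) : MvPolynomial.aeval v F ∈ Φ.S d := by
  rw [MvPolynomial.aeval_def, MvPolynomial.eval₂_eq']
  refine sum_mem fun m hm => ?_
  have := hF (MvPolynomial.mem_support_iff.1 hm)
  rw [Finsupp.weight_apply, Finsupp.sum_fintype _ _ (by simp)] at this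
  simp only [Pi.one_apply, smul_eq_mul, mul_one] at this
  rw [← zero_add d, ← this]
  refine Φ.mul (hk _) (Φ.prod _ _ _ fun i _ => ?_)
  have := Φ.prod (Finset.range (m i)) (fun _ => v i) (fun _ => 1) (fun _ _ => hv i)
  simpa using this

/-- the degree filtration -/
noncomputable def base (k : Type*) [Field k] : Filt k[X] where
  S n := { carrier := {p | p.natDegree ≤ n}
           zero_mem' := by simp
           add_mem' := fun ha hb => natDegree_add_le_of_degree_le ha hb
           neg_mem' := fun {x} ha => by
            change (-x).natDegree ≤ n
            rw [natDegree_neg]; exact ha }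
  mono := fun h hx => le_trans hx h
  one := by change (1 : k[X]).natDegree ≤ 0; simp
  mul := fun hx hy => natDegree_mul_le_of_le hx hy

end Filt

section
variable {k : Type} [Field k] [IsAlgClosed k] 

lemma lamP_deg {d : ℕ} (Z : Crv k d) : Z.lamP.natDegree ≤ d := by
  refine (Filt.base k).aeval (fun c => ?_) Z.hom _ (fun i => ?_)
  · change (C c).natDegree ≤ 0; simp
  · fin_cases i
    · change (0 : k[X]).natDegree ≤ 1; simp
    · change (1 : k[X]).natDegree ≤ 1; simp
    · change (X : k[X]).natDegree ≤ 1; simp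

lemma PP_mem {d : ℕ} (Z : Crv k d) : Z.PP (X : k[X]) ∈ (Filt.base k).poly.S ((d + (d - 1)) * d) := by
  have h : GG (X : k[X]) Z.F ∈ (Filt.base k).poly.poly.S d := by
    refine Filt.aeval _ (fun c => ?_) Z.hom _ (fun i => ?_)
    · change C (C (C c)) ∈ _
      refine Filt.C_mem _ (Filt.C_mem _ ?_)
      change (C c).natDegree ≤ 0; simp
    · fin_cases i
      · exact Filt.mono _ (Nat.zero_le 1) (Filt.one _)
      · exact Filt.mono _ (Nat.zero_le 1) (Filt.X_mem _)
      · change C (C X) * X + C X ∈ _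
        refine add_mem ?_ ?_
        · refine Filt.mul _ (i := 1) (j := 0) (Filt.C_mem _ (Filt.C_mem _ ?_)) (Filt.X_mem _)
          change (X : k[X]).natDegree ≤ 1; simp
        · exact Filt.mono _ (Nat.zero_le 1) (Filt.C_mem _ (Filt.X_mem _))
  exact Filt.res _ h (Filt.deriv _ h) _ _

lemma rho0_deg {r : ℕ} {d : Fin r → ℕ} (Z : ∀ i, Crv k (d i)) (m : ℕ) (hm : ∑ i, d i ≤ m) : (rho0 Z).natDegree ≤ 4 * m ^ 4 := by
  have h1 : PPP Z ∈ (Filt.base k).poly.S (∑ i, (d i + (d i - 1)) * d i) := Filt.prod _ _ _ _ fun i _ => PP_mem (Z i)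
  have h2 : rho0 Z ∈ (Filt.base k).S _ := Filt.res _ h1 (Filt.deriv _ h1) _ _
  refine le_trans h2 ?_
  have hdm : ∀ i, d i ≤ m := fun i => (Finset.single_le_sum (f := d) (fun _ _ => Nat.zero_le _) (Finset.mem_univ i)).trans hm
  have e1 : ∑ i, (d i + (d i - 1)) * d i ≤ 2 * m ^ 2 := by
    calc ∑ i, (d i + (d i - 1)) * d i ≤ ∑ i, (2 * m) * d i := by
          refine Finset.sum_le_sum fun i _ => Nat.mul_le_mul_right _ ?_
          have := hdm i; omega
      _ = (2 * m) * ∑ i, d i := by rw [Finset.mul_sum]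
      _ ≤ (2 * m) * m := Nat.mul_le_mul_left _ hm
      _ = _ := by ring
  have e2 : ∑ i, d i * (d i - 1) ≤ m ^ 2 := by
    calc ∑ i, d i * (d i - 1) ≤ ∑ i, d i * m := by
          refine Finset.sum_le_sum fun i _ => Nat.mul_le_mul_left _ ?_
          have := hdm i; omega
      _ = (∑ i, d i) * m := by rw [Finset.sum_mul]
      _ ≤ m * m := Nat.mul_le_mul_right _ hm
      _ = _ := by ring
  calc _ ≤ (2 * m ^ 2) * (2 * m ^ 2) := Nat.mul_le_mul (by omega) e1
    _ = _ := by ring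

theorem exists_rho {r : ℕ} {d : Fin r → ℕ} (Z : ∀ i, Crv k (d i)) (m : ℕ) (hm : ∑ i, d i ≤ m)
    (hZ : ∀ i j, i ≠ j → ¬ aff (Z i).F ∣ aff (Z j).F) :
    ∃ ρ : k[X], ρ ≠ 0 ∧ ρ.natDegree ≤ 4 * m ^ 4 + m ∧ ∀ c, ρ.eval c ≠ 0 → (∀ i, (Z i).lam c ≠ 0) ∧
      ∃ Fm : Fam k r d, ∀ i, Fm.g i = (Z i).nG c := by
  refine ⟨rho0 Z * ∏ i, (Z i).lamP, mul_ne_zero (rho0_ne Z hZ) (Finset.prod_ne_zero_iff.2 fun i _ => (Z i).lamP_ne), ?_, ?_⟩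
  · refine natDegree_mul_le_of_le (rho0_deg Z m hm) ?_
    refine (natDegree_prod_le _ _).trans ((Finset.sum_le_sum fun i _ => lamP_deg (Z i)).trans hm)
  · intro c hc
    rw [eval_mul, eval_prod] at hc
    have h1 := left_ne_zero_of_mul hc
    have h2 := Finset.prod_ne_zero_iff.1 (right_ne_zero_of_mul hc)
    have h3 : ∀ i, (Z i).lam c ≠ 0 := fun i => by
      rw [← (Z i).lamP_map c, coe_aeval_eq_eval]; exact h2 i (Finset.mem_univ i)
    exact ⟨h3, mk_fam Z c h3 h1⟩

end
end LineIrr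

end

section
open Polynomial
open Polynomial

namespace LineIrr

section
variable {k : Type*} [Field k] (t0 : k)

/-- projective change of coordinates -/
noncomputable def tw (F : MvPolynomial (Fin 3) k) : MvPolynomial (Fin 3) k :=
  MvPolynomial.aeval ![MvPolynomial.X 1, MvPolynomial.X 0 + MvPolynomial.C t0 * MvPolynomial.X 1, MvPolynomial.X 2] F

lemma aeval_tw (F : MvPolynomial (Fin 3) k) {E : Type*} [CommRing E] [Algebra k E] (a b c : E) :
    MvPolynomial.aeval ![a, b, c] (tw t0 F) = MvPolynomial.aeval ![b, a + algebraMap k E t0 * b, c] F := by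
  have h := MvPolynomial.comp_aeval_apply ![MvPolynomial.X 1, MvPolynomial.X 0 + MvPolynomial.C t0 * MvPolynomial.X 1, MvPolynomial.X 2]
    (MvPolynomial.aeval (R := k) ![a, b, c]) F
  rw [tw, h]
  congr 2
  funext i; fin_cases i <;> simp

lemma tw_hom {F : MvPolynomial (Fin 3) k} {d : ℕ} (hF : F.IsHomogeneous d) : (tw t0 F).IsHomogeneous d := by
  have h := hF.aeval (n := 1) (![MvPolynomial.X 1, MvPolynomial.X 0 + MvPolynomial.C t0 * MvPolynomial.X 1, MvPolynomial.X 2] : Fin 3 → MvPolynomial (Fin 3) k) ?_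
  · rw [one_mul] at h; exact h
  · intro i
    fin_cases i
    · exact MvPolynomial.isHomogeneous_X _ _
    · refine (MvPolynomial.isHomogeneous_X _ _).add ?_
      have := (MvPolynomial.isHomogeneous_C (Fin 3) t0).mul (MvPolynomial.isHomogeneous_X k (1 : Fin 3))
      rwa [zero_add] at this
    · exact MvPolynomial.isHomogeneous_X _ _

lemma tw_p0 (F : MvPolynomial (Fin 3) k) : MvPolynomial.pderiv 0 (tw t0 F) = tw t0 (MvPolynomial.pderiv 1 F) := by
  rw [tw, deriv_aeval]
  simp [Fin.sum_univ_three, tw, MvPolynomial.pderiv_X]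

lemma tw_p1 (F : MvPolynomial (Fin 3) k) : MvPolynomial.pderiv 1 (tw t0 F) =
    tw t0 (MvPolynomial.pderiv 0 F) + MvPolynomial.C t0 * tw t0 (MvPolynomial.pderiv 1 F) := by
  rw [tw, deriv_aeval]
  simp [Fin.sum_univ_three, tw, MvPolynomial.pderiv_X, mul_comm]

lemma tw_p2 (F : MvPolynomial (Fin 3) k) : MvPolynomial.pderiv 2 (tw t0 F) = tw t0 (MvPolynomial.pderiv 2 F) := by
  rw [tw, deriv_aeval]
  simp [Fin.sum_univ_three, tw, MvPolynomial.pderiv_X]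

lemma euler' {F : MvPolynomial (Fin 3) k} {d : ℕ} (hF : F.IsHomogeneous d) {R : Type*} [CommRing R] [Algebra k R] (v : Fin 3 → R) :
    v 0 * MvPolynomial.aeval v (MvPolynomial.pderiv 0 F) + v 1 * MvPolynomial.aeval v (MvPolynomial.pderiv 1 F)
     + v 2 * MvPolynomial.aeval v (MvPolynomial.pderiv 2 F) = (d : R) * MvPolynomial.aeval v F := by
  have := congrArg (MvPolynomial.aeval v) hF.sum_X_mul_pderiv
  simp only [map_sum, map_mul, MvPolynomial.aeval_X, map_nsmul, Fin.sum_univ_three] at this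
  simpa using this

/-- smooth projective curve -/
def Sm (F : MvPolynomial (Fin 3) k) : Prop := ∀ x : Fin 3 → k, x ≠ 0 → MvPolynomial.aeval x F = 0 →
  ∃ j, MvPolynomial.aeval x (MvPolynomial.pderiv j F) ≠ 0

/-- the line T = t0 is transversal -/
def GoodT (F : MvPolynomial (Fin 3) k) : Prop := ∀ u v : k, (u ≠ 0 ∨ v ≠ 0) → MvPolynomial.aeval ![u, t0 * u, v] F = 0 →
  MvPolynomial.aeval ![u, t0 * u, v] (MvPolynomial.pderiv 0 F) + t0 * MvPolynomial.aeval ![u, t0 * u, v] (MvPolynomial.pderiv 1 F) = 0 →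
  MvPolynomial.aeval ![u, t0 * u, v] (MvPolynomial.pderiv 2 F) ≠ 0

lemma tw_smooth {F : MvPolynomial (Fin 3) k} {d : ℕ} (hF : F.IsHomogeneous d) (hs : Sm F) (t x : k)
    (h0 : MvPolynomial.aeval ![1, t, x] (tw t0 F) = 0) (h1 : MvPolynomial.aeval ![1, t, x] (MvPolynomial.pderiv 1 (tw t0 F)) = 0) :
    MvPolynomial.aeval ![1, t, x] (MvPolynomial.pderiv 2 (tw t0 F)) ≠ 0 := by
  intro h2
  have h3 := euler' (tw_hom t0 hF) ![1, t, x]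
  rw [h0, h1, h2] at h3
  simp only [Matrix.cons_val_zero, one_mul, mul_zero, add_zero] at h3
  rw [tw_p0, aeval_tw] at h3
  rw [tw_p2, aeval_tw] at h2
  rw [tw_p1, map_add, map_mul, aeval_tw, aeval_tw, h3, mul_zero, add_zero] at h1
  rw [aeval_tw] at h0
  obtain ⟨j, hj⟩ := hs _ (by
    intro h
    have e1 := congrFun h 0
    have e2 := congrFun h 1
    simp at e1 e2
    rw [e1] at e2; simp at e2) h0
  fin_cases j
  · exact hj h1
  · exact hj h3
  · exact hj h2

lemma tw_trans {F : MvPolynomial (Fin 3) k} (hs : GoodT t0 F) (u v : k) (huv : u ≠ 0 ∨ v ≠ 0)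
    (h0 : MvPolynomial.aeval ![0, u, v] (tw t0 F) = 0) (h1 : MvPolynomial.aeval ![0, u, v] (MvPolynomial.pderiv 1 (tw t0 F)) = 0) :
    MvPolynomial.aeval ![0, u, v] (MvPolynomial.pderiv 2 (tw t0 F)) ≠ 0 := by
  rw [tw_p2, aeval_tw]
  rw [tw_p1, map_add, map_mul, aeval_tw, aeval_tw] at h1
  rw [aeval_tw] at h0
  simp only [zero_add, Algebra.algebraMap_self, RingHom.id_apply, MvPolynomial.aeval_C] at h0 h1 ⊢
  exact hs u v huv h0 h1

/-- the transform `h*` -/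
noncomputable def tws (n : ℕ) (h : MvPolynomial (Fin 2) k) : MvPolynomial (Fin 2) k :=
  ∑ m ∈ h.support, MvPolynomial.C (h.coeff m) * ((MvPolynomial.X 0 - MvPolynomial.C t0) ^ (n - m 0 - m 1) * MvPolynomial.X 1 ^ m 1)

lemma sum_le_totalDegree (h : MvPolynomial (Fin 2) k) (m : Fin 2 →₀ ℕ) (hm : m ∈ h.support) : m 0 + m 1 ≤ h.totalDegree := by
  have := MvPolynomial.le_totalDegree hm
  rw [Finsupp.sum_fintype _ _ (by simp)] at this
  simpa [Fin.sum_univ_two] using this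

lemma tws_deg (n : ℕ) (h : MvPolynomial (Fin 2) k) (hn : h.totalDegree ≤ n) : (tws t0 n h).totalDegree ≤ n := by
  refine MvPolynomial.totalDegree_finsetSum_le fun m hm => ?_
  have h1 := (sum_le_totalDegree h m hm).trans hn
  refine (MvPolynomial.totalDegree_mul _ _).trans ?_
  rw [MvPolynomial.totalDegree_C, zero_add]
  refine (MvPolynomial.totalDegree_mul _ _).trans ?_
  have e1 : (MvPolynomial.X (R := k) (0 : Fin 2) - MvPolynomial.C t0).totalDegree ≤ 1 := by
    refine (MvPolynomial.totalDegree_sub_C_le _ _).trans ?_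
    rw [MvPolynomial.totalDegree_X]
  have e2 := (MvPolynomial.totalDegree_pow (MvPolynomial.X (R := k) (0 : Fin 2) - MvPolynomial.C t0) (n - m 0 - m 1)).trans
    (Nat.mul_le_mul_left _ e1)
  have e3 := (MvPolynomial.totalDegree_pow (MvPolynomial.X (R := k) (1 : Fin 2)) (m 1))
  rw [MvPolynomial.totalDegree_X] at e3
  omega

lemma tws_aeval (n : ℕ) (h : MvPolynomial (Fin 2) k) (hn : h.totalDegree ≤ n) {E : Type*} [Field E] [Algebra k E] (t x s : E)
    (hs : s = t - algebraMap k E t0) (hs0 : s ≠ 0) :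
    MvPolynomial.aeval ![t, x] (tws t0 n h) = s ^ n * MvPolynomial.aeval ![1 / s, x / s] h := by
  rw [tws, map_sum, MvPolynomial.aeval_def ![1 / s, x / s], MvPolynomial.eval₂_eq', Finset.mul_sum]
  refine Finset.sum_congr rfl fun m hm => ?_
  have h1 := (sum_le_totalDegree h m hm).trans hn
  obtain ⟨e, rfl⟩ := Nat.exists_eq_add_of_le h1
  simp [Fin.prod_univ_two, ← hs, show m 0 + m 1 + e - m 0 - m 1 = e by omega, div_pow, pow_add]
  field_simp

/-- generic point principle -/
lemma eq_of_generic (p q : MvPolynomial (Fin 2) k) (h : MvPolynomial.aeval (S₁ := FractionRing (MvPolynomial (Fin 2) k))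
    ![algebraMap (MvPolynomial (Fin 2) k) _ (MvPolynomial.X 0), algebraMap (MvPolynomial (Fin 2) k) _ (MvPolynomial.X 1)] p = MvPolynomial.aeval
    ![algebraMap (MvPolynomial (Fin 2) k) _ (MvPolynomial.X 0), algebraMap (MvPolynomial (Fin 2) k) _ (MvPolynomial.X 1)] q) : p = q := by
  have e : ∀ p : MvPolynomial (Fin 2) k, MvPolynomial.aeval (S₁ := FractionRing (MvPolynomial (Fin 2) k))
    ![algebraMap (MvPolynomial (Fin 2) k) _ (MvPolynomial.X 0), algebraMap (MvPolynomial (Fin 2) k) _ (MvPolynomial.X 1)] p = algebraMap _ _ p := by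
    intro p
    have h := MvPolynomial.comp_aeval_apply (MvPolynomial.X (R := k)) (IsScalarTower.toAlgHom k (MvPolynomial (Fin 2) k) (FractionRing (MvPolynomial (Fin 2) k))) p
    rw [MvPolynomial.aeval_X_left_apply] at h
    simp only [IsScalarTower.coe_toAlgHom'] at h
    rw [h]; congr 2; funext i; fin_cases i <;> simp
  rw [e, e] at h
  exact IsFractionRing.injective _ _ h

lemma generic_ne : (algebraMap (MvPolynomial (Fin 2) k) (FractionRing (MvPolynomial (Fin 2) k)) (MvPolynomial.X 0)) - algebraMap k _ t0 ≠ 0 := by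
  rw [IsScalarTower.algebraMap_apply k (MvPolynomial (Fin 2) k), ← map_sub]
  refine (map_ne_zero_iff _ (IsFractionRing.injective _ _)).2 ?_
  intro h
  have := congrArg (MvPolynomial.aeval ![t0 + 1, 0]) h
  simp at this

lemma aff_tw {F : MvPolynomial (Fin 3) k} {d : ℕ} (hF : F.IsHomogeneous d) {E : Type*} [Field E] [Algebra k E] (t x s : E)
    (hs : s = t - algebraMap k E t0) (hs0 : s ≠ 0) :
    MvPolynomial.aeval ![t, x] (aff F) = s ^ d * MvPolynomial.aeval ![1 / s, x / s] (aff (tw t0 F)) := by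
  rw [aeval_aff, aeval_aff, aeval_tw]
  refine aeval_hom hF s _ _ _ _ _ _ ?_ ?_ ?_
  · simp; field_simp
  · simp; field_simp; rw [hs]; ring
  · simp; field_simp

/-- factorisations transfer -/
lemma aff_factor {F : MvPolynomial (Fin 3) k} {d : ℕ} (hF : F.IsHomogeneous d) (g h : MvPolynomial (Fin 2) k)
    (he : aff (tw t0 F) = g * h) (n1 n2 : ℕ) (h1 : g.totalDegree ≤ n1) (h2 : h.totalDegree ≤ n2) (hd : n1 + n2 = d) :
    aff F = tws t0 n1 g * tws t0 n2 h := by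
  apply eq_of_generic
  rw [aff_tw t0 hF _ _ _ rfl (generic_ne t0), map_mul, tws_aeval t0 n1 g h1 _ _ _ rfl (generic_ne t0), 
    tws_aeval t0 n2 h h2 _ _ _ rfl (generic_ne t0), he, map_mul, ← hd, pow_add]
  ring

lemma aff_deg {F : MvPolynomial (Fin 3) k} {d : ℕ} (hF : F.IsHomogeneous d) : (aff F).totalDegree ≤ d := by
  rw [aff, MvPolynomial.aeval_def, MvPolynomial.eval₂_eq']
  refine MvPolynomial.totalDegree_finsetSum_le fun m hm => ?_
  have := hF (MvPolynomial.mem_support_iff.1 hm)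
  rw [Finsupp.weight_apply, Finsupp.sum_fintype _ _ (by simp)] at this
  simp [Fin.sum_univ_three] at this
  simp only [Fin.prod_univ_three, Matrix.cons_val_zero, Matrix.cons_val_one, Matrix.cons_val, one_pow, one_mul]
  refine (MvPolynomial.totalDegree_mul _ _).trans ?_
  rw [MvPolynomial.algebraMap_eq, MvPolynomial.totalDegree_C, zero_add]
  refine (MvPolynomial.totalDegree_mul _ _).trans ?_
  have e2 := (MvPolynomial.totalDegree_pow (MvPolynomial.X (R := k) (0 : Fin 2)) (m 1))
  have e3 := (MvPolynomial.totalDegree_pow (MvPolynomial.X (R := k) (1 : Fin 2)) (m 2))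
  rw [MvPolynomial.totalDegree_X] at e2 e3
  omega

lemma isUnit_of_deg {g : MvPolynomial (Fin 2) k} (hg : g ≠ 0) (h : g.totalDegree = 0) : IsUnit g := by
  rw [MvPolynomial.totalDegree_eq_zero_iff_eq_C] at h
  rw [h]
  refine IsUnit.map _ (IsUnit.mk0 _ ?_)
  intro h0; rw [h0, MvPolynomial.C_0] at h; exact hg h

lemma deg_of_isUnit {g : MvPolynomial (Fin 2) k} (hg : IsUnit g) : g.totalDegree = 0 := by
  obtain ⟨c, -, rfl⟩ := MvPolynomial.isUnit_iff_eq_C_of_isReduced.1 hg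
  simp

lemma tw_irr {F : MvPolynomial (Fin 3) k} {d : ℕ} (hF : F.IsHomogeneous d) (hirr : Irreducible (aff F)) (hdeg : (aff F).totalDegree = d)
    (hd : 2 ≤ d) : Irreducible (aff (tw t0 F)) := by
  have hfac : ∀ g h, aff (tw t0 F) = g * h → g ≠ 0 ∧ h ≠ 0 ∧ g.totalDegree + h.totalDegree ≤ d := by
    intro g h he
    have hne : aff (tw t0 F) ≠ 0 := by
      intro h0
      have := aff_factor t0 hF 0 0 (by rw [h0]; simp) 0 d (by simp) (by simp) (by simp)
      rw [show tws t0 0 0 = 0 by simp [tws], zero_mul] at this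
      exact hirr.ne_zero this
    rw [he] at hne
    refine ⟨left_ne_zero_of_mul hne, right_ne_zero_of_mul hne, ?_⟩
    rw [← MvPolynomial.totalDegree_mul_of_isDomain (left_ne_zero_of_mul hne) (right_ne_zero_of_mul hne), ← he]
    exact aff_deg (tw_hom t0 hF)
  constructor
  · intro hu
    have h0 := deg_of_isUnit hu
    have h1 := aff_factor t0 hF (aff (tw t0 F)) 1 (mul_one _).symm (d - 1) 1 (by omega) (by simp) (by omega)
    have e1 := tws_deg t0 (d - 1) (aff (tw t0 F)) (by omega)
    have e2 := tws_deg t0 1 (1 : MvPolynomial (Fin 2) k) (by simp)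
    have e3 := MvPolynomial.totalDegree_mul (tws t0 (d - 1) (aff (tw t0 F))) (tws t0 1 1)
    rw [← h1, hdeg] at e3
    rcases hirr.isUnit_or_isUnit h1 with h | h
    · have := deg_of_isUnit h; omega
    · have := deg_of_isUnit h; omega
  · intro g h he
    obtain ⟨hg, hh, hle⟩ := hfac g h he
    have h1 := aff_factor t0 hF g h he g.totalDegree (d - g.totalDegree) le_rfl (by omega) (by omega)
    have e1 := tws_deg t0 g.totalDegree g le_rfl
    have e2 := tws_deg t0 (d - g.totalDegree) h (by omega)
    have e3 := MvPolynomial.totalDegree_mul (tws t0 g.totalDegree g) (tws t0 (d - g.totalDegree) h)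
    rw [← h1, hdeg] at e3
    rcases hirr.isUnit_or_isUnit h1 with h | h
    · have := deg_of_isUnit h
      left; apply isUnit_of_deg hg; omega
    · have := deg_of_isUnit h
      right; apply isUnit_of_deg hh; omega

lemma tw_assoc {F G : MvPolynomial (Fin 3) k} {d e : ℕ} (hF : F.IsHomogeneous d) (hG : G.IsHomogeneous e)
    (hFi : Irreducible (aff F)) (hGi : Irreducible (aff G)) (hde : d ≤ e) (c : k)
    (h : aff (tw t0 G) = aff (tw t0 F) * MvPolynomial.C c) : ∃ c : k, c ≠ 0 ∧ aff G = MvPolynomial.C c * aff F := by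
  have h1 : aff G = ((MvPolynomial.X 0 - MvPolynomial.C t0) ^ (e - d) * MvPolynomial.C c) * aff F := by
    apply eq_of_generic
    rw [aff_tw t0 hG _ _ _ rfl (generic_ne t0), map_mul, aff_tw t0 hF _ _ _ rfl (generic_ne t0), h, map_mul]
    obtain ⟨l, rfl⟩ := Nat.exists_eq_add_of_le hde
    simp [pow_add]
    ring
  have hu := (hGi.isUnit_or_isUnit h1).resolve_right hFi.not_isUnit
  obtain ⟨c', hc', he⟩ := MvPolynomial.isUnit_iff_eq_C_of_isReduced.1 hu
  exact ⟨c', hc'.ne_zero, by rw [h1, he]⟩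

lemma tw_not_dvd {F G : MvPolynomial (Fin 3) k} {d e : ℕ} (hF : F.IsHomogeneous d) (hG : G.IsHomogeneous e)
    (hFi : Irreducible (aff F)) (hGi : Irreducible (aff G)) (hFi' : Irreducible (aff (tw t0 F))) (hGi' : Irreducible (aff (tw t0 G)))
    (h : aff (tw t0 F) ∣ aff (tw t0 G)) : ∃ c : k, aff G = MvPolynomial.C c * aff F := by
  obtain ⟨u, hu⟩ := hFi'.associated_of_dvd hGi' h
  obtain ⟨c, hc, hcu⟩ := MvPolynomial.isUnit_iff_eq_C_of_isReduced.1 u.isUnit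
  rw [hcu] at hu
  rcases le_total d e with hde | hde
  · obtain ⟨c, -, h⟩ := tw_assoc t0 hF hG hFi hGi hde c hu.symm
    exact ⟨c, h⟩
  · obtain ⟨c', h0, h⟩ := tw_assoc t0 hG hF hGi hFi hde c⁻¹ (by
      rw [← hu, mul_assoc, ← MvPolynomial.C_mul, mul_inv_cancel₀ hc.ne_zero, MvPolynomial.C_1, mul_one])
    refine ⟨c'⁻¹, ?_⟩
    rw [h, ← mul_assoc, ← MvPolynomial.C_mul, inv_mul_cancel₀ h0, MvPolynomial.C_1, one_mul]

/-- the line at infinity is not a component -/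
lemma top_ne {F : MvPolynomial (Fin 3) k} {d : ℕ} (hF : F.IsHomogeneous d) (hdeg : (aff F).totalDegree = d) (hd : 2 ≤ d) :
    MvPolynomial.aeval ![0, 1, (X : k[X])] F ≠ 0 := by
  intro h0
  have hX : ∀ p : MvPolynomial (Fin 2) k, MvPolynomial.X 0 ∣ p - MvPolynomial.aeval ![0, MvPolynomial.X 1] p := by
    intro p
    rw [← Ideal.mem_span_singleton, ← Ideal.Quotient.mk_eq_mk_iff_sub_mem]
    have : (Ideal.Quotient.mkₐ k (Ideal.span {(MvPolynomial.X 0 : MvPolynomial (Fin 2) k)})) =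
      (Ideal.Quotient.mkₐ k (Ideal.span {(MvPolynomial.X 0 : MvPolynomial (Fin 2) k)})).comp (MvPolynomial.aeval ![0, MvPolynomial.X 1]) := by
      refine MvPolynomial.algHom_ext fun i => ?_
      fin_cases i
      · simp only [Fin.zero_eta, AlgHom.comp_apply, MvPolynomial.aeval_X, Matrix.cons_val_zero, map_zero]
        rw [Ideal.Quotient.mkₐ_eq_mk, Ideal.Quotient.eq_zero_iff_mem]
        exact Ideal.mem_span_singleton_self _
      · simp
    exact congrArg (fun φ => φ p) this
  have h1 : MvPolynomial.aeval ![0, MvPolynomial.X 1] (aff (tw 0 F)) = (0 : MvPolynomial (Fin 2) k) := by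
    rw [aeval_aff, aeval_tw]
    have h := MvPolynomial.comp_aeval_apply ![0, 1, (X : k[X])] (aeval (MvPolynomial.X 1 : MvPolynomial (Fin 2) k) : k[X] →ₐ[k] _) F
    rw [h0, map_zero] at h
    refine Eq.trans ?_ h.symm
    congr 2; funext i; fin_cases i <;> simp
  have h2 := hX (aff (tw 0 F))
  rw [h1, sub_zero] at h2
  obtain ⟨g, hg⟩ := h2
  have hne : aff (tw 0 F) ≠ 0 := by
    intro h0
    have := aff_factor 0 hF 0 0 (by rw [h0]; simp) 0 d (by simp) (by simp) (by simp)
    rw [show tws (0 : k) 0 0 = 0 by simp [tws], zero_mul] at this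
    rw [this] at hdeg
    simp at hdeg; omega
  have hg0 : g ≠ 0 := by rintro rfl; rw [mul_zero] at hg; exact hne hg
  have h3 := MvPolynomial.totalDegree_mul_of_isDomain (MvPolynomial.X_ne_zero 0) hg0
  rw [← hg, MvPolynomial.totalDegree_X] at h3
  have h4 := aff_deg (tw_hom (0 : k) hF)
  have h5 : aff F = tws 0 (d - 1) g := by
    apply eq_of_generic
    rw [aff_tw 0 hF _ _ _ rfl (generic_ne 0), tws_aeval 0 (d - 1) g (by omega) _ _ _ rfl (generic_ne 0), hg, map_mul]
    have hh := generic_ne (0 : k)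
    obtain ⟨l, rfl⟩ := Nat.exists_eq_add_of_le hd
    simp only [MvPolynomial.aeval_X, Matrix.cons_val_zero, show 2 + l - 1 = l + 1 by omega, show 2 + l = l + 1 + 1 by omega, pow_succ _ (l + 1)]
    field_simp
    rw [show l + 1 + 1 - 1 = l + 1 by omega]; ring
  have h6 := tws_deg 0 (d - 1) g (by omega)
  rw [← h5] at h6
  omega

end
end LineIrr

end

section
open Polynomial
open Polynomial

namespace LineIrr

section
variable {k : Type} [Field k]

lemma hom_zero0 {H : MvPolynomial (Fin 3) k} {n : ℕ} (hH : H.IsHomogeneous n) (h0 : aff H = 0) {E : Type*} [Field E] [Algebra k E] (x : Fin 3 → E)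
    (hx0 : x 0 ≠ 0) : MvPolynomial.aeval x H = 0 := by
  have h1 := aeval_hom hH (x 0) 1 (x 1 / x 0) (x 2 / x 0) (x 0) (x 1) (x 2) (by simp) (by field_simp) (by field_simp)
  have h2 := aeval_aff H ![x 1 / x 0, x 2 / x 0]
  rw [h0, map_zero] at h2
  simp only [Matrix.cons_val_zero, Matrix.cons_val_one] at h2
  rw [← h2, mul_zero] at h1
  rw [← h1]; congr 2; funext i; fin_cases i <;> rfl

lemma hom_zero {H : MvPolynomial (Fin 3) k} {n : ℕ} (hH : H.IsHomogeneous n) (h0 : aff H = 0) : H = 0 := by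
  have h1 := hom_zero0 hH h0 (E := FractionRing (MvPolynomial (Fin 3) k)) (fun i => algebraMap (MvPolynomial (Fin 3) k) _ (MvPolynomial.X i))
    ((map_ne_zero_iff _ (IsFractionRing.injective (MvPolynomial (Fin 3) k) _)).2 (MvPolynomial.X_ne_zero (R := k) (0 : Fin 3)))
  have h := MvPolynomial.comp_aeval_apply (MvPolynomial.X (R := k))
    (IsScalarTower.toAlgHom k (MvPolynomial (Fin 3) k) (FractionRing (MvPolynomial (Fin 3) k))) H
  rw [MvPolynomial.aeval_X_left_apply] at h
  simp only [IsScalarTower.coe_toAlgHom'] at h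
  rw [← h] at h1
  exact (map_eq_zero_iff _ (IsFractionRing.injective _ _)).1 h1

variable {F : MvPolynomial (Fin 3) k} {d : ℕ}

lemma pd_comm (i j : Fin 3) (G : MvPolynomial (Fin 3) k) : MvPolynomial.pderiv i (MvPolynomial.pderiv j G) = MvPolynomial.pderiv j (MvPolynomial.pderiv i G) := by
  have h : ⁅(MvPolynomial.pderiv i : Derivation k (MvPolynomial (Fin 3) k) (MvPolynomial (Fin 3) k)), (MvPolynomial.pderiv j : Derivation k (MvPolynomial (Fin 3) k) (MvPolynomial (Fin 3) k))⁆ = 0 := by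
    refine MvPolynomial.derivation_ext fun l => ?_
    rw [Derivation.commutator_apply, MvPolynomial.pderiv_X, MvPolynomial.pderiv_X]
    simp only [Pi.single_apply]
    split_ifs <;> simp
  have := congrArg (fun D => D G) h
  rw [Derivation.commutator_apply] at this
  exact sub_eq_zero.1 this

lemma p2_ne (hF : F.IsHomogeneous d) (hs : Sm F) (hc : ((d * (d - 1) : ℕ) : k) ≠ 0) : aff (MvPolynomial.pderiv 2 F) ≠ 0 := by
  intro h0
  have h2 := hom_zero (hF.pderiv (i := 2)) h0
  push_cast at hc
  have hcd := left_ne_zero_of_mul hc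
  have hcd1 := right_ne_zero_of_mul hc
  have hV : MvPolynomial.aeval ![0, 0, (1:k)] F = 0 := by
    have := euler' hF ![0, 0, (1:k)]
    rw [h2] at this
    simp only [Matrix.cons_val_zero, Matrix.cons_val_one, Matrix.cons_val, zero_mul, map_zero, mul_zero, add_zero] at this
    exact (mul_eq_zero.1 this.symm).resolve_left hcd
  obtain ⟨j, hj⟩ := hs _ (fun h => by have := congrFun h 2; simp at this) hV
  apply hj
  have := euler' (hF.pderiv (i := j)) ![0, 0, (1:k)]
  rw [pd_comm 2 j, h2] at this
  simp only [Matrix.cons_val_zero, Matrix.cons_val_one, Matrix.cons_val, zero_mul, map_zero, mul_zero, add_zero] at this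
  exact (mul_eq_zero.1 this.symm).resolve_left hcd1

noncomputable def PX (F : MvPolynomial (Fin 3) k) : k[X][X] := MvPolynomial.aeval ![1, C X, X] F

lemma PX_deriv : derivative (PX F) = PX (MvPolynomial.pderiv 2 F) := by
  have h := deriv_aeval (Derivation.restrictScalars k (derivative' (R := k[X]))) ![1, C X, X] F
  simp [Fin.sum_univ_three] at h
  rw [PX, h, PX]

lemma PX_eval (t x : k) (F : MvPolynomial (Fin 3) k) : (PX F).evalEval t x = MvPolynomial.aeval ![1, t, x] F := by
  have h := MvPolynomial.map_aeval ![1, C X, X] (evalEvalRingHom t x) F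
  rw [coe_evalEvalRingHom] at h
  rw [PX, h, MvPolynomial.aeval_def, ← MvPolynomial.coe_eval₂Hom]
  congr 2
  · ext x; simp
  · funext i; fin_cases i <;> simp [evalEval_C]

lemma PX_E {E : Type*} [Field E] [Algebra k E] [Algebra (RatFunc k) E] [IsScalarTower k (RatFunc k) E] (z : E) (F : MvPolynomial (Fin 3) k) :
    aeval z ((PX F).map (algebraMap k[X] (RatFunc k))) = MvPolynomial.aeval ![1, algebraMap (RatFunc k) E RatFunc.X, z] F := by
  have h := MvPolynomial.map_aeval ![1, C X, X] (((aeval z : (RatFunc k)[X] →ₐ[RatFunc k] E).toRingHom).comp (mapRingHom (algebraMap k[X] (RatFunc k)))) F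
  change (((aeval z : (RatFunc k)[X] →ₐ[RatFunc k] E).toRingHom).comp (mapRingHom (algebraMap k[X] (RatFunc k)))) (PX F) = _
  rw [PX, h, MvPolynomial.aeval_def, ← MvPolynomial.coe_eval₂Hom]
  congr 2
  · ext x
    simp only [RingHom.comp_apply, coe_mapRingHom]
    rw [IsScalarTower.algebraMap_apply k k[X] k[X][X], algebraMap_eq, algebraMap_eq, map_C]
    rw [IsScalarTower.algebraMap_apply k (RatFunc k) E]
    simp
  · funext i; fin_cases i <;> simp

lemma PX_sep [IsAlgClosed k] (hF : F.IsHomogeneous d) (hs : Sm F) (hc : ((d * (d - 1) : ℕ) : k) ≠ 0) (hd : 2 ≤ d) (hdeg : (aff F).totalDegree = d)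
    (hirr : Irreducible (aff F)) : ((PX F).map (algebraMap k[X] (RatFunc k))).Separable := by
  rw [Separable, Polynomial.isCoprime_iff_aeval_ne_zero_of_isAlgClosed (RatFunc k) (AlgebraicClosure (RatFunc k))]
  intro z
  by_contra! hcon
  obtain ⟨h1, h2⟩ := hcon
  rw [derivative_map, PX_deriv] at h2
  rw [PX_E] at h1 h2
  set T := algebraMap (RatFunc k) (AlgebraicClosure (RatFunc k)) RatFunc.X with hT
  have hne := p2_ne hF hs hc
  obtain ⟨P, hP⟩ := point_of_two (aff F) (aff (MvPolynomial.pderiv 2 F)) hirr (MvPolynomial.aeval (R := k) ![T, z])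
    (by rw [aeval_aff]; exact h1) (by rw [aeval_aff]; exact h2) (by
      rintro ⟨g, hg⟩
      rw [hg] at hne
      have e1 := MvPolynomial.totalDegree_mul_of_isDomain (left_ne_zero_of_mul hne) (right_ne_zero_of_mul hne)
      rw [← hg, hdeg] at e1
      have e2 := aff_deg (hF.pderiv (i := 2))
      omega)
  have h3 := hP (MvPolynomial.X 0)
  simp only [MvPolynomial.aeval_X, Matrix.cons_val_zero] at h3
  rw [hT, IsScalarTower.algebraMap_apply k (RatFunc k) (AlgebraicClosure (RatFunc k))] at h3
  have h4 := (algebraMap (RatFunc k) (AlgebraicClosure (RatFunc k))).injective h3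
  rw [← RatFunc.algebraMap_X, IsScalarTower.algebraMap_apply k k[X] (RatFunc k)] at h4
  have h5 := RatFunc.algebraMap_injective k h4
  have := congrArg natDegree h5
  simp at this

lemma PX_natDegree_ne (hF : F.IsHomogeneous d) (hs : Sm F) (hc : ((d * (d - 1) : ℕ) : k) ≠ 0) : (PX F).natDegree ≠ 0 := by
  intro h
  have h1 : derivative (PX F) = 0 := derivative_of_natDegree_zero h
  rw [PX_deriv] at h1
  apply p2_ne hF hs hc
  have h := MvPolynomial.map_aeval ![1, C X, X] (eval₂RingHom (aeval (MvPolynomial.X 0) : k[X] →ₐ[k] MvPolynomial (Fin 2) k).toRingHom (MvPolynomial.X 1))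
    (MvPolynomial.pderiv 2 F)
  rw [← PX, h1, map_zero] at h
  refine Eq.trans ?_ h.symm
  rw [aff, MvPolynomial.aeval_def, ← MvPolynomial.coe_eval₂Hom]
  congr 2
  · ext x
    simp only [RingHom.comp_apply]
    rw [IsScalarTower.algebraMap_apply k k[X] k[X][X], algebraMap_eq, algebraMap_eq]
    simp
  · funext i; fin_cases i <;> simp

lemma PX_mem (hF : F.IsHomogeneous d) : PX F ∈ (Filt.base k).poly.S d := by
  refine Filt.aeval _ (fun c => ?_) hF _ (fun i => ?_)
  · change C (C c) ∈ _
    refine Filt.C_mem _ ?_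
    change (C c).natDegree ≤ 0; simp
  · fin_cases i
    · exact Filt.mono _ (Nat.zero_le 1) (Filt.one _)
    · refine Filt.C_mem _ ?_
      change (X : k[X]).natDegree ≤ 1; simp
    · exact Filt.mono _ (Nat.zero_le 1) (Filt.X_mem _)

lemma PX_natDegree (hF : F.IsHomogeneous d) : (PX F).natDegree ≤ d := by
  rw [PX, MvPolynomial.aeval_def, MvPolynomial.eval₂_eq']
  refine natDegree_sum_le_of_forall_le _ _ fun m hm => ?_
  have := hF (MvPolynomial.mem_support_iff.1 hm)
  rw [Finsupp.weight_apply, Finsupp.sum_fintype _ _ (by simp)] at this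
  simp [Fin.sum_univ_three] at this
  simp only [Fin.prod_univ_three, Matrix.cons_val_zero, Matrix.cons_val_one, Matrix.cons_val, one_pow, one_mul]
  rw [show algebraMap k k[X][X] (F.coeff m) = C (C (F.coeff m)) from rfl, ← C_pow, ← mul_assoc, ← C_mul]
  refine (natDegree_C_mul_X_pow_le _ _).trans (by omega)

theorem exists_bad [IsAlgClosed k] (hF : F.IsHomogeneous d) (hs : Sm F) (hc : ((d * (d - 1) : ℕ) : k) ≠ 0) (hd : 2 ≤ d) (hdeg : (aff F).totalDegree = d)
    (hirr : Irreducible (aff F)) : ∃ R : k[X], R ≠ 0 ∧ R.natDegree ≤ 2 * d * d + 1 ∧ ∀ t0, R.eval t0 ≠ 0 → GoodT t0 F := by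
  classical
  set n := (PX F).natDegree with hn
  set R1 := resultant (PX F) (derivative (PX F)) n (n - 1) with hR1
  have hR1ne : R1 ≠ 0 := res_map_ne (algebraMap k[X] (RatFunc k)) _ _ (natDegree_map_eq_of_injective (RatFunc.algebraMap_injective k) _)
    (PX_sep hF hs hc hd hdeg hirr)
  have hR1d : R1.natDegree ≤ 2 * d * d := by
    refine le_trans (Filt.res _ (PX_mem hF) (Filt.deriv _ (PX_mem hF)) _ _ : R1 ∈ (Filt.base k).S _) ?_
    refine Nat.mul_le_mul_right _ ?_
    have := PX_natDegree hF
    omega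
  set V : Fin 3 → k := ![0, 0, 1] with hV
  set B0 : k[X] := C (MvPolynomial.aeval V (MvPolynomial.pderiv 0 F)) + C (MvPolynomial.aeval V (MvPolynomial.pderiv 1 F)) * X with hB0
  have hB0d : B0.natDegree ≤ 1 := by rw [hB0]; compute_degree
  refine ⟨R1 * (if B0 = 0 then 1 else B0), mul_ne_zero hR1ne (by split_ifs with h <;> simp [h]), ?_, ?_⟩
  · refine natDegree_mul_le_of_le hR1d ?_
    split_ifs
    · simp
    · exact hB0d
  · intro t0 ht u v huv h0 h1 h2
    rw [eval_mul] at ht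
    by_cases hu : u = 0
    · subst hu
      have hv : v ≠ 0 := by simpa using huv
      have e : ∀ {G : MvPolynomial (Fin 3) k} {n : ℕ}, G.IsHomogeneous n → MvPolynomial.aeval ![0, t0 * 0, v] G = v ^ n * MvPolynomial.aeval V G :=
        fun hG => aeval_hom hG v _ _ _ _ _ _ (by simp) (by simp) (by simp)
      rw [e hF] at h0
      rw [e hF.pderiv, e hF.pderiv] at h1
      rw [e hF.pderiv] at h2
      have h0' := (mul_eq_zero.1 h0).resolve_left (pow_ne_zero _ hv)
      have h2' := (mul_eq_zero.1 h2).resolve_left (pow_ne_zero _ hv)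
      have h1' : B0.eval t0 = 0 := by
        have : v ^ (d - 1) * B0.eval t0 = 0 := by
          rw [← h1, hB0]; simp only [eval_add, eval_mul, eval_C, eval_X]; ring
        exact (mul_eq_zero.1 this).resolve_left (pow_ne_zero _ hv)
      have hB : B0 = 0 := by
        by_contra hB
        rw [if_neg hB] at ht
        exact right_ne_zero_of_mul ht h1'
      obtain ⟨j, hj⟩ := hs V (fun h => by have := congrFun h 2; simp [hV] at this) h0'
      have c0 := congrArg (fun p => coeff p 0) hB
      have c1 := congrArg (fun p => coeff p 1) hB
      simp [hB0, -MvPolynomial.coe_aeval_eq_eval] at c0 c1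
      fin_cases j
      · exact hj c0
      · exact hj c1
      · exact hj h2'
    · have e : ∀ {G : MvPolynomial (Fin 3) k} {n : ℕ}, G.IsHomogeneous n → MvPolynomial.aeval ![u, t0 * u, v] G = u ^ n * MvPolynomial.aeval ![1, t0, v / u] G :=
        fun hG => aeval_hom hG u _ _ _ _ _ _ (by simp) (by ring) (by field_simp)
      rw [e hF] at h0
      rw [e hF.pderiv] at h2
      have h0' := (mul_eq_zero.1 h0).resolve_left (pow_ne_zero _ hu)
      have h2' := (mul_eq_zero.1 h2).resolve_left (pow_ne_zero _ hu)
      rw [← PX_eval] at h0' h2'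
      rw [← PX_deriv] at h2'
      have := res_root (PX F) (derivative (PX F)) n (n - 1) le_rfl (natDegree_derivative_le _) t0 (v / u) h0' h2' (PX_natDegree_ne hF hs hc)
      exact left_ne_zero_of_mul ht (dvd_iff_isRoot.1 this)

end
end LineIrr

end

section
open Polynomial
open Polynomial

namespace LineIrr

section
variable {K : Type*} [Field K]

lemma reverse_reverse' {p : K[X]} (h : p.coeff 0 ≠ 0) : p.reverse.reverse = p := by
  have h1 : p.reverse.natDegree = p.natDegree := by
    rw [reverse_natDegree, natTrailingDegree_eq_zero.2 (Or.inr h), Nat.sub_zero]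
  rw [reverse, h1, reverse, reflect_reflect]

lemma irr_reverse {p : K[X]} (h : p.coeff 0 ≠ 0) (hp : Irreducible p) : Irreducible p.reverse := by
  have key : ∀ a : K[X], a.coeff 0 ≠ 0 → IsUnit a.reverse → IsUnit a := by
    intro a ha hu
    have h1 : a.reverse.natDegree = a.natDegree := by
      rw [reverse_natDegree, natTrailingDegree_eq_zero.2 (Or.inr ha), Nat.sub_zero]
    have ha0 : a ≠ 0 := by rintro rfl; simp at ha
    rw [natDegree_eq_zero_of_isUnit hu] at h1
    exact isUnit_iff_degree_eq_zero.2 (by rw [degree_eq_natDegree ha0, ← h1]; rfl)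
  constructor
  · intro hu; exact hp.not_isUnit (key p h hu)
  · intro a b he
    have h0 : a.coeff 0 * b.coeff 0 ≠ 0 := by
      rw [← mul_coeff_zero, ← he, coeff_zero_reverse]
      exact leadingCoeff_ne_zero.2 hp.ne_zero
    have h1 : p = a.reverse * b.reverse := by
      rw [← reverse_mul_of_domain, ← he, reverse_reverse' h]
    rcases hp.isUnit_or_isUnit h1 with hu | hu
    · exact Or.inl (key _ (left_ne_zero_of_mul h0) hu)
    · exact Or.inr (key _ (right_ne_zero_of_mul h0) hu)

lemma irr_reverse_iff {p : K[X]} (h : p.coeff 0 ≠ 0) : Irreducible p.reverse ↔ Irreducible p := by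
  refine ⟨fun hp => ?_, irr_reverse h⟩
  have := irr_reverse (p := p.reverse) (by
    rw [coeff_zero_reverse]
    refine leadingCoeff_ne_zero.2 ?_
    rintro rfl; simp at h) hp
  rwa [reverse_reverse' h] at this

lemma aeval_lin_deg {F : MvPolynomial (Fin 3) K} {d : ℕ} (hF : F.IsHomogeneous d) (v : Fin 3 → K[X]) (hv : ∀ i, (v i).natDegree ≤ 1) :
    (MvPolynomial.aeval v F).natDegree ≤ d := by
  refine (Filt.base K).aeval (fun c => ?_) hF _ (fun i => hv i)
  change (C c).natDegree ≤ 0; simp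

lemma fin3_deg {a b c : K[X]} (ha : a.natDegree ≤ 1) (hb : b.natDegree ≤ 1) (hc : c.natDegree ≤ 1) (i : Fin 3) : (![a, b, c] i).natDegree ≤ 1 := by
  fin_cases i
  · exact ha
  · exact hb
  · exact hc

lemma eval_aeval (x : K) (F : MvPolynomial (Fin 3) K) (a b c : K[X]) : (MvPolynomial.aeval ![a, b, c] F).eval x = MvPolynomial.aeval ![a.eval x, b.eval x, c.eval x] F := by
  have h := MvPolynomial.comp_aeval_apply ![a, b, c] (aeval x : K[X] →ₐ[K] K) F
  rw [← coe_aeval_eq_eval, h]; congr 2; funext i; fin_cases i <;> simp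

lemma line_reflect {F : MvPolynomial (Fin 3) K} {d : ℕ} (hF : F.IsHomogeneous d) (t0 a y0 : K) :
    MvPolynomial.aeval ![(X : K[X]), 1 + C t0 * X, C y0 * X + C a] F =
      reflect d (MvPolynomial.aeval ![(1 : K[X]), X + C t0, C a * X + C y0] F) := by
  set L1 := MvPolynomial.aeval ![(1 : K[X]), X + C t0, C a * X + C y0] F with hL
  have hdeg : L1.natDegree ≤ d := aeval_lin_deg hF _ (fin3_deg (by simp) (by compute_degree) (by compute_degree))
  apply IsFractionRing.injective K[X] (FractionRing K[X])
  set x := algebraMap K[X] (FractionRing K[X]) X with hx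
  have hx0 : x ≠ 0 := (map_ne_zero_iff _ (IsFractionRing.injective K[X] _)).2 X_ne_zero
  let φ := IsScalarTower.toAlgHom K K[X] (FractionRing K[X])
  have hC : ∀ c : K, algebraMap K[X] (FractionRing K[X]) (C c) = algebraMap K _ c := fun c =>
    (IsScalarTower.algebraMap_apply K K[X] (FractionRing K[X]) c).symm
  have h1 : algebraMap K[X] (FractionRing K[X]) (MvPolynomial.aeval ![(X : K[X]), 1 + C t0 * X, C y0 * X + C a] F) =
      MvPolynomial.aeval ![x, 1 + algebraMap K _ t0 * x, algebraMap K _ y0 * x + algebraMap K _ a] F := by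
    have h := MvPolynomial.comp_aeval_apply ![(X : K[X]), 1 + C t0 * X, C y0 * X + C a] φ F
    refine Eq.trans h ?_
    congr 2; funext i; fin_cases i <;> simp [φ, hC, hx]
  have h2 : aeval x⁻¹ L1 = MvPolynomial.aeval ![1, x⁻¹ + algebraMap K _ t0, algebraMap K _ a * x⁻¹ + algebraMap K _ y0] F := by
    have h := MvPolynomial.comp_aeval_apply ![(1 : K[X]), X + C t0, C a * X + C y0] (aeval x⁻¹ : K[X] →ₐ[K] _) F
    refine Eq.trans h ?_
    congr 2; funext i; fin_cases i <;> simp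
  have h3 : algebraMap K[X] (FractionRing K[X]) (reflect d L1) = aeval x (reflect d L1) := by
    have := aeval_algebraMap_apply (FractionRing K[X]) (X : K[X]) (reflect d L1)
    rw [aeval_X_left_apply] at this
    exact this.symm
  letI : Invertible x⁻¹ := invertibleOfNonzero (inv_ne_zero hx0)
  have h4 := eval₂_reflect_mul_pow (algebraMap K (FractionRing K[X])) x⁻¹ d L1 hdeg
  rw [invOf_eq_inv, inv_inv, ← aeval_def, ← aeval_def, h2] at h4
  rw [h1, h3, aeval_hom hF x 1 (x⁻¹ + algebraMap K _ t0) (algebraMap K _ a * x⁻¹ + algebraMap K _ y0) _ _ _ (by simp) (by field_simp) (by field_simp; ring), ← h4]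
  rw [inv_pow]
  field_simp

theorem line_irr_iff {F : MvPolynomial (Fin 3) K} {d : ℕ} (hF : F.IsHomogeneous d) (t0 a y0 : K)
    (h1 : MvPolynomial.aeval ![0, 1, a] F ≠ 0) (h2 : MvPolynomial.aeval ![0, 1, y0] (tw t0 F) ≠ 0) :
    Irreducible (MvPolynomial.aeval ![1, X, C y0 * X + C a] (tw t0 F)) ↔
    Irreducible (MvPolynomial.aeval ![X, C a * X + C (y0 - a * t0)] (aff F)) := by
  have e0 := line_reflect hF t0 a y0
  set L1 := MvPolynomial.aeval ![(1 : K[X]), X + C t0, C a * X + C y0] F with hL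
  have hdeg : L1.natDegree ≤ d := aeval_lin_deg hF _ (fin3_deg (by simp) (by compute_degree) (by compute_degree))
  have hc0 : L1.coeff 0 ≠ 0 := by
    rw [aeval_tw] at h2
    rw [coeff_zero_eq_eval_zero, hL, eval_aeval]
    simpa [-MvPolynomial.coe_aeval_eq_eval] using h2
  have hcd : L1.coeff d ≠ 0 := by
    have : (reflect d L1).coeff 0 = L1.coeff d := by rw [coeff_reflect, revAt_zero]
    rw [← this, ← e0, coeff_zero_eq_eval_zero, eval_aeval]
    simpa [-MvPolynomial.coe_aeval_eq_eval] using h1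
  have hd : L1.natDegree = d := le_antisymm hdeg (le_natDegree_of_ne_zero hcd)
  have e1 : MvPolynomial.aeval ![1, X, C y0 * X + C a] (tw t0 F) = L1.reverse := by
    rw [reverse, hd, ← e0, aeval_tw]; rfl
  have e2 : L1 = algEquivAevalXAddC t0 (MvPolynomial.aeval ![X, C a * X + C (y0 - a * t0)] (aff F)) := by
    rw [aeval_aff]
    have h := MvPolynomial.comp_aeval_apply ![1, ![X, C a * X + C (y0 - a * t0)] 0, ![X, C a * X + C (y0 - a * t0)] 1] (algEquivAevalXAddC t0).toAlgHom F
    refine Eq.trans ?_ h.symm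
    rw [hL]
    congr 2
    funext i; fin_cases i <;> simp; ring
  rw [e1, irr_reverse_iff hc0, e2, MulEquiv.irreducible_iff]

end
end LineIrr

end

section
open Polynomial
open Polynomial

namespace LineIrr

section
variable {K k : Type} [Field K] [Field k] [Algebra K k]

lemma map_tw (t0 : K) (F : MvPolynomial (Fin 3) K) : MvPolynomial.map (algebraMap K k) (tw t0 F) = tw (algebraMap K k t0) (MvPolynomial.map (algebraMap K k) F) := by
  have h := MvPolynomial.map_aeval ![MvPolynomial.X 1, MvPolynomial.X 0 + MvPolynomial.C t0 * MvPolynomial.X 1, MvPolynomial.X 2] (MvPolynomial.map (σ := Fin 3) (algebraMap K k)) F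
  rw [tw, h, tw, MvPolynomial.aeval_map_algebraMap, MvPolynomial.aeval_def, ← MvPolynomial.coe_eval₂Hom]
  congr 2
  · ext x; simp [MvPolynomial.algebraMap_eq]; 
  · funext i; fin_cases i <;> simp

lemma map_aff (F : MvPolynomial (Fin 3) K) : MvPolynomial.map (algebraMap K k) (aff F) = aff (MvPolynomial.map (algebraMap K k) F) := by
  have h := MvPolynomial.map_aeval ![1, MvPolynomial.X 0, MvPolynomial.X 1] (MvPolynomial.map (σ := Fin 2) (algebraMap K k)) F
  rw [aff, h, aff, MvPolynomial.aeval_map_algebraMap, MvPolynomial.aeval_def, ← MvPolynomial.coe_eval₂Hom]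
  congr 2
  · ext x; simp [MvPolynomial.algebraMap_eq]
  · funext i; fin_cases i <;> simp

lemma map_GG (c : K) (F : MvPolynomial (Fin 3) K) : (GG c F).map (mapRingHom (algebraMap K k)) = GG (algebraMap K k c) (MvPolynomial.map (algebraMap K k) F) := by
  have h := MvPolynomial.map_aeval ![1, X, C (C c) * X + C X] (mapRingHom (mapRingHom (algebraMap K k))) F
  rw [coe_mapRingHom] at h
  rw [GG, h, GG, MvPolynomial.aeval_map_algebraMap, MvPolynomial.aeval_def, ← MvPolynomial.coe_eval₂Hom]
  congr 2
  · ext x : 1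
    simp only [RingHom.comp_apply]
    rw [show algebraMap K K[X][X] x = C (C x) from rfl, show algebraMap K k[X][X] x = C (C (algebraMap K k x)) from rfl]
    simp
  · funext i; fin_cases i <;> simp

lemma aeval_algMap (F : MvPolynomial (Fin 3) K) (a b c : K) : MvPolynomial.aeval ![algebraMap K k a, algebraMap K k b, algebraMap K k c] F =
    algebraMap K k (MvPolynomial.aeval ![a, b, c] F) := by
  rw [← MvPolynomial.aeval_algebraMap_apply]
  congr 2; funext i; fin_cases i <;> rfl

open Classical in
lemma card_roots_le [Fintype K] (R : k[X]) (hR : R ≠ 0) : (Finset.univ.filter fun t : K => R.eval (algebraMap K k t) = 0).card ≤ R.natDegree := by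
  refine le_trans ?_ ((Multiset.toFinset_card_le R.roots).trans (card_roots' R))
  refine Finset.card_le_card_of_injOn (algebraMap K k) (fun t ht => ?_) ((algebraMap K k).injective.injOn)
  simp only [Finset.coe_filter, Finset.mem_univ, true_and, Set.mem_setOf_eq] at ht
  simp [hR, ht]

lemma totalDegree_map' (f : MvPolynomial (Fin 2) K) : (MvPolynomial.map (algebraMap K k) f).totalDegree = f.totalDegree :=
  by rw [MvPolynomial.totalDegree, MvPolynomial.support_map_of_injective _ (algebraMap K k).injective, MvPolynomial.totalDegree]

lemma scalar_desc (f g : MvPolynomial (Fin 2) K) (u : k) (hf : f ≠ 0) (h : MvPolynomial.map (algebraMap K k) g = MvPolynomial.C u * MvPolynomial.map (algebraMap K k) f) :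
    ∃ c : K, g = c • f := by
  obtain ⟨n, hn⟩ := MvPolynomial.ne_zero_iff.1 hf
  have hco : ∀ n, algebraMap K k (g.coeff n) = u * algebraMap K k (f.coeff n) := by
    intro n
    have := congrArg (MvPolynomial.coeff n) h
    rwa [MvPolynomial.coeff_map, MvPolynomial.coeff_C_mul, MvPolynomial.coeff_map] at this
  have hu : u = algebraMap K k (g.coeff n / f.coeff n) := by
    rw [map_div₀, hco n, mul_div_cancel_right₀]
    exact (map_ne_zero_iff _ (algebraMap K k).injective).2 hn
  refine ⟨g.coeff n / f.coeff n, ?_⟩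
  ext l
  apply (algebraMap K k).injective
  rw [hco, MvPolynomial.coeff_smul, smul_eq_mul, map_mul, hu]

/-- input data -/
structure Dat (K k : Type) [Field K] [Field k] [Algebra K k] (r : ℕ) (d : Fin r → ℕ) where
  F : Fin r → MvPolynomial (Fin 3) K
  hom : ∀ i, (F i).IsHomogeneous (d i)
  deg : ∀ i, (aff (F i)).totalDegree = d i
  hd : ∀ i, 2 ≤ d i
  hc : ∀ i, ((d i * (d i - 1) : ℕ) : k) ≠ 0
  irr : ∀ i, Irreducible (MvPolynomial.map (algebraMap K k) (aff (F i)))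
  nas : ∀ i j, i ≠ j → ∀ c : K, aff (F i) ≠ c • aff (F j)
  sm : ∀ i, Sm (MvPolynomial.map (algebraMap K k) (F i))

variable [IsAlgClosed k] {r : ℕ} {d : Fin r → ℕ} (Z : Dat K k r d)

namespace Dat

noncomputable def Fk (i : Fin r) : MvPolynomial (Fin 3) k := MvPolynomial.map (algebraMap K k) (Z.F i)

lemma Fk_hom (i) : (Z.Fk i).IsHomogeneous (d i) := (Z.hom i).map _
lemma Fk_irr (i) : Irreducible (aff (Z.Fk i)) := by rw [Fk, ← map_aff]; exact Z.irr i
lemma Fk_deg (i) : (aff (Z.Fk i)).totalDegree = d i := by rw [Fk, ← map_aff, totalDegree_map']; exact Z.deg i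

lemma exists_R (m : ℕ) (hm : ∑ i, d i ≤ m) : ∃ R : k[X], R ≠ 0 ∧ R.natDegree ≤ 2 * m ^ 2 + m ∧ ∀ t0, R.eval t0 ≠ 0 → ∀ i, GoodT t0 (Z.Fk i) := by
  choose R h0 h1 h2 using fun i => exists_bad (Z.Fk_hom i) (Z.sm i) (Z.hc i) (Z.hd i) (Z.Fk_deg i) (Z.Fk_irr i)
  refine ⟨∏ i, R i, Finset.prod_ne_zero_iff.2 fun i _ => h0 i, ?_, fun t0 ht i => ?_⟩
  · refine (natDegree_prod_le _ _).trans ?_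
    calc ∑ i, (R i).natDegree ≤ ∑ i, (2 * m + 1) * d i := Finset.sum_le_sum fun i _ => by
            have e1 := h1 i
            have e2 := Z.hd i
            have e3 : d i ≤ m := (Finset.single_le_sum (f := d) (fun _ _ => Nat.zero_le _) (Finset.mem_univ i)).trans hm
            have e4 := Nat.mul_le_mul_right (d i) e3
            nlinarith
      _ = (2 * m + 1) * ∑ i, d i := by rw [Finset.mul_sum]
      _ ≤ (2 * m + 1) * m := Nat.mul_le_mul_left _ hm
      _ = _ := by ring
  · rw [eval_prod, Finset.prod_ne_zero_iff] at ht
    exact h2 i t0 (ht i (Finset.mem_univ _))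

noncomputable def crv (t0 : k) (h : ∀ i, GoodT t0 (Z.Fk i)) (i : Fin r) : Crv k (d i) where
  F := tw t0 (Z.Fk i)
  hom := tw_hom t0 (Z.Fk_hom i)
  smooth := tw_smooth t0 (Z.Fk_hom i) (Z.sm i)
  trans := tw_trans t0 (h i)
  irr := tw_irr t0 (Z.Fk_hom i) (Z.Fk_irr i) (Z.Fk_deg i) (Z.hd i)
  hd := Z.hd i
  hc := Z.hc i

lemma crv_nd (t0 : k) (h : ∀ i, GoodT t0 (Z.Fk i)) (i j : Fin r) (hij : i ≠ j) : ¬ aff (Z.crv t0 h i).F ∣ aff (Z.crv t0 h j).F := by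
  intro hdvd
  obtain ⟨u, hu⟩ := tw_not_dvd t0 (Z.Fk_hom i) (Z.Fk_hom j) (Z.Fk_irr i) (Z.Fk_irr j) (Z.crv t0 h i).irr (Z.crv t0 h j).irr hdvd
  rw [Fk, Fk, ← map_aff, ← map_aff] at hu
  obtain ⟨c, hc⟩ := scalar_desc _ _ u (by
    intro h0
    have := (Z.irr i).ne_zero
    rw [h0, map_zero] at this; exact this rfl) hu
  exact Z.nas j i hij.symm c hc

end Dat
end
end LineIrr

end

section
open Polynomial
open Polynomial

namespace LineIrr

section
variable {K k : Type} [Field K] [Fintype K] [Field k] [Algebra K k] [IsAlgClosed k] {r : ℕ} {d : Fin r → ℕ} (Z : Dat K k r d)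

namespace Dat

/-- the line condition -/
def LP (a b : K) : Prop := ∀ i, Irreducible (MvPolynomial.aeval ![X, C a * X + C b] (aff (Z.F i)))

open Classical in
lemma bad_a (m : ℕ) (hm : ∑ i, d i ≤ m) : (Finset.univ.filter fun a : K => ∃ i, MvPolynomial.aeval ![0, 1, a] (Z.F i) = 0).card ≤ m := by
  have hne : ∏ i, MvPolynomial.aeval ![0, 1, (X : K[X])] (Z.F i) ≠ 0 := Finset.prod_ne_zero_iff.2 fun i _ => top_ne (Z.hom i) (Z.deg i) (Z.hd i)
  have h := card_roots_le (K := K) (k := K) _ hne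
  refine le_trans ?_ (h.trans ?_)
  · refine Finset.card_le_card fun a ha => ?_
    simp only [Finset.mem_filter, Finset.mem_univ, true_and] at ha ⊢
    obtain ⟨i, hi⟩ := ha
    rw [eval_prod]
    refine Finset.prod_eq_zero (Finset.mem_univ i) ?_
    rw [eval_aeval]
    simpa [-MvPolynomial.coe_aeval_eq_eval] using hi
  · refine (natDegree_prod_le _ _).trans ((Finset.sum_le_sum fun i _ => ?_).trans hm)
    exact aeval_lin_deg (Z.hom i) _ (fin3_deg (by simp) (by simp) (by simp))

lemma card_diff {α : Type*} [DecidableEq α] (A B S : Finset α) (h : ∀ a, a ∉ S → (a ∈ A ↔ a ∈ B)) : |(A.card : ℝ) - B.card| ≤ S.card := by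
  have h1 : A.card ≤ B.card + S.card := (Finset.card_le_card (fun a ha => by
    rw [Finset.mem_union]
    by_cases hs : a ∈ S
    · exact Or.inr hs
    · exact Or.inl ((h a hs).1 ha))).trans (Finset.card_union_le _ _)
  have h2 : B.card ≤ A.card + S.card := (Finset.card_le_card (fun a ha => by
    rw [Finset.mem_union]
    by_cases hs : a ∈ S
    · exact Or.inr hs
    · exact Or.inl ((h a hs).2 ha))).trans (Finset.card_union_le _ _)
  rw [abs_le]
  have h1' : (A.card : ℝ) ≤ B.card + S.card := by exact_mod_cast h1
  have h2' : (B.card : ℝ) ≤ A.card + S.card := by exact_mod_cast h2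
  constructor <;> linarith

open Classical in
lemma good_y (m : ℕ) (hm : ∑ i, d i ≤ m) (Cst : ℝ) (hC : ∀ (F : Fam k r d)
    (g : Fin r → K[X][X]) (_hg : ∀ i, F.g i = (g i).map (mapRingHom (algebraMap K k))),
    |((Finset.univ.filter fun a0 : K => ∀ i, Irreducible ((g i).map (evalRingHom a0))).card : ℝ) -
      (Fintype.card K : ℝ) / (∏ i, d i : ℕ)| ≤ Cst * √(Fintype.card K : ℝ)) (t0 y : K)
    (h : ∀ i, GoodT (algebraMap K k t0) (Z.Fk i)) (hl : ∀ i, (Z.crv _ h i).lam (algebraMap K k y) ≠ 0)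
    (Fm : Fam k r d) (hF : ∀ i, Fm.g i = (Z.crv _ h i).nG (algebraMap K k y)) :
    |((Finset.univ.filter fun a : K => Z.LP a (y - a * t0)).card : ℝ) - (Fintype.card K : ℝ) / (∏ i, d i : ℕ)| ≤ Cst * √(Fintype.card K : ℝ) + m := by
  set lamK : Fin r → K := fun i => MvPolynomial.aeval ![0, 1, y] (tw t0 (Z.F i)) with hlamK
  have hcF : ∀ i, (Z.crv _ h i).F = MvPolynomial.map (algebraMap K k) (tw t0 (Z.F i)) := fun i => (map_tw t0 (Z.F i)).symm
  have hlam : ∀ i, (Z.crv _ h i).lam (algebraMap K k y) = algebraMap K k (lamK i) := by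
    intro i
    rw [Crv.lam, hcF, MvPolynomial.aeval_map_algebraMap]
    have := aeval_algMap (k := k) (tw t0 (Z.F i)) 0 1 y
    rw [map_zero, map_one] at this
    exact this
  have hlne : ∀ i, lamK i ≠ 0 := by
    intro i h0
    apply hl i
    rw [hlam, h0, map_zero]
  set g : Fin r → K[X][X] := fun i => C (C (lamK i)⁻¹) * GG y (tw t0 (Z.F i)) with hg
  have h1 := hC Fm g (fun i => by
    rw [hF, Crv.nG, hlam, hcF, hg]
    simp only [Polynomial.map_mul, map_C, coe_mapRingHom, map_GG, map_inv₀])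
  have h2 : |((Finset.univ.filter fun a : K => Z.LP a (y - a * t0)).card : ℝ) - 
      (Finset.univ.filter fun a0 : K => ∀ i, Irreducible ((g i).map (evalRingHom a0))).card| ≤ m := by
    refine (card_diff _ _ (Finset.univ.filter fun a : K => ∃ i, MvPolynomial.aeval ![0, 1, a] (Z.F i) = 0) fun a ha => ?_).trans
      (by exact_mod_cast Z.bad_a m hm)
    simp only [Finset.mem_filter, Finset.mem_univ, true_and, not_exists] at ha ⊢
    refine forall_congr' fun i => ?_
    rw [← line_irr_iff (Z.hom i) t0 a y (ha i) (hlne i), hg]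
    simp only [Polynomial.map_mul, map_C, coe_evalRingHom, eval_C, GG_map_eval]
    rw [irreducible_isUnit_mul]
    exact isUnit_C.2 (IsUnit.mk0 _ (inv_ne_zero (hlne i)))
  have := abs_sub_le ((Finset.univ.filter fun a : K => Z.LP a (y - a * t0)).card : ℝ)
    (Finset.univ.filter fun a0 : K => ∀ i, Irreducible ((g i).map (evalRingHom a0))).card ((Fintype.card K : ℝ) / (∏ i, d i : ℕ))
  linarith

end Dat

open Classical in
lemma card_pencil (P : K → K → Prop) (t0 : K) : Nat.card {a : K × K // P a.1 a.2} = ∑ y : K, (Finset.univ.filter fun a : K => P a (y - a * t0)).card := by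
  rw [Nat.card_eq_fintype_card, Fintype.card_subtype,
    Finset.card_eq_sum_card_fiberwise (t := Finset.univ) (f := fun a : K × K => a.2 + a.1 * t0) (fun _ _ => Finset.mem_univ _)]
  refine Finset.sum_congr rfl fun y _ => ?_
  refine Finset.card_bij' (fun a _ => a.1) (fun a _ => (a, y - a * t0)) ?_ ?_ ?_ ?_
  · rintro ⟨a, b⟩ h
    simp only [Finset.mem_filter, Finset.mem_univ, true_and] at h ⊢
    rw [← h.2, add_sub_cancel_right]; exact h.1
  · intro a h
    simp only [Finset.mem_filter, Finset.mem_univ, true_and] at h ⊢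
    exact ⟨h, by ring⟩
  · rintro ⟨a, b⟩ h
    simp only [Finset.mem_filter, Finset.mem_univ, true_and] at h ⊢
    rw [← h.2, add_sub_cancel_right]
  · intros; rfl

end

lemma triv_bd (n q : ℝ) (D : ℕ) (h0 : 0 ≤ n) (h1 : n ≤ q) (hD : 1 ≤ D) : |n - q / D| ≤ q := by
  have hD' : (1 : ℝ) ≤ D := by exact_mod_cast hD
  have hq := h0.trans h1
  have e1 : q / D ≤ q := div_le_self hq hD'
  have e2 : 0 ≤ q / D := by positivity
  rw [abs_le]; constructor <;> linarith

theorem main_count (m : ℕ) : ∃ C : ℝ, ∀ (K k : Type) [Field K] [Fintype K] [Field k] [IsAlgClosed k] [Algebra K k] (r : ℕ) (d : Fin r → ℕ)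
    (Z : Dat K k r d) (_hm : ∑ i, d i ≤ m), 
    |(Nat.card {a : K × K // Z.LP a.1 a.2} : ℝ) - (Fintype.card K : ℝ) ^ 2 / (∏ i, d i : ℕ)| ≤ C * (Fintype.card K : ℝ) ^ ((3 : ℝ) / 2) := by
  classical
  obtain ⟨C0, hC0, hC⟩ := fam_count m
  refine ⟨(2 * m ^ 2 + m : ℕ) + (C0 + m + (4 * m ^ 4 + m : ℕ)), ?_⟩
  intro K k _ _ _ _ _ r d Z hm
  set q := Fintype.card K with hq
  have hq1 : 1 ≤ q := Fintype.card_pos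
  have hq1' : (1 : ℝ) ≤ q := by exact_mod_cast hq1
  set s := √(q : ℝ) with hs
  have hs1 : 1 ≤ s := by rw [hs]; exact Real.one_le_sqrt.2 hq1'
  have hss : s * s = q := Real.mul_self_sqrt (by positivity)
  have h32 : (q : ℝ) ^ ((3 : ℝ) / 2) = q * s := by
    rw [show (3 : ℝ) / 2 = 1 + 1 / 2 by norm_num, Real.rpow_add (by positivity), Real.rpow_one, ← Real.sqrt_eq_rpow]
  rw [h32]
  have hD : 1 ≤ ∏ i, d i := Nat.one_le_iff_ne_zero.2 (Finset.prod_ne_zero_iff.2 fun i _ => by have := Z.hd i; omega)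
  have hnn : 0 ≤ (q : ℝ) * s := by positivity
  by_cases hsm : q ≤ 2 * m ^ 2 + m
  · have h1 : Nat.card {a : K × K // Z.LP a.1 a.2} ≤ q ^ 2 := by
      rw [Nat.card_eq_fintype_card]
      refine (Fintype.card_subtype_le _).trans ?_
      rw [Fintype.card_prod, sq]
    have h2 := triv_bd (Nat.card {a : K × K // Z.LP a.1 a.2}) ((q : ℝ) ^ 2) (∏ i, d i) (by positivity) (by exact_mod_cast h1) hD
    refine h2.trans ?_
    have h3 : (q : ℝ) ≤ (2 * m ^ 2 + m : ℕ) := by exact_mod_cast hsm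
    have h4 : s ≤ q := by nlinarith
    have h5 : (q : ℝ) ^ 2 ≤ (2 * m ^ 2 + m : ℕ) * (q * s) := by
      rw [sq]
      have : (q : ℝ) * q ≤ q * ((2 * m ^ 2 + m : ℕ) * s) := by
        refine mul_le_mul_of_nonneg_left ?_ (by positivity)
        nlinarith
      linarith
    have h6 : 0 ≤ (C0 + m + (4 * m ^ 4 + m : ℕ)) * (q * s) := by positivity
    rw [add_mul]
    linarith
  · obtain ⟨R, hR0, hRd, hR⟩ := Z.exists_R m hm
    obtain ⟨t0, ht0⟩ : ∃ t0 : K, R.eval (algebraMap K k t0) ≠ 0 := by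
      by_contra! hcon
      have := card_roots_le (K := K) R hR0
      rw [Finset.filter_true_of_mem (fun t _ => hcon t), Finset.card_univ] at this
      omega
    have hG := hR _ ht0
    obtain ⟨ρ, hρ0, hρd, hρ⟩ := exists_rho (Z.crv _ hG) m hm (Z.crv_nd _ hG)
    set n : K → ℕ := fun y => (Finset.univ.filter fun a : K => Z.LP a (y - a * t0)).card with hn
    set D := ∏ i, d i with hDdef
    have hN : (Nat.card {a : K × K // Z.LP a.1 a.2} : ℝ) - (q : ℝ) ^ 2 / (D : ℕ) = ∑ y : K, ((n y : ℝ) - q / (D : ℕ)) := by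
      rw [card_pencil Z.LP t0, Finset.sum_sub_distrib, Finset.sum_const, Finset.card_univ, nsmul_eq_mul]
      push_cast
      rw [← hq]; ring
    rw [hN]
    have hy : ∀ y : K, |(n y : ℝ) - q / (D : ℕ)| ≤ (C0 * s + m) + (if ρ.eval (algebraMap K k y) = 0 then (q : ℝ) else 0) := by
      intro y
      split_ifs with hbad
      · have h1 : n y ≤ q := (Finset.card_filter_le _ _).trans_eq Finset.card_univ
        have := triv_bd (n y) q D (by positivity) (by exact_mod_cast h1) hD
        have : 0 ≤ C0 * s + m := by positivity
        linarith
      · obtain ⟨hl, Fm, hFm⟩ := hρ _ hbad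
        rw [add_zero]
        exact Z.good_y m hm C0 (fun F g hg => hC K k r d F g hg Z.hd hm) t0 y hG hl Fm hFm
    refine (Finset.abs_sum_le_sum_abs _ _).trans ((Finset.sum_le_sum fun y _ => hy y).trans ?_)
    rw [Finset.sum_add_distrib, Finset.sum_const, Finset.card_univ, nsmul_eq_mul, ← hq, ← Finset.sum_filter, Finset.sum_const, nsmul_eq_mul]
    have hb : ((Finset.univ.filter fun y : K => ρ.eval (algebraMap K k y) = 0).card : ℝ) ≤ (4 * m ^ 4 + m : ℕ) := by
      exact_mod_cast (card_roots_le ρ hρ0).trans hρd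
    have e1 : ((Finset.univ.filter fun y : K => ρ.eval (algebraMap K k y) = 0).card : ℝ) * q ≤ (4 * m ^ 4 + m : ℕ) * (q * s) := by
      refine mul_le_mul hb ?_ (by positivity) (by positivity)
      nlinarith
    have e2 : (m : ℝ) * q ≤ m * (q * s) := by
      refine mul_le_mul_of_nonneg_left ?_ (by positivity)
      nlinarith
    have e3 : 0 ≤ ((2 * m ^ 2 + m : ℕ) : ℝ) * (q * s) := by positivity
    nlinarith

end LineIrr

end

open MvPolynomial

/-- for every `m > 0` there is a constant `C = C(m)` such that for every
finite field `K` with `q` elements and characteristic `p` and all pairwise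
non-associate absolutely irreducible `f₁, …, f_r ∈ K[T,X]` with total degrees
`d_i ≥ 2`, `p ∤ d_i(d_i − 1)`, smooth homogenizations, and `∑ d_i ≤ m`, the number
`N` of pairs `(a₁,a₂) ∈ K²` with all `f_i(T, a₁T + a₂)` irreducible in `K[T]`
satisfies `|N − q²/d| ≤ C·q^{3/2}` where `d = ∏ d_i`. -/
theorem card_irreducible_line_substitutions (m : ℕ) (hm : 0 < m) :
    ∃ C : ℝ, ∀ (K : Type) (_ : Field K) (_ : Fintype K) (q p : ℕ),
      Fintype.card K = q → CharP K p →
      ∀ (r : ℕ) (f : Fin r → MvPolynomial (Fin 2) K) (d : Fin r → ℕ),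
      (∀ i, d i = (f i).totalDegree) →
      (∀ i, 2 ≤ d i) →
      (∀ i, ¬ (p ∣ d i * (d i - 1))) →
      (∀ i, AbsolutelyIrreducible (f i)) →
      (∀ i j, i ≠ j → ∀ c : K, f i ≠ c • f j) →
      (∀ i, ∃ F : MvPolynomial (Fin 3) K, IsSmoothHomogenization F (f i) (d i)) →
      (∑ i, d i) ≤ m →
      |(Nat.card {a : K × K // ∀ i, Irreducible (lineSub (f i) a.1 a.2)} : ℝ) -
          (q : ℝ) ^ 2 / (∏ i, d i : ℕ)| ≤ C * (q : ℝ) ^ ((3 : ℝ) / 2) := by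
  obtain ⟨C, hC⟩ := LineIrr.main_count m
  refine ⟨C, ?_⟩
  intro K _ _ q p hq hp r f d hdeg hd hpd hirr hnas hsm hsum
  choose F hF using hsm
  subst hq
  let Z : LineIrr.Dat K (AlgebraicClosure K) r d :=
    { F := F
      hom := fun i => (hF i).1
      deg := fun i => by
        rw [show LineIrr.aff (F i) = f i from (hF i).2.1]; exact (hdeg i).symm
      hd := hd
      hc := fun i h => by
        haveI : CharP (AlgebraicClosure K) p :=
          charP_of_injective_algebraMap (algebraMap K (AlgebraicClosure K)).injective p
        exact hpd i ((CharP.cast_eq_zero_iff (AlgebraicClosure K) p _).1 h)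
      irr := fun i => by
        rw [show LineIrr.aff (F i) = f i from (hF i).2.1]; exact hirr i
      nas := fun i j hij c => by
        rw [show LineIrr.aff (F i) = f i from (hF i).2.1, show LineIrr.aff (F j) = f j from (hF j).2.1]
        exact hnas i j hij c
      sm := fun i x hx h0 => by
        obtain ⟨j, hj⟩ := (hF i).2.2 x hx (by rw [← MvPolynomial.coe_aeval_eq_eval]; exact h0)
        refine ⟨j, ?_⟩
        rw [← MvPolynomial.coe_aeval_eq_eval] at hj
        rw [MvPolynomial.pderiv_map]
        exact hj }
  have h := hC K (AlgebraicClosure K) r d Z hsum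
  have he : ∀ a : K × K, Z.LP a.1 a.2 ↔ ∀ i, Irreducible (lineSub (f i) a.1 a.2) := fun a =>
    forall_congr' fun i => by
      rw [show LineIrr.aff (Z.F i) = f i from (hF i).2.1]; rfl
  rw [Nat.card_congr (Equiv.subtypeEquivRight he)] at h
  exact h
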